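/- Let G=(V,E) be a finite simple graph, let P ⊆ V, and let v ∈ V∖P. Then v is uniquely localizable in G with respect to P in ℝ² if and only if |P| ≥ 3 and there is an ℛ₂-component H of G+K(P) with P ∪ {v} ⊆ V(H) and κ_H(v,b) ≥ 3 for all b ∈ P. -/

import Mathlib

open scoped BigOperators

noncomputable section

namespace Rigidity

variable {V : Type*}

/-- Euclidean distance between two points of `ℝ^d` (given as coordinate functions). -/
def eDist {d : ℕ} (x y : Fin d → ℝ) : ℝ := Real.sqrt (∑ i, (x i - y i) ^ 2)

/-- Two frameworks `(G,p)` and `(G,q)` are equivalent if corresponding edge lengths agree. -/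
def Equivalent {d : ℕ} (G : SimpleGraph V) (p q : V → Fin d → ℝ) : Prop :=
  ∀ u v : V, G.Adj u v → eDist (p u) (p v) = eDist (q u) (q v)

/-- Two placements are congruent if all pairwise distances agree. -/
def Congruent {d : ℕ} (p q : V → Fin d → ℝ) : Prop :=
  ∀ u v : V, eDist (p u) (p v) = eDist (q u) (q v)

/-- A placement is generic if the multiset of its coordinates is algebraically
independent over `ℚ`. -/
def Generic {d : ℕ} (p : V → Fin d → ℝ) : Prop :=
  AlgebraicIndependent ℚ (fun vi : V × Fin d => p vi.1 vi.2)

/-- `{u,v}` is globally linked in the framework `(G,p)`. -/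
def GloballyLinkedIn {d : ℕ} (G : SimpleGraph V) (p : V → Fin d → ℝ) (u v : V) : Prop :=
  ∀ q : V → Fin d → ℝ, Equivalent G p q → eDist (q u) (q v) = eDist (p u) (p v)

/-- `{u,v}` is globally `d`-linked in `G`. -/
def GloballyLinked (d : ℕ) (G : SimpleGraph V) (u v : V) : Prop :=
  ∀ p : V → Fin d → ℝ, Generic p → GloballyLinkedIn G p u v

/-- The framework `(G,p)` is rigid. -/
def RigidFramework {d : ℕ} (G : SimpleGraph V) (p : V → Fin d → ℝ) : Prop :=
  ∃ ε > (0:ℝ), ∀ q : V → Fin d → ℝ, Equivalent G p q →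
    (∀ v, eDist (p v) (q v) < ε) → Congruent p q

/-- `G` is `d`-rigid: every generic framework of `G` in `ℝ^d` is rigid. -/
def IsRigidGraph (d : ℕ) (G : SimpleGraph V) : Prop :=
  ∀ p : V → Fin d → ℝ, Generic p → RigidFramework G p

/-- The framework `(G,p)` is globally rigid. -/
def GloballyRigidFramework {d : ℕ} (G : SimpleGraph V) (p : V → Fin d → ℝ) : Prop :=
  ∀ q : V → Fin d → ℝ, Equivalent G p q → Congruent p q

/-- The row of the rigidity matrix corresponding to the (ordered) edge `(u,v)`. -/
def edgeVec [DecidableEq V] {d : ℕ} (p : V → Fin d → ℝ) (u v : V) : V × Fin d → ℝ :=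
  fun wi => if wi.1 = u then p u wi.2 - p v wi.2
            else if wi.1 = v then p v wi.2 - p u wi.2 else 0

/-- The rank of the set of rows of the rigidity matrix of `(·,p)` indexed by `F`. -/
def rankAt [DecidableEq V] (d : ℕ) (p : V → Fin d → ℝ) (F : Set (Sym2 V)) : ℕ :=
  Module.finrank ℝ (Submodule.span ℝ
    {x : V × Fin d → ℝ | ∃ u v : V, s(u, v) ∈ F ∧ x = edgeVec p u v})

/-- `r_d(F)`: the rank of the set of rows indexed by `F` of the rigidity matrix of a
generic framework, equivalently the maximum of this rank over all placements. -/
def rd [DecidableEq V] (d : ℕ) (F : Set (Sym2 V)) : ℕ :=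
  sSup {n : ℕ | ∃ p : V → Fin d → ℝ, n = rankAt d p F}

/-- An edge set is `ℛ_d`-independent if its rank equals its cardinality. -/
def RdIndep [DecidableEq V] (d : ℕ) (F : Set (Sym2 V)) : Prop := rd d F = F.ncard

/-- An `ℛ_d`-circuit: not independent, but every proper subset is independent. -/
def RdCircuit [DecidableEq V] (d : ℕ) (C : Set (Sym2 V)) : Prop :=
  ¬ RdIndep d C ∧ ∀ C' : Set (Sym2 V), C' ⊂ C → RdIndep d C'

/-- An `ℛ_d`-circuit of the graph `G`. -/
def RdCircuitOf [DecidableEq V] (d : ℕ) (G : SimpleGraph V) (C : Set (Sym2 V)) : Prop :=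
  C ⊆ G.edgeSet ∧ RdCircuit d C

/-- `F` is (the edge set of) an `ℛ_d`-component of `G`: an equivalence class of the
relation "`e = f` or some `ℛ_d`-circuit of `G` contains both `e` and `f`". -/
def IsRdComponent [DecidableEq V] (d : ℕ) (G : SimpleGraph V) (F : Set (Sym2 V)) : Prop :=
  ∃ e ∈ G.edgeSet, F = {f | f ∈ G.edgeSet ∧
    (e = f ∨ ∃ C, RdCircuitOf d G C ∧ e ∈ C ∧ f ∈ C)}

/-- The set of vertices covered by an edge set. -/
def vertexSpan (F : Set (Sym2 V)) : Set V := {v | ∃ e ∈ F, v ∈ e}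

/-- A nonempty edge set is `ℛ_d`-connected if any two of its edges lie on a common
`ℛ_d`-circuit contained in it (or are equal). -/
def RdConnectedSet [DecidableEq V] (d : ℕ) (F : Set (Sym2 V)) : Prop :=
  F.Nonempty ∧ ∀ e ∈ F, ∀ f ∈ F, e = f ∨ ∃ C, C ⊆ F ∧ RdCircuit d C ∧ e ∈ C ∧ f ∈ C

/-- A graph (with at least one edge) is `ℛ_d`-connected. -/
def RdConnected [DecidableEq V] (d : ℕ) (H : SimpleGraph V) : Prop :=
  RdConnectedSet d H.edgeSet

/-- `e` is an `ℛ_d`-bridge of `G`: `r_d(E ∖ {e}) = r_d(E) − 1`. -/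
def IsRdBridge [DecidableEq V] (d : ℕ) (G : SimpleGraph V) (e : Sym2 V) : Prop :=
  e ∈ G.edgeSet ∧ rd d (G.edgeSet \ {e}) + 1 = rd d G.edgeSet

/-- `G + uv`. -/
def addEdge (G : SimpleGraph V) (u v : V) : SimpleGraph V :=
  G ⊔ SimpleGraph.fromEdgeSet {s(u, v)}

/-- `{u,v}` is `d`-linked in `G` if `r_d(G+uv) = r_d(G)`. -/
def IsLinked [DecidableEq V] (d : ℕ) (G : SimpleGraph V) (u v : V) : Prop :=
  rd d (addEdge G u v).edgeSet = rd d G.edgeSet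

/-- There exist `k` pairwise internally vertex-disjoint `u`–`v` paths in `H`
(i.e. `κ_H(u,v) ≥ k`). -/
def InternallyDisjointPaths (H : SimpleGraph V) (u v : V) (k : ℕ) : Prop :=
  ∃ P : Fin k → H.Walk u v, (∀ i, (P i).IsPath) ∧
    ∀ i j, i ≠ j → ∀ w, w ∈ (P i).support → w ∈ (P j).support → w = u ∨ w = v

/-- An unordered pair forming a 2-separator: two distinct vertices whose deletion
disconnects the graph. -/
def TwoSepPair (H : SimpleGraph V) (e : Sym2 V) : Prop :=
  ¬ e.IsDiag ∧ ¬ (H.induce {v | v ∉ e}).Connected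

/-- The augmented graph `Ĥ`: add an edge for every 2-separator. -/
def aug (H : SimpleGraph V) : SimpleGraph V :=
  H ⊔ SimpleGraph.fromEdgeSet {e | TwoSepPair H e}

/-- A subgraph is 3-connected: at least 4 vertices, and deleting fewer than 3
vertices leaves it connected. -/
def IsThreeConnectedSubgraph {G : SimpleGraph V} (J : G.Subgraph) : Prop :=
  4 ≤ J.verts.ncard ∧ ∀ S : Set V, S.ncard < 3 → (J.deleteVerts S).coe.Connected

/-- A 3-block of `H`: a maximal 3-connected subgraph of the augmented graph `Ĥ`. -/
def IsThreeBlock (H : SimpleGraph V) (J : (aug H).Subgraph) : Prop :=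
  IsThreeConnectedSubgraph J ∧
    ∀ J' : (aug H).Subgraph, IsThreeConnectedSubgraph J' → J ≤ J' → J = J'

/-- `h_H(e)`: the number of 3-blocks of `H` containing both vertices of `e`. -/
def numBlocksOn (H : SimpleGraph V) (e : Sym2 V) : ℕ :=
  {J : (aug H).Subgraph | IsThreeBlock H J ∧ ∀ v ∈ e, v ∈ J.verts}.ncard

open Classical in
/-- `k(H) = Σ (h_H(ab) − 1)` over all 2-separators `{a,b}` of `H`. -/
def kGraph [Fintype V] [DecidableEq V] (H : SimpleGraph V) : ℕ :=
  ∑ e : Sym2 V, if TwoSepPair H e then numBlocksOn H e - 1 else 0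

/-- The graph of an `ℛ₂`-component, on its own vertex set. -/
def componentGraph [DecidableEq V] (F : Set (Sym2 V)) :
    SimpleGraph (vertexSpan F) :=
  (SimpleGraph.fromEdgeSet F).induce (vertexSpan F)

/-- `X` is the vertex set of an `ℛ_d`-block of `G`: a 3-block of a non-trivial
`ℛ_d`-component of `G`. -/
def IsRdBlockVerts [DecidableEq V] (d : ℕ) (G : SimpleGraph V) (X : Set V) : Prop :=
  ∃ F : Set (Sym2 V), IsRdComponent d G F ∧ 2 ≤ F.ncard ∧
    ∃ J : (aug (componentGraph F)).Subgraph,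
      IsThreeBlock (componentGraph F) J ∧ X = Subtype.val '' J.verts

/-- The globally linked closure of `G` in `ℝ^d`. -/
def glc (d : ℕ) (G : SimpleGraph V) : SimpleGraph V :=
  G ⊔ SimpleGraph.fromEdgeSet {e | ∃ u v : V, e = s(u, v) ∧ GloballyLinked d G u v}

/-- A globally `d`-linked cluster: the vertex set of a maximal complete subgraph of
`glc_d(G)`. -/
def IsCluster (d : ℕ) (G : SimpleGraph V) (X : Set V) : Prop :=
  (∀ a ∈ X, ∀ b ∈ X, a ≠ b → (glc d G).Adj a b) ∧
    ∀ Y : Set V, X ⊆ Y → (∀ a ∈ Y, ∀ b ∈ Y, a ≠ b → (glc d G).Adj a b) → Y = X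

/-- Equilibrium stress of a framework, encoded as a symmetric function vanishing on
non-edges. -/
def IsEqStress [Fintype V] {d : ℕ} (G : SimpleGraph V) (p : V → Fin d → ℝ)
    (ω : V → V → ℝ) : Prop :=
  (∀ u v, ω u v = ω v u) ∧ (∀ u v, ¬ G.Adj u v → ω u v = 0) ∧
    ∀ u, ∑ v, ω u v • (p u - p v) = 0

/-- `{u,v}` is `d`-stress-linked in `G`. -/
def StressLinked [Fintype V] (d : ℕ) (G : SimpleGraph V) (u v : V) : Prop :=
  ∀ p : V → Fin d → ℝ, Generic p → ∀ q : V → Fin d → ℝ,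
    (∀ ω, IsEqStress G p ω → IsEqStress G q ω) →
    ∀ ω, IsEqStress (addEdge G u v) p ω → IsEqStress (addEdge G u v) q ω

/-- Equivalence of complex frameworks. -/
def CEquivalent {d : ℕ} (G : SimpleGraph V) (p q : V → Fin d → ℂ) : Prop :=
  ∀ u v : V, G.Adj u v →
    ∑ i, (p u i - p v i) ^ 2 = ∑ i, (q u i - q v i) ^ 2

/-- Generic complex placement. -/
def CGeneric {d : ℕ} (p : V → Fin d → ℂ) : Prop :=
  AlgebraicIndependent ℚ (fun vi : V × Fin d => p vi.1 vi.2)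

/-- `{u,v}` is globally linked in `G` in `ℂ^d`. -/
def CGloballyLinked (d : ℕ) (G : SimpleGraph V) (u v : V) : Prop :=
  ∀ p : V → Fin d → ℂ, CGeneric p → ∀ q : V → Fin d → ℂ, CEquivalent G p q →
    ∑ i, (q u i - q v i) ^ 2 = ∑ i, (p u i - p v i) ^ 2

/-- A flexing of the framework `(G,q)`. -/
def IsFlexing {d : ℕ} (G : SimpleGraph V) (q : V → Fin d → ℝ)
    (φ : Set.Icc (0:ℝ) 1 → V → Fin d → ℝ) : Prop :=
  Continuous φ ∧ φ ⟨0, Set.left_mem_Icc.mpr zero_le_one⟩ = q ∧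
    (∀ t, Equivalent G q (φ t)) ∧
    ∀ t : Set.Icc (0:ℝ) 1, 0 < (t : ℝ) → ¬ Congruent q (φ t)

/-- A finite loopless multigraph on vertex type `V` with edge type `E`. -/
structure Multigraph (V : Type*) (E : Type*) where
  ends : E → Sym2 V
  loopless : ∀ e, ¬ (ends e).IsDiag

/-- The data `(B, bar)` exhibits `G` as a body-bar graph induced by `H`. -/
def IsBodyBar {V E W : Type*} (H : Multigraph V E) (G : SimpleGraph W)
    (B : V → Set W) (bar : E → W × W) : Prop :=
  (∀ w : W, ∃! v : V, w ∈ B v) ∧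
  (∀ v : V, (B v).ncard = {e : E | v ∈ H.ends e}.ncard) ∧
  (∀ e : E, ∃ w z : V, H.ends e = s(w, z) ∧ (bar e).1 ∈ B w ∧ (bar e).2 ∈ B z) ∧
  (∀ e : E, (bar e).1 ≠ (bar e).2) ∧
  (∀ e e' : E, e ≠ e' →
    ({(bar e).1, (bar e).2} ∩ {(bar e').1, (bar e').2} : Set W) = ∅) ∧
  (∀ a b : W, G.Adj a b ↔ a ≠ b ∧
    ((∃ v : V, a ∈ B v ∧ b ∈ B v) ∨ ∃ e : E, s(a, b) = s((bar e).1, (bar e).2)))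

/-- `P` is a partition of the set `X`. -/
def IsPartitionOf {V : Type*} (X : Set V) (P : Set (Set V)) : Prop :=
  (∀ p ∈ P, p.Nonempty ∧ p ⊆ X) ∧ ∀ v ∈ X, ∃! p, p ∈ P ∧ v ∈ p

/-- The subgraph `(X,F)` of the multigraph `H` is `k`-tree-connected. -/
def SubTreeConnected {V E : Type*} (k : ℕ) (H : Multigraph V E)
    (X : Set V) (F : Set E) : Prop :=
  X.Nonempty ∧ (∀ e ∈ F, ∀ v ∈ H.ends e, v ∈ X) ∧
    ∀ P : Set (Set V), IsPartitionOf X P →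
      k * (P.ncard - 1) ≤ {e | e ∈ F ∧ ¬ ∃ p ∈ P, ∀ v ∈ H.ends e, v ∈ p}.ncard

/-- `(X,F)` is a `k`-superbrick of `H`: a maximal `k`-tree-connected subgraph. -/
def IsSuperbrick {V E : Type*} (k : ℕ) (H : Multigraph V E)
    (X : Set V) (F : Set E) : Prop :=
  SubTreeConnected k H X F ∧
    ∀ X' F', SubTreeConnected k H X' F' → X ⊆ X' → F ⊆ F' → X = X' ∧ F = F'

/-- `v` is uniquely localizable in `G` with respect to `P` in `ℝ²`. -/
def UniquelyLocalizable {V : Type*} (G : SimpleGraph V) (P : Set V) (v : V) : Prop :=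
  ∀ p : V → Fin 2 → ℝ, Generic p → ∀ q : V → Fin 2 → ℝ, Equivalent G p q →
    (∀ b ∈ P, q b = p b) → q v = p v

/-- `G + K(P)`: add an edge between every non-adjacent pair of vertices of `P`. -/
def addClique {V : Type*} (G : SimpleGraph V) (P : Set V) : SimpleGraph V :=
  G ⊔ SimpleGraph.fromEdgeSet {e | ∃ a ∈ P, ∃ b ∈ P, e = s(a, b)}

set_option linter.unusedSectionVars false

section ElementarySupports

variable {ι : Type*}

open Function

/-- `C` is the support of an elementary vector of `S`: a minimal nonempty support. -/
def IsElem (S : Submodule ℝ (ι → ℝ)) (C : Set ι) : Prop :=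
  (∃ ω ∈ S, ω ≠ 0 ∧ support ω = C) ∧ ∀ ω ∈ S, ω ≠ 0 → support ω ⊆ C → support ω = C

/-- Every coordinate in the support of a vector of `S` lies in an elementary support inside it. -/
theorem exists_isElem_of_mem_support [Finite ι] {S : Submodule ℝ (ι → ℝ)} {ω : ι → ℝ} (hω : ω ∈ S) {e : ι}
    (he : ω e ≠ 0) : ∃ C, IsElem S C ∧ e ∈ C ∧ C ⊆ support ω := by
  classical
  obtain ⟨n, hn⟩ : ∃ n, n = (support ω).ncard := ⟨_, rfl⟩
  induction n using Nat.strong_induction_on generalizing ω with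
  | _ n ih =>
  by_cases h : IsElem S (support ω)
  · exact ⟨_, h, he, subset_rfl⟩
  have hω0 : ω ≠ 0 := by rintro rfl; simp at he
  obtain ⟨τ, hτ, hτ0, hsub, hne⟩ : ∃ τ ∈ S, τ ≠ 0 ∧ support τ ⊆ support ω ∧
      support τ ≠ support ω := by
    by_contra hcon
    push Not at hcon
    exact h ⟨⟨ω, hω, hω0, rfl⟩, fun τ hτ hτ0 hs => hcon τ hτ hτ0 hs⟩
  have hlt : (support τ).ncard < (support ω).ncard :=
    Set.ncard_lt_ncard (hsub.ssubset_of_ne hne) (Set.toFinite _)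
  by_cases hτe : τ e = 0
  · obtain ⟨g, hg⟩ : ∃ g, τ g ≠ 0 := by
      by_contra hcon; push Not at hcon; exact hτ0 (funext hcon)
    set σ := ω - (ω g / τ g) • τ with hσ
    have hσS : σ ∈ S := S.sub_mem hω (S.smul_mem _ hτ)
    have hσe : σ e ≠ 0 := by simp [hσ, hτe, he]
    have hσg : σ g = 0 := by simp [hσ]; field_simp; simp
    have hσsub : support σ ⊆ support ω := by
      intro f hf
      by_contra hfω
      have h1 : ω f = 0 := by simpa using hfω
      have h2 : τ f = 0 := by
        by_contra h2; exact hfω (hsub h2)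
      simp [hσ, h1, h2] at hf
    have hσlt : (support σ).ncard < (support ω).ncard := by
      refine Set.ncard_lt_ncard (hσsub.ssubset_of_ne ?_) (Set.toFinite _)
      intro heq
      have : g ∈ support σ := heq ▸ hsub hg
      exact this hσg
    obtain ⟨C, h1, h2, h3⟩ := ih _ (hn ▸ hσlt) hσS hσe rfl
    exact ⟨C, h1, h2, h3.trans hσsub⟩
  · obtain ⟨C, h1, h2, h3⟩ := ih _ (hn ▸ hlt) hτ hτe rfl
    exact ⟨C, h1, h2, h3.trans hsub⟩

theorem IsElem.strong_elimination [Finite ι] {S : Submodule ℝ (ι → ℝ)} {C₁ C₂ : Set ι} (h₁ : IsElem S C₁)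
    (h₂ : IsElem S C₂) {e g : ι} (he : e ∈ C₁) (he' : e ∉ C₂) (hg : g ∈ C₁) (hg' : g ∈ C₂) :
    ∃ C, IsElem S C ∧ e ∈ C ∧ C ⊆ (C₁ ∪ C₂) \ {g} := by
  obtain ⟨⟨ω₁, hω₁, -, rfl⟩, -⟩ := h₁
  obtain ⟨⟨ω₂, hω₂, -, rfl⟩, -⟩ := h₂
  have he2 : ω₂ e = 0 := by simpa using he'
  have hg2 : ω₂ g ≠ 0 := hg'
  set σ := ω₁ - (ω₁ g / ω₂ g) • ω₂ with hσ
  have hσS : σ ∈ S := S.sub_mem hω₁ (S.smul_mem _ hω₂)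
  have hσe : σ e ≠ 0 := by simpa [hσ, he2] using he
  obtain ⟨C, hC, heC, hCs⟩ := exists_isElem_of_mem_support hσS hσe
  refine ⟨C, hC, heC, fun f hf => ⟨?_, ?_⟩⟩
  · have := hCs hf
    by_contra hcon
    simp only [Set.mem_union, mem_support, not_or, not_not] at hcon
    simp [hσ, hcon.1, hcon.2] at this
  · rintro rfl
    have := hCs hf
    simp [hσ] at this
    field_simp at this
    simp at this

theorem IsElem.eq_of_subset {S : Submodule ℝ (ι → ℝ)} {C₁ C₂ : Set ι} (h₁ : IsElem S C₁)
    (h₂ : IsElem S C₂) (h : C₁ ⊆ C₂) : C₁ = C₂ := by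
  obtain ⟨⟨ω₁, hω₁, h0, rfl⟩, -⟩ := h₁
  exact h₂.2 ω₁ hω₁ h0 h

/-- Two meeting elementary supports span a common elementary support through any two given
elements. -/
theorem IsElem.exists_common [Finite ι] {S : Submodule ℝ (ι → ℝ)} {C₁ C₂ : Set ι} (h₁ : IsElem S C₁)
    (h₂ : IsElem S C₂) {e f g : ι} (he : e ∈ C₁) (hf : f ∈ C₂) (hg : g ∈ C₁) (hg' : g ∈ C₂) :
    ∃ C, IsElem S C ∧ e ∈ C ∧ f ∈ C ∧ C ⊆ C₁ ∪ C₂ := by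
  obtain ⟨n, hn⟩ : ∃ n, n = (C₁ ∪ C₂).ncard := ⟨_, rfl⟩
  induction n using Nat.strong_induction_on generalizing C₁ C₂ g with
  | _ n ih =>
  by_cases he2 : e ∈ C₂
  · exact ⟨C₂, h₂, he2, hf, Set.subset_union_right⟩
  by_cases hf1 : f ∈ C₁
  · exact ⟨C₁, h₁, he, hf1, Set.subset_union_left⟩
  obtain ⟨C₃, h₃, he3, hs3⟩ := h₁.strong_elimination h₂ he he2 hg hg'
  obtain ⟨C₄, h₄, hf4, hs4⟩ := h₂.strong_elimination h₁ hf hf1 hg' hg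
  have hs3' : C₃ ⊆ C₁ ∪ C₂ := hs3.trans Set.sdiff_subset
  have hs4' : C₄ ⊆ C₁ ∪ C₂ := by rw [Set.union_comm]; exact hs4.trans Set.sdiff_subset
  have hn3 : ∃ k ∈ C₃, k ∈ C₂ ∧ k ∉ C₁ := by
    by_contra hcon
    push Not at hcon
    have hsub : C₃ ⊆ C₁ := fun k hk => (hs3' hk).elim id (hcon k hk)
    have := h₃.eq_of_subset h₁ hsub
    exact (hs3 (this ▸ hg : g ∈ C₃)).2 rfl
  obtain ⟨k, hk3, hk2, hk1⟩ := hn3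
  by_cases hlt : (C₃ ∪ C₂).ncard < (C₁ ∪ C₂).ncard
  · obtain ⟨C, hC, heC, hfC, hsC⟩ := ih _ (hn ▸ hlt) h₃ h₂ he3 hf hk3 hk2 rfl
    exact ⟨C, hC, heC, hfC, hsC.trans (Set.union_subset hs3' Set.subset_union_right)⟩
  have hn4 : ∃ k ∈ C₄, k ∈ C₁ ∧ k ∉ C₂ := by
    by_contra hcon
    push Not at hcon
    have hsub : C₄ ⊆ C₂ := fun k hk => (hs4' hk).elim (hcon k hk) id
    have := h₄.eq_of_subset h₂ hsub
    exact (hs4 (this ▸ hg' : g ∈ C₄)).2 rfl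
  obtain ⟨l, hl4, hl1, hl2⟩ := hn4
  have heq : C₃ ∪ C₂ = C₁ ∪ C₂ :=
    Set.eq_of_subset_of_ncard_le (Set.union_subset hs3' Set.subset_union_right)
      (not_lt.mp hlt) (Set.toFinite _)
  have hl3 : l ∈ C₃ := by
    have : l ∈ C₃ ∪ C₂ := heq ▸ Or.inl hl1
    exact this.resolve_right hl2
  have hlt' : (C₃ ∪ C₄).ncard < (C₁ ∪ C₂).ncard := by
    refine Set.ncard_lt_ncard ((Set.union_subset hs3' hs4').ssubset_of_ne ?_) (Set.toFinite _)
    intro h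
    have : g ∈ C₃ ∪ C₄ := h ▸ Or.inl hg
    exact this.elim (fun h => (hs3 h).2 rfl) (fun h => (hs4 h).2 rfl)
  obtain ⟨C, hC, heC, hfC, hsC⟩ := ih _ (hn ▸ hlt') h₃ h₄ he3 hf4 hl3 hl4 rfl
  exact ⟨C, hC, heC, hfC, hsC.trans (Set.union_subset hs3' hs4')⟩

/-- The elements sharing an elementary support with `e`, together with `e`. -/
def elemClass (S : Submodule ℝ (ι → ℝ)) (e : ι) : Set ι :=
  {f | e = f ∨ ∃ C, IsElem S C ∧ e ∈ C ∧ f ∈ C}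

open Classical in
/-- The restriction of a vector of `S` to a class lies in `S`. -/
theorem indicator_elemClass_mem [Finite ι] {S : Submodule ℝ (ι → ℝ)} (e : ι) {ω : ι → ℝ} (hω : ω ∈ S) :
    (elemClass S e).indicator ω ∈ S := by
  obtain ⟨n, hn⟩ : ∃ n, n = (support ω).ncard := ⟨_, rfl⟩
  induction n using Nat.strong_induction_on generalizing ω with
  | _ n ih =>
  by_cases h0 : ω = 0
  · subst h0; simp
  obtain ⟨g, hg⟩ : ∃ g, ω g ≠ 0 := by
    by_contra hcon; push Not at hcon; exact h0 (funext hcon)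
  obtain ⟨C, hC, hgC, hCs⟩ := exists_isElem_of_mem_support hω hg
  obtain ⟨⟨τ, hτ, hτ0, hτC⟩, -⟩ := id hC
  have hτg : τ g ≠ 0 := by rw [← hτC] at hgC; exact hgC
  set σ := ω - (ω g / τ g) • τ with hσ
  have hσS : σ ∈ S := S.sub_mem hω (S.smul_mem _ hτ)
  have hσlt : (support σ).ncard < (support ω).ncard := by
    have hσsub : support σ ⊆ support ω := by
      intro f hf
      by_contra hfω
      have h1 : ω f = 0 := by simpa using hfω
      have h2 : τ f = 0 := by
        by_contra h2; exact hfω (hCs (hτC ▸ h2 : f ∈ C))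
      simp [hσ, h1, h2] at hf
    refine Set.ncard_lt_ncard (hσsub.ssubset_of_ne ?_) (Set.toFinite _)
    intro heq
    have : g ∈ support σ := heq ▸ hg
    apply this
    simp [hσ]; field_simp; simp
  have hτD : (elemClass S e).indicator τ ∈ S := by
    by_cases hmeet : ∃ k ∈ C, k ∈ elemClass S e
    · obtain ⟨k, hkC, hk⟩ := hmeet
      have : C ⊆ elemClass S e := by
        intro f hf
        rcases hk with rfl | ⟨C', hC', heC', hkC'⟩
        · exact Or.inr ⟨C, hC, hkC, hf⟩
        · obtain ⟨C₂, h1, h2, h3, -⟩ := hC'.exists_common hC heC' hf hkC' hkC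
          exact Or.inr ⟨C₂, h1, h2, h3⟩
      rwa [Set.indicator_eq_self.mpr (hτC ▸ this)]
    · push Not at hmeet
      rw [Set.indicator_eq_zero.mpr]
      · exact S.zero_mem
      · rw [hτC]; exact Set.disjoint_left.mpr hmeet
  have hωσ : ω = σ + (ω g / τ g) • τ := by simp [hσ]
  rw [hωσ, Set.indicator_add', show (elemClass S e).indicator ((ω g / τ g) • τ) =
    (ω g / τ g) • (elemClass S e).indicator τ from by
      ext f; by_cases hf : f ∈ elemClass S e <;> simp [hf]]
  exact S.add_mem (ih _ (hn ▸ hσlt) hσS rfl) (S.smul_mem _ hτD)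

theorem elemClass_subset {S : Submodule ℝ (ι → ℝ)} {e : ι} {D : Set ι} (he : e ∈ D)
    (hD : ∀ ω ∈ S, D.indicator ω ∈ S) : elemClass S e ⊆ D := by
  classical
  rintro f (rfl | ⟨C, hC, heC, hfC⟩)
  · exact he
  · obtain ⟨⟨ω, hω, h0, rfl⟩, hmin⟩ := hC
    have h1 := hD ω hω
    have h2 : D.indicator ω ≠ 0 := by
      intro h
      have := congrFun h e
      simp [he] at this
      exact heC this
    have := hmin _ h1 h2 (by rw [Set.support_indicator]; exact Set.inter_subset_right)
    rw [Set.support_indicator, Set.inter_eq_right] at this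
    exact this hfC

end ElementarySupports

/-- Placements of `V` in the plane. -/
abbrev Pl (V : Type*) := V → Fin 2 → ℝ

/-- The inner product of `p u - p v` and `m u - m v`. -/
def bil (p m : Pl V) (u v : V) : ℝ :=
  (p u 0 - p v 0) * (m u 0 - m v 0) + (p u 1 - p v 1) * (m u 1 - m v 1)

/-- The squared distance of two points of a placement. -/
def sqd (p : Pl V) (u v : V) : ℝ := (p u 0 - p v 0) ^ 2 + (p u 1 - p v 1) ^ 2

theorem bil_comm (p m : Pl V) (u v : V) : bil p m u v = bil p m v u := by
  unfold bil; ring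

theorem sqd_comm (p : Pl V) (u v : V) : sqd p u v = sqd p v u := by
  unfold sqd; ring

@[simp] theorem bil_self (p m : Pl V) (u : V) : bil p m u u = 0 := by simp [bil]

@[simp] theorem sqd_self (p : Pl V) (u : V) : sqd p u u = 0 := by simp [sqd]

theorem eDist_eq_iff (p q : Pl V) (u v : V) :
    eDist (p u) (p v) = eDist (q u) (q v) ↔ sqd p u v = sqd q u v := by
  unfold eDist sqd
  simp only [Fin.sum_univ_two]
  rw [Real.sqrt_inj (by positivity) (by positivity)]

/-- The row of the rigidity matrix indexed by a pair, as a functional on velocities. -/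
def rowF (p : Pl V) (e : Sym2 V) : Pl V →ₗ[ℝ] ℝ where
  toFun m := Sym2.lift ⟨fun u v => bil p m u v, fun u v => bil_comm p m u v⟩ e
  map_add' m n := by
    induction e with | _ u v => simp [bil]; ring
  map_smul' c m := by
    induction e with | _ u v => simp [bil]; ring

@[simp] theorem rowF_mk (p m : Pl V) (u v : V) : rowF p s(u, v) m = bil p m u v := rfl

/-- Infinitesimal motions of the framework with edge set `F` at `p`. -/
def Mot (p : Pl V) (F : Set (Sym2 V)) : Submodule ℝ (Pl V) where
  carrier := {m | ∀ u v, s(u, v) ∈ F → bil p m u v = 0}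
  add_mem' {m n} hm hn u v h := by
    have h1 := hm u v h
    have h2 := hn u v h
    simp only [bil, Pi.add_apply] at *
    linarith
  zero_mem' u v _ := by simp [bil]
  smul_mem' c m hm u v h := by
    have h1 := hm u v h
    simp only [bil, Pi.smul_apply, smul_eq_mul] at *
    linear_combination c * h1

theorem Mot_anti {p : Pl V} {F F' : Set (Sym2 V)} (h : F ⊆ F') : Mot p F' ≤ Mot p F :=
  fun _ hm u v huv => hm u v (h huv)

/-- The pair `x, y` is infinitesimally linked by the edges in `F`. -/
def Lk (p : Pl V) (F : Set (Sym2 V)) (x y : V) : Prop := ∀ m ∈ Mot p F, bil p m x y = 0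

theorem Lk.mono {p : Pl V} {F F' : Set (Sym2 V)} (h : F ⊆ F') {x y : V} (hl : Lk p F x y) :
    Lk p F' x y := fun m hm => hl m (Mot_anti h hm)

theorem Lk.symm {p : Pl V} {F : Set (Sym2 V)} {x y : V} (hl : Lk p F x y) : Lk p F y x :=
  fun m hm => bil_comm p m x y ▸ hl m hm

theorem Lk.of_mem {p : Pl V} {F : Set (Sym2 V)} {x y : V} (h : s(x, y) ∈ F) : Lk p F x y :=
  fun _ hm => hm x y h

theorem Lk.self (p : Pl V) (F : Set (Sym2 V)) (x : V) : Lk p F x x := fun m _ => bil_self p m x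

theorem Lk.trans {p : Pl V} {F F' : Set (Sym2 V)} (h : ∀ u v, s(u, v) ∈ F' → Lk p F u v) {x y : V}
    (hl : Lk p F' x y) : Lk p F x y :=
  fun m hm => hl m fun u v huv => h u v huv m hm

/-- `F` is infinitesimally rigid on `X` at `p`: its motions are trivial on `X`. -/
def RigidOn (p : Pl V) (F : Set (Sym2 V)) (X : Set V) : Prop :=
  ∀ m ∈ Mot p F, ∃ a b θ : ℝ, ∀ u ∈ X, m u 0 = a - θ * p u 1 ∧ m u 1 = b + θ * p u 0

/-- The complete edge set on `X`. -/
def KK (X : Set V) : Set (Sym2 V) := {e | ¬ e.IsDiag ∧ ∀ u ∈ e, u ∈ X}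

theorem mem_KK {X : Set V} {u v : V} : s(u, v) ∈ KK X ↔ u ≠ v ∧ u ∈ X ∧ v ∈ X := by
  simp [KK]

theorem KK_mono {X Y : Set V} (h : X ⊆ Y) : KK X ⊆ KK Y :=
  fun _ he => ⟨he.1, fun u hu => h (he.2 u hu)⟩

/-- Twice the signed area of a triangle. -/
def area (p : Pl V) (x y z : V) : ℝ :=
  (p y 0 - p x 0) * (p z 1 - p x 1) - (p y 1 - p x 1) * (p z 0 - p x 0)

/-- General position: distinct abscissae and no three collinear points. -/
def GenPos (p : Pl V) : Prop :=
  (∀ x y, x ≠ y → p x 0 ≠ p y 0) ∧ ∀ x y z, x ≠ y → y ≠ z → x ≠ z → area p x y z ≠ 0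

theorem GenPos.sqd_pos {p : Pl V} (hp : GenPos p) {x y : V} (h : x ≠ y) : 0 < sqd p x y := by
  have := sub_ne_zero.mpr (hp.1 x y h)
  unfold sqd; positivity

theorem RigidOn.lk {p : Pl V} {F : Set (Sym2 V)} {X : Set V} (h : RigidOn p F X) {x y : V}
    (hx : x ∈ X) (hy : y ∈ X) : Lk p F x y := by
  intro m hm
  obtain ⟨a, b, θ, H⟩ := h m hm
  obtain ⟨h1, h2⟩ := H x hx
  obtain ⟨h3, h4⟩ := H y hy
  unfold bil; rw [h1, h2, h3, h4]; ring

theorem RigidOn.mono {p : Pl V} {F F' : Set (Sym2 V)} {X X' : Set V} (h : RigidOn p F X)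
    (hF : F ⊆ F') (hX : X' ⊆ X) : RigidOn p F' X' := by
  intro m hm
  obtain ⟨a, b, θ, H⟩ := h m (Mot_anti hF hm)
  exact ⟨a, b, θ, fun u hu => H u (hX hu)⟩

theorem RigidOn.trans {p : Pl V} {F F' : Set (Sym2 V)} {X : Set V}
    (h : ∀ u v, s(u, v) ∈ F' → Lk p F u v) (hr : RigidOn p F' X) : RigidOn p F X :=
  fun m hm => hr m fun u v huv => h u v huv m hm

/-- A velocity preserving one pair is trivial on it. -/
theorem exists_trivial_of_pair {p : Pl V} {x y : V} (hxy : sqd p x y ≠ 0) {m : Pl V}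
    (h : bil p m x y = 0) : ∃ a b θ : ℝ, ∀ u, u = x ∨ u = y →
      m u 0 = a - θ * p u 1 ∧ m u 1 = b + θ * p u 0 := by
  set D := sqd p x y with hD
  set θ := ((p y 0 - p x 0) * (m y 1 - m x 1) - (p y 1 - p x 1) * (m y 0 - m x 0)) / D with hθ
  have hθD : θ * D = (p y 0 - p x 0) * (m y 1 - m x 1) - (p y 1 - p x 1) * (m y 0 - m x 0) := by
    rw [hθ]; field_simp
  clear_value θ
  have hDe : D = (p x 0 - p y 0) ^ 2 + (p x 1 - p y 1) ^ 2 := rfl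
  have hb : (p x 0 - p y 0) * (m x 0 - m y 0) + (p x 1 - p y 1) * (m x 1 - m y 1) = 0 := h
  refine ⟨m x 0 + θ * p x 1, m x 1 - θ * p x 0, θ, ?_⟩
  rintro u (rfl | rfl)
  · constructor <;> ring
  · constructor
    · apply mul_left_cancel₀ hxy
      linear_combination (m u 0 - m x 0) * hDe + (p u 1 - p x 1) * hθD + (p u 0 - p x 0) * hb
    · apply mul_left_cancel₀ hxy
      linear_combination (m u 1 - m x 1) * hDe - (p u 0 - p x 0) * hθD + (p u 1 - p x 1) * hb

/-- A velocity that is trivial on two points and preserves their distances to a third point is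
trivial there, provided the points are not collinear. -/
theorem trivial_of_two {p m : Pl V} {x y u : V} (hA : area p x y u ≠ 0) {a b θ : ℝ}
    (hx : m x 0 = a - θ * p x 1 ∧ m x 1 = b + θ * p x 0)
    (hy : m y 0 = a - θ * p y 1 ∧ m y 1 = b + θ * p y 0)
    (hux : bil p m u x = 0) (huy : bil p m u y = 0) :
    m u 0 = a - θ * p u 1 ∧ m u 1 = b + θ * p u 0 := by
  unfold bil at hux huy
  rw [hx.1, hx.2] at hux
  rw [hy.1, hy.2] at huy
  unfold area at hA
  constructor
  · apply mul_left_cancel₀ hA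
    linear_combination - (p y 1 - p u 1) * hux + (p x 1 - p u 1) * huy
  · apply mul_left_cancel₀ hA
    linear_combination (p y 0 - p u 0) * hux - (p x 0 - p u 0) * huy

theorem trivial_ext_pair {p : Pl V} {x y : V} (hxy : sqd p x y ≠ 0) {a b θ a' b' θ' : ℝ}
    (hx : a - θ * p x 1 = a' - θ' * p x 1 ∧ b + θ * p x 0 = b' + θ' * p x 0)
    (hy : a - θ * p y 1 = a' - θ' * p y 1 ∧ b + θ * p y 0 = b' + θ' * p y 0) :
    a = a' ∧ b = b' ∧ θ = θ' := by
  have h : θ = θ' := by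
    apply mul_left_cancel₀ hxy
    unfold sqd
    linear_combination (p x 0 - p y 0) * (hx.2 - hy.2) - (p x 1 - p y 1) * (hx.1 - hy.1)
  subst h
  exact ⟨by linear_combination hx.1, by linear_combination hx.2, rfl⟩

theorem RigidOn.union {p : Pl V} (hp : GenPos p) {F : Set (Sym2 V)} {X Y : Set V}
    (hX : RigidOn p F X) (hY : RigidOn p F Y) {x y : V} (hxy : x ≠ y) (hxX : x ∈ X) (hxY : x ∈ Y)
    (hyX : y ∈ X) (hyY : y ∈ Y) : RigidOn p F (X ∪ Y) := by
  intro m hm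
  obtain ⟨a, b, θ, H⟩ := hX m hm
  obtain ⟨a', b', θ', H'⟩ := hY m hm
  obtain ⟨rfl, rfl, rfl⟩ := trivial_ext_pair (hp.sqd_pos hxy).ne'
    ⟨(H x hxX).1.symm.trans (H' x hxY).1, (H x hxX).2.symm.trans (H' x hxY).2⟩
    ⟨(H y hyX).1.symm.trans (H' y hyY).1, (H y hyX).2.symm.trans (H' y hyY).2⟩
  exact ⟨a, b, θ, fun u hu => hu.elim (H u) (H' u)⟩

theorem RigidOn.insert {p : Pl V} (hp : GenPos p) {F : Set (Sym2 V)} {X : Set V}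
    (hX : RigidOn p F X) {x y w : V} (hxy : x ≠ y) (hx : x ∈ X) (hy : y ∈ X)
    (hwx : Lk p F w x) (hwy : Lk p F w y) (hw : w ∉ X) : RigidOn p F (insert w X) := by
  intro m hm
  obtain ⟨a, b, θ, H⟩ := hX m hm
  refine ⟨a, b, θ, ?_⟩
  rintro u (rfl | hu)
  · exact trivial_of_two (hp.2 x y u hxy (fun h => hw (h ▸ hy)) (fun h => hw (h ▸ hx)))
      (H x hx) (H y hy) (hwx m hm) (hwy m hm)
  · exact H u hu

theorem rigidOn_of_lk {p : Pl V} (hp : GenPos p) {F : Set (Sym2 V)} {X : Set V}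
    (h : ∀ x ∈ X, ∀ y ∈ X, Lk p F x y) : RigidOn p F X := by
  intro m hm
  by_cases hX : ∃ x ∈ X, ∃ y ∈ X, x ≠ y
  · obtain ⟨x, hx, y, hy, hxy⟩ := hX
    obtain ⟨a, b, θ, H⟩ := exists_trivial_of_pair (hp.sqd_pos hxy).ne' (h x hx y hy m hm)
    refine ⟨a, b, θ, fun u hu => ?_⟩
    by_cases hux : u = x
    · exact H u (Or.inl hux)
    by_cases huy : u = y
    · exact H u (Or.inr huy)
    exact trivial_of_two (hp.2 x y u hxy (Ne.symm huy) (Ne.symm hux)) (H x (Or.inl rfl))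
      (H y (Or.inr rfl)) (h u hu x hx m hm) (h u hu y hy m hm)
  · push Not at hX
    by_cases hne : X.Nonempty
    · obtain ⟨x, hx⟩ := hne
      refine ⟨m x 0, m x 1, 0, fun u hu => ?_⟩
      rw [hX u hu x hx]; simp
    · exact ⟨0, 0, 0, fun u hu => absurd ⟨u, hu⟩ hne⟩

theorem rigidOn_KK {p : Pl V} (hp : GenPos p) (X : Set V) : RigidOn p (KK X) X := by
  apply rigidOn_of_lk hp
  intro x hx y hy
  by_cases h : x = y
  · subst h; exact Lk.self _ _ _
  · exact Lk.of_mem (mem_KK.mpr ⟨h, hx, hy⟩)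

section Stress

variable [Fintype V]

/-- The resultant of the weights `ω` at the vertex `u`. -/
def force (p : Pl V) (ω : Sym2 V → ℝ) (u : V) (i : Fin 2) : ℝ :=
  ∑ v, ω s(u, v) * (p u i - p v i)

theorem force_add (p : Pl V) (ω τ : Sym2 V → ℝ) (u : V) (i : Fin 2) :
    force p (ω + τ) u i = force p ω u i + force p τ u i := by
  simp [force, add_mul, Finset.sum_add_distrib]

theorem force_smul (p : Pl V) (c : ℝ) (ω : Sym2 V → ℝ) (u : V) (i : Fin 2) :
    force p (c • ω) u i = c * force p ω u i := by
  simp [force, Finset.mul_sum, mul_assoc]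

theorem force_sub (p : Pl V) (ω τ : Sym2 V → ℝ) (u : V) (i : Fin 2) :
    force p (ω - τ) u i = force p ω u i - force p τ u i := by
  simp [force, sub_mul, Finset.sum_sub_distrib]

/-- Equilibrium stresses at `p` supported on `F`. -/
def stressOn (p : Pl V) (F : Set (Sym2 V)) : Submodule ℝ (Sym2 V → ℝ) where
  carrier := {ω | (∀ u i, force p ω u i = 0) ∧ ∀ e ∉ F, ω e = 0}
  add_mem' {ω τ} hω hτ := ⟨fun u i => by rw [force_add, hω.1, hτ.1, add_zero],
    fun e he => by simp [hω.2 e he, hτ.2 e he]⟩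
  zero_mem' := ⟨fun u i => by simp [force], fun e _ => rfl⟩
  smul_mem' c ω hω := ⟨fun u i => by rw [force_smul, hω.1, mul_zero],
    fun e he => by simp [hω.2 e he]⟩

theorem stressOn_mono {p : Pl V} {F F' : Set (Sym2 V)} (h : F ⊆ F') :
    stressOn p F ≤ stressOn p F' := fun _ hω => ⟨hω.1, fun e he => hω.2 e fun h' => he (h h')⟩

variable [DecidableEq V]

/-- Virtual work: pairing weights with a velocity, edge by edge and vertex by vertex. -/
theorem sum_rowF_eq (p : Pl V) (ω : Sym2 V → ℝ) (m : Pl V) :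
    ∑ e, ω e * rowF p e m = ∑ u, ∑ i, force p ω u i * m u i := by
  have key : (∑ e, ω e • rowF p e) =
      ∑ u, ∑ i, force p ω u i • (LinearMap.proj i ∘ₗ LinearMap.proj u : Pl V →ₗ[ℝ] ℝ) := by
    refine LinearMap.pi_ext' fun u => LinearMap.pi_ext' fun i => ?_
    ext
    simp only [LinearMap.coe_comp, Function.comp_apply, LinearMap.coe_sum, Finset.sum_apply,
      LinearMap.smul_apply, LinearMap.coe_single, smul_eq_mul, LinearMap.proj_apply]
    have h1 : ∀ e : Sym2 V, e ∉ Finset.univ.image (fun v => s(u, v)) →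
        ω e * rowF p e (Pi.single u (Pi.single i 1)) = 0 := by
      intro e
      induction e with | _ a b =>
      intro h
      have ha : a ≠ u := by rintro rfl; exact h (by simp)
      have hb : b ≠ u := by rintro rfl; exact h (by simp)
      simp [bil, ha, hb]
    rw [← Finset.sum_subset (Finset.subset_univ (Finset.univ.image (fun v => s(u, v))))
      (fun e _ he => h1 e he), Finset.sum_image (fun a _ b _ hab => Sym2.congr_right.mp hab)]
    have h2 : ∑ w, ∑ j, force p ω w j * (Pi.single u (Pi.single i 1) : Pl V) w j =
        force p ω u i := by
      rw [Finset.sum_eq_single u (by intro w _ hw; simp [hw]) (by simp),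
        Finset.sum_eq_single i (by intro j _ hj; simp [hj]) (by simp)]
      simp
    rw [h2]
    refine Finset.sum_congr rfl fun v _ => ?_
    by_cases hv : v = u
    · subst hv; simp
    · fin_cases i <;> simp [bil, hv]
  have := LinearMap.congr_fun key m
  simpa using this

theorem sum_rowF_of_stress {p : Pl V} {ω : Sym2 V → ℝ} (h : ∀ u i, force p ω u i = 0) (m : Pl V) :
    ∑ e, ω e * rowF p e m = 0 := by
  rw [sum_rowF_eq]; simp [h]

theorem force_eq_zero_of_sum {p : Pl V} {ω : Sym2 V → ℝ}
    (h : ∀ m, ∑ e, ω e * rowF p e m = 0) (u : V) (i : Fin 2) : force p ω u i = 0 := by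
  have := h (Pi.single u (Pi.single i 1))
  rw [sum_rowF_eq, Finset.sum_eq_single u, Finset.sum_eq_single i] at this
  · simpa using this
  · intro j _ hj; simp [hj]
  · simp
  · intro w _ hw; simp [hw]
  · simp

/-- A stress with nonzero coefficient at `xy` links `x` and `y`. -/
theorem lk_of_stress {p : Pl V} {F : Set (Sym2 V)} {x y : V} {ω : Sym2 V → ℝ}
    (hω : ∀ u i, force p ω u i = 0) (hs : ∀ e, e ≠ s(x, y) → e ∉ F → ω e = 0)
    (hxy : ω s(x, y) ≠ 0) : Lk p F x y := by
  intro m hm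
  have := sum_rowF_of_stress hω m
  rw [Finset.sum_eq_single s(x, y)] at this
  · simpa [hxy] using this
  · intro e _ he
    by_cases heF : e ∈ F
    · induction e with | _ u v => simp [hm u v heF]
    · simp [hs e he heF]
  · simp

/-- A linked pair outside `F` carries a stress. -/
theorem exists_stress_of_lk {p : Pl V} {F : Set (Sym2 V)} {x y : V} (h : Lk p F x y)
    (hF : s(x, y) ∉ F) : ∃ ω ∈ stressOn p (insert s(x, y) F), ω s(x, y) = 1 := by
  classical
  let L : Sym2 V → (Pl V →ₗ[ℝ] ℝ) := fun e => if e ∈ F then rowF p e else 0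
  have h1 : rowF p s(x, y) ∈ Submodule.span ℝ (Set.range L) := by
    apply mem_span_of_iInf_ker_le_ker
    intro m hm
    simp only [Submodule.mem_iInf, LinearMap.mem_ker] at hm
    exact h m fun u v huv => by simpa [L, huv] using hm s(u, v)
  rw [Submodule.mem_span_range_iff_exists_fun] at h1
  obtain ⟨c, hc⟩ := h1
  refine ⟨Pi.single s(x, y) 1 - F.indicator c, ⟨?_, ?_⟩, by simp [hF]⟩
  · apply force_eq_zero_of_sum
    intro m
    have hcm := LinearMap.congr_fun hc m
    rw [LinearMap.sum_apply] at hcm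
    simp only [Pi.sub_apply, sub_mul, Finset.sum_sub_distrib]
    rw [Finset.sum_eq_single s(x, y) (by intro e _ he; simp [he]) (by simp), Pi.single_eq_same,
      one_mul, ← hcm, sub_eq_zero]
    refine Finset.sum_congr rfl fun e _ => ?_
    by_cases he : e ∈ F <;> simp [L, he]
  · intro e he
    simp only [Set.mem_insert_iff, not_or] at he
    simp [he.1, he.2]

end Stress

section PinnedStress

variable [Fintype V] [DecidableEq V]

theorem exists_comb_of_vanish {p : Pl V} {F : Set (Sym2 V)} {φ : Pl V →ₗ[ℝ] ℝ}
    (h : ∀ m ∈ Mot p F, φ m = 0) :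
    ∃ c : Sym2 V → ℝ, (∀ e ∉ F, c e = 0) ∧ ∀ m, φ m = ∑ e, c e * rowF p e m := by
  classical
  let L : Sym2 V → (Pl V →ₗ[ℝ] ℝ) := fun e => if e ∈ F then rowF p e else 0
  have h1 : φ ∈ Submodule.span ℝ (Set.range L) := by
    apply mem_span_of_iInf_ker_le_ker
    intro m hm
    simp only [Submodule.mem_iInf, LinearMap.mem_ker] at hm
    exact h m fun u v huv => by simpa [L, huv] using hm s(u, v)
  rw [Submodule.mem_span_range_iff_exists_fun] at h1
  obtain ⟨c, hc⟩ := h1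
  refine ⟨F.indicator c, fun e he => by simp [he], fun m => ?_⟩
  rw [← hc, LinearMap.sum_apply]
  refine Finset.sum_congr rfl fun e _ => ?_
  by_cases he : e ∈ F <;> simp [L, he]

/-- A load on a rigid vertex set coming from weights in equilibrium elsewhere is resolved. -/
theorem exists_resolve {p : Pl V} {H : Set (Sym2 V)} {X : Set V} (hH : RigidOn p H X)
    {ω : Sym2 V → ℝ} (hω : ∀ u ∉ X, ∀ i, force p ω u i = 0) :
    ∃ c : Sym2 V → ℝ, (∀ e ∉ H, c e = 0) ∧ ∀ u i, force p c u i = force p ω u i := by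
  have hv : ∀ m ∈ Mot p H, (∑ e, ω e • rowF p e) m = 0 := by
    intro m hm
    obtain ⟨a, b, θ, hX⟩ := hH m hm
    let t : Pl V := fun u => ![a - θ * p u 1, b + θ * p u 0]
    have ht : ∑ e, ω e * rowF p e t = 0 := by
      refine Finset.sum_eq_zero fun e _ => ?_
      induction e with | _ u v =>
      rw [rowF_mk, mul_eq_zero]
      right
      simp only [bil, t, Matrix.cons_val_zero, Matrix.cons_val_one]
      ring
    have : ∑ e, ω e * rowF p e m = ∑ e, ω e * rowF p e t := by
      rw [sum_rowF_eq, sum_rowF_eq]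
      refine Finset.sum_congr rfl fun u _ => Finset.sum_congr rfl fun i _ => ?_
      by_cases hu : u ∈ X
      · fin_cases i
        · simp [t, (hX u hu).1]
        · simp [t, (hX u hu).2]
      · rw [hω u hu]; ring
    simpa [this] using ht
  obtain ⟨c, hc, hcm⟩ := exists_comb_of_vanish hv
  refine ⟨c, hc, fun u i => ?_⟩
  have : force p (c - ω) u i = 0 := by
    apply force_eq_zero_of_sum
    intro m
    have := hcm m
    simp only [LinearMap.sum_apply, LinearMap.smul_apply, smul_eq_mul] at this
    simp [sub_mul, Finset.sum_sub_distrib, this]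
  rw [force_sub] at this
  linarith

/-- A pinned equilibrium load on a rigid set extends to a stress. -/
theorem exists_stress_of_pinned {p : Pl V} {H B : Set (Sym2 V)} {X : Set V} (hH : RigidOn p H X)
    {ω : Sym2 V → ℝ} (hω : ∀ u ∉ X, ∀ i, force p ω u i = 0) (hB : ∀ e ∉ B, ω e = 0) :
    ∃ τ ∈ stressOn p (B ∪ H), ∀ e ∉ H, τ e = ω e := by
  obtain ⟨c, hc, hcf⟩ := exists_resolve hH hω
  refine ⟨ω - c, ⟨fun u i => by rw [force_sub, hcf, sub_self], fun e he => ?_⟩, fun e he => ?_⟩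
  · simp only [Set.mem_union, not_or] at he
    simp [hB e he.1, hc e he.2]
  · simp [hc e he]

theorem force_single (p : Pl V) {a b : V} (hab : a ≠ b) (u : V) (i : Fin 2) :
    force p (Pi.single s(a, b) 1) u i =
      if u = a then p a i - p b i else if u = b then p b i - p a i else 0 := by
  unfold force
  by_cases ha : u = a
  · subst ha
    rw [Finset.sum_eq_single b]
    · simp
    · intro v _ hv
      rw [Pi.single_eq_of_ne]
      · ring
      · exact fun h => hv (Sym2.congr_right.mp h)
    · simp
  · rw [if_neg ha]
    by_cases hb : u = b
    · subst hb
      rw [Finset.sum_eq_single a]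
      · simp [Sym2.eq_swap]
      · intro v _ hv
        rw [Pi.single_eq_of_ne]
        · ring
        · rw [Sym2.eq_swap]; intro h; exact hv (Sym2.congr_left.mp h)
      · simp
    · rw [if_neg hb]
      refine Finset.sum_eq_zero fun v _ => ?_
      rw [Pi.single_eq_of_ne]
      · ring
      · intro h
        have : u ∈ s(a, b) := h ▸ Sym2.mem_mk_left u v
        simp [ha, hb] at this

theorem force_eq_sum (p : Pl V) {ω : Sym2 V → ℝ} {w : V} (S : Finset V)
    (h : ∀ v ∉ S, v ≠ w → ω s(w, v) = 0) (i : Fin 2) :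
    force p ω w i = ∑ v ∈ S, ω s(w, v) * (p w i - p v i) := by
  unfold force
  symm
  refine Finset.sum_subset (Finset.subset_univ _) fun v _ hv => ?_
  by_cases hvw : v = w
  · subst hvw; simp
  · rw [h v hv hvw]; ring

/-- Two non-parallel bars cannot be in equilibrium at a vertex unless unstressed. -/
theorem star_two {p : Pl V} {ω : Sym2 V → ℝ} {w x y : V} (hf : ∀ i, force p ω w i = 0)
    (h : ∀ v, v ≠ w → v ≠ x → v ≠ y → ω s(w, v) = 0) (hxy : x ≠ y) (hA : area p w x y ≠ 0) :
    ω s(w, x) = 0 ∧ ω s(w, y) = 0 := by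
  have h0 := fun i => force_eq_sum p (ω := ω) (w := w) {x, y}
    (fun v hv hvw => by simp at hv; exact h v hvw hv.1 hv.2) i
  simp only [Finset.sum_pair hxy, hf] at h0
  have e0 := h0 0
  have e1 := h0 1
  unfold area at hA
  constructor
  · apply mul_left_cancel₀ hA
    linear_combination - (p y 1 - p w 1) * (-e0) + (p y 0 - p w 0) * (-e1)
  · apply mul_left_cancel₀ hA
    linear_combination - (p x 0 - p w 0) * (-e1) + (p x 1 - p w 1) * (-e0)

/-- `B` carries no nonzero weights in equilibrium at all vertices outside `X`. -/
def PinIndep (p : Pl V) (X : Set V) (B : Set (Sym2 V)) : Prop :=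
  ∀ ω : Sym2 V → ℝ, (∀ u ∉ X, ∀ i, force p ω u i = 0) → (∀ e ∉ B, ω e = 0) → ω = 0

/-- `B` carries no nonzero stress. -/
def Indep (p : Pl V) (B : Set (Sym2 V)) : Prop := PinIndep p ∅ B

theorem indep_iff {p : Pl V} {B : Set (Sym2 V)} : Indep p B ↔ ∀ ω ∈ stressOn p B, ω = 0 := by
  constructor
  · intro h ω hω; exact h ω (fun u _ => hω.1 u) hω.2
  · intro h ω h1 h2; exact h ω ⟨fun u => h1 u (by simp), h2⟩

theorem PinIndep.mono {p : Pl V} {X : Set V} {B B' : Set (Sym2 V)} (h : PinIndep p X B)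
    (hB : B' ⊆ B) : PinIndep p X B' :=
  fun ω h1 h2 => h ω h1 fun e he => h2 e fun h' => he (hB h')

theorem PinIndep.loopless {p : Pl V} {X : Set V} {B : Set (Sym2 V)} (h : PinIndep p X B) :
    ∀ e ∈ B, ¬ e.IsDiag := by
  intro e he
  induction e with | _ u v =>
  intro hd
  have huv : u = v := by simpa using hd
  subst huv
  have := h (Pi.single s(u, u) 1) (fun w _ i => ?_) (fun e he' => ?_)
  · have := congrFun this s(u, u); simp at this
  · refine Finset.sum_eq_zero fun v _ => ?_
    by_cases hw : s(w, v) = s(u, u)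
    · have : w = u ∧ v = u := by simpa using hw
      simp [this]
    · simp [hw]
  · rw [Pi.single_eq_of_ne]; rintro rfl; exact he' he

/-- The load of `xy` is resolved by `B` up to the pins `X`. -/
def PLk (p : Pl V) (X : Set V) (B : Set (Sym2 V)) (x y : V) : Prop :=
  ∃ τ : Sym2 V → ℝ, (∀ e ∉ B, τ e = 0) ∧
    ∀ u ∉ X, ∀ i, force p τ u i = force p (Pi.single s(x, y) 1) u i

theorem PLk.of_mem {p : Pl V} {X : Set V} {B : Set (Sym2 V)} {x y : V} (h : s(x, y) ∈ B) :
    PLk p X B x y :=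
  ⟨Pi.single s(x, y) 1, fun e he => by rw [Pi.single_eq_of_ne]; rintro rfl; exact he h,
    fun _ _ _ => rfl⟩

theorem PinIndep.insert_of_not_PLk {p : Pl V} {X : Set V} {B : Set (Sym2 V)} {x y : V}
    (h : PinIndep p X B) (hxy : ¬ PLk p X B x y) : PinIndep p X (insert s(x, y) B) := by
  intro ω h1 h2
  have hB : s(x, y) ∉ B := fun h' => hxy (.of_mem h')
  by_cases h0 : ω s(x, y) = 0
  · refine h ω h1 fun e he => ?_
    by_cases hee : e = s(x, y)
    · rw [hee, h0]
    · exact h2 e (by simp [hee, he])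
  · exfalso
    apply hxy
    refine ⟨Pi.single s(x, y) 1 - (ω s(x, y))⁻¹ • ω, fun e he => ?_, fun u hu i => ?_⟩
    · by_cases hee : e = s(x, y)
      · subst hee; simp [h0]
      · simp [hee, h2 e (by simp [hee, he])]
    · rw [force_sub, force_smul, h1 u hu]; ring

theorem Lk.PLk {p : Pl V} {B : Set (Sym2 V)} {x y : V} (h : Lk p B x y) (X : Set V) :
    PLk p X B x y := by
  obtain ⟨c, hc, hcm⟩ := exists_comb_of_vanish (p := p) (F := B) (φ := rowF p s(x, y)) h
  refine ⟨c, hc, fun u _ i => ?_⟩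
  have : force p (c - Pi.single s(x, y) 1) u i = 0 := by
    apply force_eq_zero_of_sum
    intro m
    simp only [Pi.sub_apply, sub_mul, Finset.sum_sub_distrib, ← hcm m]
    rw [Finset.sum_eq_single s(x, y) (by intro e _ he; simp [he]) (by simp)]
    simp
  rw [force_sub] at this
  linarith

theorem lk_of_PLk {p : Pl V} {B : Set (Sym2 V)} {x y : V} (h : PLk p ∅ B x y) : Lk p B x y := by
  obtain ⟨τ, hτ, hf⟩ := h
  by_cases hB : s(x, y) ∈ B
  · exact Lk.of_mem hB
  refine lk_of_stress (ω := τ - Pi.single s(x, y) 1) (fun u i => ?_) (fun e he heB => ?_) ?_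
  · rw [force_sub, hf u (by simp), sub_self]
  · simp [he, hτ e heB]
  · simp [hτ _ hB]

/-- The stress of a complete graph on four points in general position, up to scale. -/
theorem exists_K4_stress {p : Pl V} (w x y z : V) (hxyz : area p x y z ≠ 0) (hwyz : area p w y z ≠ 0)
    (hwx : w ≠ x) (hwy : w ≠ y) (hwz : w ≠ z) (hxy : x ≠ y) (hxz : x ≠ z) (hyz : y ≠ z) :
    ∃ a b c d e f : ℝ, a ≠ 0 ∧ ∀ u i, force p (a • Pi.single s(w, x) 1 + b • Pi.single s(w, y) 1 +
      c • Pi.single s(w, z) 1 + d • Pi.single s(x, y) 1 + e • Pi.single s(x, z) 1 +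
      f • Pi.single s(y, z) 1) u i = 0 := by
  set α := - area p x y z
  set β := area p w y z
  set γ := - area p w x z
  set δ := area p w x y
  refine ⟨α * β, α * γ, α * δ, β * γ, β * δ, γ * δ, mul_ne_zero (neg_ne_zero.mpr hxyz) hwyz, ?_⟩
  have h1 : α + β + γ + δ = 0 := by simp only [α, β, γ, δ, area]; ring
  have h2 : ∀ i, α * p w i + β * p x i + γ * p y i + δ * p z i = 0 := by
    intro i; fin_cases i <;> simp only [α, β, γ, δ, area] <;> simp <;> ring
  intro u i
  simp only [force_add, force_smul, force_single p hwx, force_single p hwy, force_single p hwz,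
    force_single p hxy, force_single p hxz, force_single p hyz]
  by_cases hw : u = w
  · subst hw; simp only [if_true, hwx, hwy, hwz, if_false]
    linear_combination α * p u i * h1 - α * h2 i
  by_cases hx : u = x
  · subst hx; simp only [if_true, hw, hxy, hxz, if_false]
    linear_combination β * p u i * h1 - β * h2 i
  by_cases hy : u = y
  · subst hy; simp only [if_true, hw, hx, hyz, if_false]
    linear_combination γ * p u i * h1 - γ * h2 i
  by_cases hz : u = z
  · subst hz; simp only [if_true, hw, hx, hy, if_false]
    linear_combination δ * p u i * h1 - δ * h2 i
  · simp [hw, hx, hy, hz]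

/-- A vertex of degree three attached to mutually linked vertices creates a dependency. -/
theorem not_PinIndep_of_PLk {p : Pl V} {X : Set V} {B' : Set (Sym2 V)} {w x y z : V}
    (hxyz : area p x y z ≠ 0) (hwyz : area p w y z ≠ 0)
    (hwx : w ≠ x) (hwy : w ≠ y) (hwz : w ≠ z) (hxy : x ≠ y) (hxz : x ≠ z) (hyz : y ≠ z)
    (hw : ∀ v, s(w, v) ∉ B') (h1 : PLk p X B' x y) (h2 : PLk p X B' x z) (h3 : PLk p X B' y z) :
    ¬ PinIndep p X (B' ∪ {s(w, x), s(w, y), s(w, z)}) := by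
  intro hI
  obtain ⟨a, b, c, d, e, f, ha, hK⟩ := exists_K4_stress w x y z hxyz hwyz hwx hwy hwz hxy hxz hyz
  obtain ⟨τ₁, s1, f1⟩ := h1
  obtain ⟨τ₂, s2, f2⟩ := h2
  obtain ⟨τ₃, s3, f3⟩ := h3
  have := hI (a • Pi.single s(w, x) 1 + b • Pi.single s(w, y) 1 +
      c • Pi.single s(w, z) 1 + d • τ₁ + e • τ₂ + f • τ₃) (fun u hu i => ?_) (fun g hg => ?_)
  · have h := congrFun this s(w, x)
    have e1 : s(w, x) ≠ s(w, y) := fun h => hxy (Sym2.congr_right.mp h)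
    have e2 : s(w, x) ≠ s(w, z) := fun h => hxz (Sym2.congr_right.mp h)
    simp [s1 _ (hw x), s2 _ (hw x), s3 _ (hw x), -Sym2.eq, Pi.single_eq_of_ne e1,
      Pi.single_eq_of_ne e2] at h
    exact ha h
  · have := hK u i
    simp only [force_add, force_smul] at this ⊢
    rw [f1 u hu, f2 u hu, f3 u hu, this]
  · simp only [Set.mem_union, Set.mem_insert_iff, Set.mem_singleton_iff, not_or] at hg
    simp [s1 _ hg.1, s2 _ hg.1, s3 _ hg.1, Pi.single_eq_of_ne hg.2.1, Pi.single_eq_of_ne hg.2.2.1,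
      Pi.single_eq_of_ne hg.2.2.2]

theorem force_congr {p p' : Pl V} {ω : Sym2 V → ℝ} {w : V} (h : ∀ v, ω s(w, v) = 0)
    (hp : ∀ v, v ≠ w → p v = p' v) (u : V) (i : Fin 2) : force p ω u i = force p' ω u i := by
  unfold force
  refine Finset.sum_congr rfl fun v _ => ?_
  by_cases hv : v = w
  · subst hv; rw [Sym2.eq_swap, h]; ring
  by_cases hu : u = w
  · subst hu; rw [h]; ring
  rw [hp v hv, hp u hu]

/-- One-extension, with the new vertex placed at the midpoint of the removed edge. -/
theorem PinIndep.one_extension {p : Pl V} {X : Set V} {B' : Set (Sym2 V)} {w x y z : V}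
    (hwx : w ≠ x) (hwy : w ≠ y) (hwz : w ≠ z) (hxy : x ≠ y) (hxz : x ≠ z) (hyz : y ≠ z)
    (hA : area p x y z ≠ 0) (hw : ∀ v, s(w, v) ∉ B') (hwX : w ∉ X)
    (hB : s(x, y) ∉ B') (hI : PinIndep p X (insert s(x, y) B')) :
    PinIndep (Function.update p w fun i => (p x i + p y i) / 2) X
      (B' ∪ {s(w, x), s(w, y), s(w, z)}) := by
  intro ω h1 h2
  set p' : Pl V := Function.update p w fun i => (p x i + p y i) / 2 with hp'
  have pw : ∀ i, p' w i = (p x i + p y i) / 2 := fun i => by simp [hp']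
  have px : p' x = p x := by simp [hp', hwx.symm]
  have py : p' y = p y := by simp [hp', hwy.symm]
  have pz : p' z = p z := by simp [hp', hwz.symm]
  have hf := fun i => force_eq_sum p' (ω := ω) (w := w) {x, y, z}
    (fun v hv hvw => by
      simp only [Finset.mem_insert, Finset.mem_singleton, not_or] at hv
      apply h2
      simp only [Set.mem_union, Set.mem_insert_iff, Set.mem_singleton_iff, Sym2.congr_right, hv,
        hw, or_self, not_false_eq_true]) i
  simp only [h1 w hwX, Finset.sum_insert, Finset.mem_insert, Finset.mem_singleton, hxy, hxz, hyz,
    or_self, not_false_eq_true, Finset.sum_singleton, pw, px, py, pz] at hf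
  have hf0 := hf 0
  have hf1 := hf 1
  have hz0 : ω s(w, z) = 0 := by
    apply mul_left_cancel₀ hA
    unfold area
    linear_combination -(p y 1 - p x 1) * hf0 + (p y 0 - p x 0) * hf1
  rw [hz0] at hf0 hf1
  have hxy' : ω s(w, x) = ω s(w, y) := by
    by_contra hne
    have hne' := sub_ne_zero.mpr hne
    apply hA
    have g0 : p x 0 = p y 0 := by
      apply mul_left_cancel₀ hne'
      linear_combination 2 * hf0
    have g1 : p x 1 = p y 1 := by
      apply mul_left_cancel₀ hne'
      linear_combination 2 * hf1
    unfold area; rw [g0, g1]; ring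
  set t := ω s(w, x) with ht
  have e1 : s(w, x) ≠ s(w, y) := fun h => hxy (Sym2.congr_right.mp h)
  have e2 : s(w, x) ≠ s(x, y) := by
    intro h
    have : w ∈ s(x, y) := h ▸ Sym2.mem_mk_left w x
    simp [hwx, hwy] at this
  have e3 : s(w, y) ≠ s(x, y) := by
    intro h
    have : w ∈ s(x, y) := h ▸ Sym2.mem_mk_left w y
    simp [hwx, hwy] at this
  set τ : Sym2 V → ℝ := ω - t • Pi.single s(w, x) 1 - t • Pi.single s(w, y) 1 +
    (t / 2) • Pi.single s(x, y) 1 with hτ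
  have hτw : ∀ v, τ s(w, v) = 0 := by
    intro v
    by_cases hvx : v = x
    · subst hvx; simp [hτ, ht, Pi.single_eq_of_ne e1, Pi.single_eq_of_ne e2, -Sym2.eq]
    by_cases hvy : v = y
    · subst hvy
      simp [hτ, hxy', Pi.single_eq_of_ne e1.symm, Pi.single_eq_of_ne e3, -Sym2.eq]
    have e4 : s(w, v) ≠ s(x, y) := by
      intro h
      have : w ∈ s(x, y) := h ▸ Sym2.mem_mk_left w v
      simp [hwx, hwy] at this
    have e5 : s(w, v) ≠ s(w, x) := fun h => hvx (Sym2.congr_right.mp h)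
    have e6 : s(w, v) ≠ s(w, y) := fun h => hvy (Sym2.congr_right.mp h)
    have : ω s(w, v) = 0 := by
      by_cases hvz : v = z
      · subst hvz; exact hz0
      · apply h2
        simp only [Set.mem_union, Set.mem_insert_iff, Set.mem_singleton_iff, Sym2.congr_right, hvx,
          hvy, hvz, hw, or_self, not_false_eq_true]
    simp [hτ, this, Pi.single_eq_of_ne e4, Pi.single_eq_of_ne e5, Pi.single_eq_of_ne e6, -Sym2.eq]
  have hτ0 : τ = 0 := by
    refine hI τ (fun u hu i => ?_) (fun e he => ?_)
    · rw [force_congr (p' := p') hτw (fun v hv => by simp [hp', hv])]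
      simp only [hτ, force_add, force_sub, force_smul, h1 u hu, force_single p' hwx,
        force_single p' hwy, force_single p' hxy]
      by_cases huw : u = w
      · subst huw; simp only [if_true, hwx, hwy, if_false, px, py, pw]; ring
      by_cases hux : u = x
      · subst hux; simp only [if_true, huw, hxy, if_false, px, py, pw]; ring
      by_cases huy : u = y
      · subst huy; simp only [if_true, huw, hux, if_false, px, py, pw]; ring
      · simp [huw, hux, huy]
    · simp only [Set.mem_insert_iff, not_or] at he
      by_cases hex : e = s(w, x)
      · rw [hex]; exact hτw x
      by_cases hey : e = s(w, y)
      · rw [hey]; exact hτw y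
      by_cases hez : e = s(w, z)
      · rw [hez]; exact hτw z
      have : ω e = 0 := h2 e (by simp [he.2, hex, hey, hez, -Sym2.eq])
      simp [hτ, this, he.1, hex, hey, -Sym2.eq]
  have ht0 : t = 0 := by
    have h := congrFun hτ0 s(x, y)
    have hω : ω s(x, y) = 0 := by
      apply h2
      simp only [Set.mem_union, hB, Set.mem_insert_iff, Set.mem_singleton_iff, e2.symm, e3.symm,
        false_or]
      intro h
      have : w ∈ s(x, y) := h ▸ Sym2.mem_mk_left w z
      simp [hwx, hwy] at this
    simp [hτ, hω, Pi.single_eq_of_ne e2.symm, Pi.single_eq_of_ne e3.symm, -Sym2.eq] at h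
    exact h
  rw [← hτ0, hτ, ht0]
  simp

end PinnedStress

section Genericity

variable [Fintype V] [DecidableEq V]

/-- The entry of the rigidity matrix of `P` in the row `e` and the column `(u, i)`. -/
def coefE {R : Type*} [CommRing R] (P : V → Fin 2 → R) (e : Sym2 V) (u : V) (i : Fin 2) : R :=
  Sym2.lift ⟨fun a b => (if u = a then P a i - P b i else 0) + (if u = b then P b i - P a i else 0),
    fun _ _ => add_comm _ _⟩ e

theorem coefE_map {R S : Type*} [CommRing R] [CommRing S] (f : R →+* S) (P : V → Fin 2 → R)
    (e : Sym2 V) (u : V) (i : Fin 2) :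
    f (coefE P e u i) = coefE (fun v j => f (P v j)) e u i := by
  induction e with | _ a b =>
  simp only [coefE, Sym2.lift_mk, map_add, apply_ite f, map_sub, map_zero]

theorem sum_coefE (p : Pl V) (ω : Sym2 V → ℝ) (u : V) (i : Fin 2) :
    ∑ e, ω e * coefE p e u i = force p ω u i := by
  have h : ∀ e, coefE p e u i = rowF p e (Pi.single u (Pi.single i 1)) := by
    intro e
    induction e with | _ a b =>
    simp only [coefE, Sym2.lift_mk, rowF_mk, bil]
    by_cases ha : a = u <;> by_cases hb : b = u <;> fin_cases i <;>
      simp_all [eq_comm]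
  simp only [h]
  rw [sum_rowF_eq, Finset.sum_eq_single u (by intro w _ hw; simp [hw]) (by simp),
    Finset.sum_eq_single i (by intro j _ hj; simp [hj]) (by simp)]
  simp

open Classical in
/-- The Gram matrix deciding pinned independence. -/
def gram {R : Type*} [CommRing R] (P : V → Fin 2 → R) (X : Set V) (B : Set (Sym2 V)) :
    Matrix (Sym2 V) (Sym2 V) R := fun e f =>
  (∑ u, ∑ i, (if e ∈ B ∧ u ∉ X then coefE P e u i else 0) *
    (if f ∈ B ∧ u ∉ X then coefE P f u i else 0)) + if e = f ∧ e ∉ B then 1 else 0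

theorem gram_map {R S : Type*} [CommRing R] [CommRing S] (f : R →+* S) (P : V → Fin 2 → R)
    (X : Set V) (B : Set (Sym2 V)) :
    f.mapMatrix (gram P X B) = gram (fun v j => f (P v j)) X B := by
  ext e g
  simp only [RingHom.mapMatrix_apply, Matrix.map_apply, gram, map_add, map_sum, map_mul,
    apply_ite f, coefE_map, map_zero, map_one]

theorem pinIndep_iff_det (p : Pl V) (X : Set V) (B : Set (Sym2 V)) :
    PinIndep p X B ↔ (gram p X B).det ≠ 0 := by
  classical
  set c : Sym2 V → V → Fin 2 → ℝ := fun e u i => if e ∈ B ∧ u ∉ X then coefE p e u i else 0 with hc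
  have hg : ∀ e f, gram p X B e f = (∑ u, ∑ i, c e u i * c f u i) +
      if e = f ∧ e ∉ B then 1 else 0 := fun e f => by simp only [gram, hc]
  have hforce : ∀ v : Sym2 V → ℝ, (∀ e ∉ B, v e = 0) → ∀ u i,
      ∑ e, v e * c e u i = if u ∉ X then force p v u i else 0 := by
    intro v hv u i
    by_cases hu : u ∈ X
    · simp [hc, hu]
    · rw [if_pos hu, ← sum_coefE]
      refine Finset.sum_congr rfl fun e _ => ?_
      by_cases he : e ∈ B <;> simp [hc, he, hu, hv]
  have hvec : ∀ v : Sym2 V → ℝ, ∀ f, (Matrix.vecMul v (gram p X B)) f =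
      (∑ u, ∑ i, (∑ e, v e * c e u i) * c f u i) + if f ∉ B then v f else 0 := by
    intro v f
    simp only [Matrix.vecMul, dotProduct, hg, mul_add, Finset.sum_add_distrib]
    congr 1
    · simp only [Finset.mul_sum, Finset.sum_mul]
      rw [Finset.sum_comm]
      refine Finset.sum_congr rfl fun u _ => ?_
      rw [Finset.sum_comm]
      refine Finset.sum_congr rfl fun i _ => Finset.sum_congr rfl fun e _ => by ring
    · rw [Finset.sum_eq_single f (by intro e _ he; simp [he]) (by simp)]
      simp
  rw [← not_iff_not, not_not, ← Matrix.exists_vecMul_eq_zero_iff]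
  constructor
  · intro h
    simp only [PinIndep, not_forall] at h
    obtain ⟨ω, h1, h2, h3⟩ := h
    refine ⟨ω, h3, ?_⟩
    ext f
    rw [hvec]
    simp only [hforce ω h2]
    have : ∀ u i, (if u ∉ X then force p ω u i else 0) = 0 := fun u i => by
      by_cases hu : u ∈ X
      · simp [hu]
      · simp [hu, h1]
    simp only [this]
    by_cases hf : f ∈ B <;> simp [hf, h2]
  · rintro ⟨v, hv, h⟩ hI
    have h0 : ∑ f, Matrix.vecMul v (gram p X B) f * v f = 0 := by simp [h]
    have h1 : (∑ u, ∑ i, (∑ e, v e * c e u i) ^ 2) + ∑ f, (if f ∉ B then v f ^ 2 else 0) = 0 := by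
      have ha : ∀ u i, (∑ e, v e * c e u i) ^ 2 = ∑ f, (∑ e, v e * c e u i) * c f u i * v f := by
        intro u i
        rw [sq, Finset.mul_sum]
        exact Finset.sum_congr rfl fun f _ => by ring
      have hb : ∑ u, ∑ i, (∑ e, v e * c e u i) ^ 2 =
          ∑ f, (∑ u, ∑ i, (∑ e, v e * c e u i) * c f u i) * v f := by
        rw [Finset.sum_congr rfl fun u _ => Finset.sum_congr rfl fun i _ => ha u i]
        rw [Finset.sum_congr rfl fun u _ => Finset.sum_comm, Finset.sum_comm]
        simp only [Finset.sum_mul]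
      rw [hb, ← Finset.sum_add_distrib]
      refine Eq.trans (Finset.sum_congr rfl fun f _ => ?_) h0
      rw [hvec, add_mul]
      congr 1
      by_cases hf : f ∈ B <;> simp [hf, sq]
    have h2 : ∑ f, (if f ∉ B then v f ^ 2 else 0) = 0 := by
      refine le_antisymm ?_ (Finset.sum_nonneg fun f _ => by positivity)
      have : 0 ≤ ∑ u, ∑ i, (∑ e, v e * c e u i) ^ 2 := by positivity
      linarith
    have hvB : ∀ f ∉ B, v f = 0 := by
      intro f hf
      have := (Finset.sum_eq_zero_iff_of_nonneg (fun f _ => by positivity)).mp h2 f (by simp)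
      simpa [hf] using this
    have h3 : ∑ u, ∑ i, (∑ e, v e * c e u i) ^ 2 = 0 := by linarith
    refine hv (hI v (fun u hu i => ?_) hvB)
    have h4 := (Finset.sum_eq_zero_iff_of_nonneg (fun u _ => by positivity)).mp h3 u (by simp)
    have h5 := (Finset.sum_eq_zero_iff_of_nonneg (fun i _ => by positivity)).mp h4 i (by simp)
    rw [hforce v hvB, if_pos hu] at h5
    exact pow_eq_zero_iff (two_ne_zero) |>.mp h5

/-- Pinned independence at a specialization implies pinned independence at generic values. -/
theorem pinIndep_of_specialization {σ : Type*} {a a₀ : σ → ℝ} (ha : AlgebraicIndependent ℚ a)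
    (P : V → Fin 2 → MvPolynomial σ ℚ) {X : Set V} {B : Set (Sym2 V)}
    (h : PinIndep (fun v i => MvPolynomial.aeval a₀ (P v i)) X B) :
    PinIndep (fun v i => MvPolynomial.aeval a (P v i)) X B := by
  have key : ∀ b : σ → ℝ, (gram (fun v i => MvPolynomial.aeval b (P v i)) X B).det =
      MvPolynomial.aeval b (gram P X B).det := by
    intro b
    have := gram_map (MvPolynomial.aeval b : MvPolynomial σ ℚ →ₐ[ℚ] ℝ).toRingHom P X B
    rw [show (MvPolynomial.aeval b) (gram P X B).det =
      (MvPolynomial.aeval b : MvPolynomial σ ℚ →ₐ[ℚ] ℝ).toRingHom (gram P X B).det from rfl,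
      RingHom.map_det, this]
    rfl
  rw [pinIndep_iff_det, key] at h ⊢
  intro h0
  apply h
  rw [show (gram P X B).det = 0 from ha (by rw [h0, map_zero]), map_zero]

theorem PinIndep.generic {p p₀ : Pl V} (hp : Generic p) {X : Set V} {B : Set (Sym2 V)}
    (h : PinIndep p₀ X B) : PinIndep p X B := by
  have := pinIndep_of_specialization (a₀ := fun vi : V × Fin 2 => p₀ vi.1 vi.2) hp
    (fun v i => MvPolynomial.X (v, i)) (X := X) (B := B) (by simpa using h)
  simpa using this

/-- The placement obtained by projecting the points of `X` onto the first axis. -/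
def flat (X : Set V) (p : Pl V) : Pl V := fun u i => open Classical in if u ∈ X ∧ i = 1 then 0 else p u i

theorem PinIndep.flat_generic {p p₀ : Pl V} (hp : Generic p) {X : Set V} {B : Set (Sym2 V)}
    (h : PinIndep (flat X p₀) X B) : PinIndep (flat X p) X B := by
  classical
  have key : ∀ r : Pl V, flat X r = fun v i => MvPolynomial.aeval (fun vi : V × Fin 2 => r vi.1 vi.2)
      (if v ∈ X ∧ i = 1 then (0 : MvPolynomial (V × Fin 2) ℚ) else MvPolynomial.X (v, i)) := by
    intro r
    ext v i
    by_cases h : v ∈ X ∧ i = 1 <;> simp [flat, h]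
  rw [key] at h ⊢
  exact pinIndep_of_specialization hp _ h

theorem Generic.genPos {p : Pl V} (hp : Generic p) : GenPos p := by
  have hX : ∀ f : MvPolynomial (V × Fin 2) ℚ, f ≠ 0 → MvPolynomial.aeval (fun vi : V × Fin 2 => p vi.1 vi.2) f ≠ 0 := by
    intro f hf h
    exact hf (hp (by simpa using h))
  constructor
  · intro x y hxy h
    apply hX (MvPolynomial.X (x, 0) - MvPolynomial.X (y, 0))
    · intro h0
      have := congrArg (MvPolynomial.aeval (fun vi : V × Fin 2 => if vi.1 = x then (1 : ℚ) else 0)) h0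
      simp [hxy.symm] at this
    · simp [h]
  · intro x y z hxy hyz hxz h
    apply hX ((MvPolynomial.X (y, 0) - MvPolynomial.X (x, 0)) * (MvPolynomial.X (z, 1) - MvPolynomial.X (x, 1)) -
      (MvPolynomial.X (y, 1) - MvPolynomial.X (x, 1)) * (MvPolynomial.X (z, 0) - MvPolynomial.X (x, 0)))
    · intro h0
      have := congrArg (MvPolynomial.aeval (fun vi : V × Fin 2 => if vi = (y, 0) then (1 : ℚ) else if vi = (z, 1) then 1 else 0)) h0
      simp [hxy, hxz, hyz, hyz.symm] at this
    · simpa [area] using h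

end Genericity

section GenericExistence

theorem exists_algebraicIndependent_near (ι : Type*) [Finite ι] :
    ∀ (a₀ : ι → ℝ) {ε : ℝ}, 0 < ε → ∃ a : ι → ℝ, AlgebraicIndependent ℚ a ∧ ∀ i, |a i - a₀ i| < ε := by
  refine Finite.induction_empty_option (P := fun ι => ∀ (a₀ : ι → ℝ) {ε : ℝ}, 0 < ε →
    ∃ a : ι → ℝ, AlgebraicIndependent ℚ a ∧ ∀ i, |a i - a₀ i| < ε) ?_ ?_ ?_ ι
  · intro α β e h a₀ ε hε
    obtain ⟨a, ha, h⟩ := h (a₀ ∘ e) hε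
    exact ⟨a ∘ e.symm, (algebraicIndependent_equiv e.symm).mpr ha, fun i => by simpa using h (e.symm i)⟩
  · intro a₀ ε _
    refine ⟨a₀, ?_, fun i => i.elim⟩
    rw [algebraicIndependent_empty_type_iff]
    exact (algebraMap ℚ ℝ).injective
  · intro α _ h a₀ ε hε
    obtain ⟨a, ha, h⟩ := h (fun i => a₀ (some i)) hε
    have hc : Set.Countable {x : ℝ | IsAlgebraic (Algebra.adjoin ℚ (Set.range a)) x} := by
      have : Countable (Algebra.adjoin ℚ (Set.range a)) := by
        rw [Algebra.adjoin_range_eq_range_aeval]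
        have : Countable (MvPolynomial α ℚ) :=
          Cardinal.mk_le_aleph0_iff.mp <| MvPolynomial.cardinalMk_le_max_lift.trans <|
            max_le (max_le (by simp) (by simp)) le_rfl
        exact (Set.countable_range (MvPolynomial.aeval a : MvPolynomial α ℚ → ℝ)).to_subtype
      exact Algebraic.countable _ _
    obtain ⟨x, hx, hxε⟩ := (hc.dense_compl ℝ).exists_dist_lt (a₀ none) hε
    refine ⟨fun o => o.elim x a, (ha.option_iff_transcendental x).mpr hx, ?_⟩
    rintro (_ | i)
    · simpa [Real.dist_eq, abs_sub_comm] using hxε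
    · exact h i

theorem exists_generic_near [Finite V] (p₀ : Pl V) {ε : ℝ} (hε : 0 < ε) :
    ∃ p : Pl V, Generic p ∧ ∀ u i, |p u i - p₀ u i| < ε := by
  obtain ⟨a, ha, h⟩ := exists_algebraicIndependent_near (V × Fin 2) (fun vi => p₀ vi.1 vi.2) hε
  exact ⟨fun u i => a (u, i), ha, fun u i => h (u, i)⟩

end GenericExistence

section RankLink

variable [Fintype V] [DecidableEq V]

theorem edgeVec_eq_coefE (p : Pl V) (a b : V) :
    edgeVec p a b = fun ui => coefE p s(a, b) ui.1 ui.2 := by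
  ext ⟨u, i⟩
  simp only [edgeVec, coefE, Sym2.lift_mk]
  by_cases ha : u = a
  · subst ha
    by_cases hb : u = b
    · subst hb; simp
    · simp [hb]
  · by_cases hb : u = b
    · subst hb; simp [ha]
    · simp [ha, hb]

theorem rankAt_eq (p : Pl V) (F : Set (Sym2 V)) : rankAt 2 p F = Set.finrank ℝ
    (Set.range fun (e : F) (ui : V × Fin 2) => coefE p e.1 ui.1 ui.2) := by
  have : {x : V × Fin 2 → ℝ | ∃ u v : V, s(u, v) ∈ F ∧ x = edgeVec p u v} =
      Set.range fun (e : F) (ui : V × Fin 2) => coefE p e.1 ui.1 ui.2 := by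
    ext x
    constructor
    · rintro ⟨u, v, h, rfl⟩
      exact ⟨⟨_, h⟩, (edgeVec_eq_coefE p u v).symm⟩
    · rintro ⟨⟨e, he⟩, rfl⟩
      induction e with | _ u v =>
      exact ⟨u, v, he, (edgeVec_eq_coefE p u v).symm⟩
  rw [rankAt, this]
  rfl

theorem rankAt_le (p : Pl V) (F : Set (Sym2 V)) : rankAt 2 p F ≤ F.ncard := by
  classical
  rw [rankAt_eq]
  have := finrank_range_le_card (R := ℝ) (fun (e : F) (ui : V × Fin 2) => coefE p e.1 ui.1 ui.2)
  rwa [Set.ncard_eq_toFinset_card', Set.toFinset_card]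

theorem rankAt_eq_iff (p : Pl V) (F : Set (Sym2 V)) : rankAt 2 p F = F.ncard ↔ Indep p F := by
  classical
  rw [rankAt_eq, Set.ncard_eq_toFinset_card', Set.toFinset_card, eq_comm,
    ← linearIndependent_iff_card_eq_finrank_span, Fintype.linearIndependent_iff]
  constructor
  · intro h ω h1 h2
    have h3 := h (fun e => ω e.1) (by
      ext ⟨u, i⟩
      have := h1 u (by simp) i
      rw [← sum_coefE] at this
      simp only [Finset.sum_apply, Pi.smul_apply, smul_eq_mul, Pi.zero_apply]
      rw [← this, Finset.sum_set_coe F (f := fun e => ω e * coefE p e u i)]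
      exact Finset.sum_subset (Finset.subset_univ _) fun e _ he => by simp [h2 e (by simpa using he)])
    ext e
    by_cases he : e ∈ F
    · exact h3 ⟨e, he⟩
    · exact h2 e he
  · intro h g hg e
    have := h (fun e => if he : e ∈ F then g ⟨e, he⟩ else 0) (fun u _ i => by
      have := congrFun hg (u, i)
      simp only [Finset.sum_apply, Pi.smul_apply, smul_eq_mul, Pi.zero_apply] at this
      refine Eq.trans ?_ this
      rw [← sum_coefE]
      symm
      have hs := Finset.sum_set_coe F
        (f := fun e => (if he : e ∈ F then g ⟨e, he⟩ else 0) * coefE p e u i)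
      simp only [Subtype.coe_prop, dite_true, Subtype.coe_eta] at hs
      rw [hs]
      exact Finset.sum_subset (Finset.subset_univ _) fun e _ he => by simp [show e ∉ F by simpa using he]) (fun e he => by simp [he])
    simpa using congrFun this e

theorem rdIndep_iff {p : Pl V} (hp : Generic p) (F : Set (Sym2 V)) : RdIndep 2 F ↔ Indep p F := by
  have hbdd : BddAbove {n : ℕ | ∃ p : V → Fin 2 → ℝ, n = rankAt 2 p F} :=
    ⟨F.ncard, by rintro n ⟨p, rfl⟩; exact rankAt_le p F⟩
  constructor
  · intro h
    have := Nat.sSup_mem (s := {n : ℕ | ∃ p : V → Fin 2 → ℝ, n = rankAt 2 p F}) ⟨_, p, rfl⟩ hbdd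
    obtain ⟨p', hp'⟩ := this
    change rd 2 F = _ at hp'
    rw [show rd 2 F = F.ncard from h] at hp'
    exact PinIndep.generic hp ((rankAt_eq_iff p' F).mp hp'.symm)
  · intro h
    apply le_antisymm
    · exact csSup_le ⟨_, p, rfl⟩ (by rintro n ⟨p, rfl⟩; exact rankAt_le p F)
    · exact le_csSup hbdd ⟨p, ((rankAt_eq_iff p F).mpr h).symm⟩

theorem rdCircuit_iff {p : Pl V} (hp : Generic p) {E C : Set (Sym2 V)} :
    C ⊆ E ∧ RdCircuit 2 C ↔ IsElem (stressOn p E) C := by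
  unfold RdCircuit
  simp only [rdIndep_iff hp, indep_iff]
  constructor
  · rintro ⟨hCE, h1, h2⟩
    push Not at h1
    obtain ⟨ω, hω, hω0⟩ := h1
    have key : ∀ τ ∈ stressOn p E, τ ≠ 0 → Function.support τ ⊆ C → Function.support τ = C := by
      intro τ hτ hτ0 hs
      by_contra hne
      exact hτ0 (h2 _ (hs.ssubset_of_ne hne) τ ⟨hτ.1, fun e he => by simpa using he⟩)
    refine ⟨⟨ω, stressOn_mono hCE hω, hω0, ?_⟩, key⟩
    exact key ω (stressOn_mono hCE hω) hω0 fun e he => by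
      by_contra h; exact he (hω.2 e h)
  · rintro ⟨⟨ω, hω, hω0, rfl⟩, h2⟩
    have hE : Function.support ω ⊆ E := fun e he => by by_contra h; exact he (hω.2 e h)
    refine ⟨hE, fun h => hω0 (h ω ⟨hω.1, fun e he => by simpa using he⟩), fun C' hC' τ hτ => ?_⟩
    by_contra hτ0
    have hs : Function.support τ ⊆ C' := fun e he => by by_contra h; exact he (hτ.2 e h)
    have := h2 τ (stressOn_mono (hC'.subset.trans hE) hτ) hτ0 (hs.trans hC'.subset)
    exact hC'.not_subset (this ▸ hs)

/-- The components of `G` are the classes of its elementary stresses at a generic placement. -/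
theorem isRdComponent_iff {p : Pl V} (hp : Generic p) (G : SimpleGraph V) (F : Set (Sym2 V)) :
    IsRdComponent 2 G F ↔ ∃ e ∈ G.edgeSet, F = elemClass (stressOn p G.edgeSet) e := by
  unfold IsRdComponent RdCircuitOf
  simp only [rdCircuit_iff hp]
  refine exists_congr fun e => and_congr_right fun he => ?_
  have : {f | f ∈ G.edgeSet ∧ (e = f ∨ ∃ C, IsElem (stressOn p G.edgeSet) C ∧ e ∈ C ∧ f ∈ C)} =
      elemClass (stressOn p G.edgeSet) e := by
    ext f
    constructor
    · exact fun h => h.2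
    · intro h
      refine ⟨?_, h⟩
      rcases h with rfl | ⟨C, hC, -, hf⟩
      · exact he
      · exact ((rdCircuit_iff hp).mpr hC).1 hf
  rw [this]

end RankLink

section Counting

/-- The neighbours of `w` in the edge set `B`. -/
def nbr (B : Set (Sym2 V)) (w : V) : Set V := {v | s(w, v) ∈ B}

/-- The edges of `B` avoiding `w`. -/
def delV (B : Set (Sym2 V)) (w : V) : Set (Sym2 V) := {e | e ∈ B ∧ w ∉ e}

theorem delV_subset (B : Set (Sym2 V)) (w : V) : delV B w ⊆ B := fun _ h => h.1

theorem notMem_delV (B : Set (Sym2 V)) (w v : V) : s(w, v) ∉ delV B w := fun h => h.2 (by simp)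

theorem mem_vertexSpan {B : Set (Sym2 V)} {w : V} : w ∈ vertexSpan B ↔ ∃ v, s(w, v) ∈ B := by
  constructor
  · rintro ⟨e, he, hw⟩
    obtain ⟨v, rfl⟩ := Sym2.mem_iff_exists.mp hw
    exact ⟨v, he⟩
  · rintro ⟨v, h⟩
    exact ⟨_, h, by simp⟩

theorem left_mem_vertexSpan {B : Set (Sym2 V)} {u v : V} (h : s(u, v) ∈ B) : u ∈ vertexSpan B :=
  ⟨_, h, by simp⟩

theorem right_mem_vertexSpan {B : Set (Sym2 V)} {u v : V} (h : s(u, v) ∈ B) : v ∈ vertexSpan B :=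
  ⟨_, h, by simp⟩

theorem vertexSpan_mono {B B' : Set (Sym2 V)} (h : B ⊆ B') : vertexSpan B ⊆ vertexSpan B' :=
  fun _ ⟨e, he, hu⟩ => ⟨e, h he, hu⟩

theorem vertexSpan_union (B B' : Set (Sym2 V)) :
    vertexSpan (B ∪ B') = vertexSpan B ∪ vertexSpan B' := by
  ext u
  simp only [vertexSpan, Set.mem_ofPred_eq, Set.mem_union]
  constructor
  · rintro ⟨e, h | h, hu⟩
    exacts [Or.inl ⟨e, h, hu⟩, Or.inr ⟨e, h, hu⟩]
  · rintro (⟨e, h, hu⟩ | ⟨e, h, hu⟩)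
    exacts [⟨e, Or.inl h, hu⟩, ⟨e, Or.inr h, hu⟩]

theorem eq_delV_union {B : Set (Sym2 V)} {w x y z : V} (h : nbr B w = {x, y, z}) :
    B = delV B w ∪ {s(w, x), s(w, y), s(w, z)} := by
  ext e
  constructor
  · intro he
    by_cases hw : w ∈ e
    · obtain ⟨v, rfl⟩ := Sym2.mem_iff_exists.mp hw
      right
      have : v ∈ nbr B w := he
      rw [h] at this
      rcases this with rfl | rfl | rfl <;> simp
    · exact Or.inl ⟨he, hw⟩
  · rintro (he | he)
    · exact he.1
    · have key : ∀ v ∈ ({x, y, z} : Set V), s(w, v) ∈ B := fun v hv => by rw [← h] at hv; exact hv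
      rcases he with rfl | rfl | rfl
      exacts [key _ (by simp), key _ (by simp), key _ (by simp)]

theorem nbr_ne {B : Set (Sym2 V)} (hB : ∀ e ∈ B, ¬ e.IsDiag) {w v : V} (h : v ∈ nbr B w) : w ≠ v := by
  rintro rfl; exact hB _ h (by simp)

variable [Fintype V] [DecidableEq V]

theorem ncard_delV_lt {B : Set (Sym2 V)} {w : V} (hw : w ∈ vertexSpan B) :
    (delV B w).ncard < B.ncard := by
  obtain ⟨v, hv⟩ := mem_vertexSpan.mp hw
  exact Set.ncard_lt_ncard ⟨delV_subset B w, fun h => notMem_delV B w v (h hv)⟩ (Set.toFinite _)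

theorem sum_ncard_nbr {B : Set (Sym2 V)} (hB : ∀ e ∈ B, ¬ e.IsDiag) :
    ∑ w, (nbr B w).ncard = 2 * B.ncard := by
  classical
  have h := SimpleGraph.sum_degrees_eq_twice_card_edges (SimpleGraph.fromEdgeSet B)
  have h1 : ∀ w, (SimpleGraph.fromEdgeSet B).degree w = (nbr B w).ncard := by
    intro w
    rw [← SimpleGraph.card_neighborSet_eq_degree, ← Nat.card_eq_fintype_card, Nat.card_coe_set_eq]
    congr 1
    ext v
    simp only [SimpleGraph.mem_neighborSet, SimpleGraph.fromEdgeSet_adj, nbr, Set.mem_ofPred_eq]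
    exact ⟨fun h => h.1, fun h => ⟨h, nbr_ne hB h⟩⟩
  have h2 : (SimpleGraph.fromEdgeSet B).edgeFinset.card = B.ncard := by
    rw [← Set.ncard_coe_finset, SimpleGraph.coe_edgeFinset, SimpleGraph.edgeSet_fromEdgeSet]
    congr 1
    ext e
    exact ⟨fun h => h.1, fun h => ⟨h, hB e h⟩⟩
  simp only [h1] at h
  rw [h, ← h2]
  congr!

theorem PinIndep.ncard_le {p : Pl V} {X : Set V} {B : Set (Sym2 V)} (h : PinIndep p X B) :
    B.ncard ≤ 2 * (vertexSpan B \ X).ncard := by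
  classical
  let ext : (B → ℝ) →ₗ[ℝ] (Sym2 V → ℝ) := Function.ExtendByZero.linearMap ℝ Subtype.val
  let L : (Sym2 V → ℝ) →ₗ[ℝ] (↥(vertexSpan B \ X) × Fin 2 → ℝ) :=
    { toFun := fun ω ui => force p ω ui.1 ui.2
      map_add' := fun ω τ => by ext; simp [force_add]
      map_smul' := fun c ω => by ext; simp [force_smul] }
  have hin : ∀ (c : B → ℝ) (e : B), ext c e.1 = c e := fun c e =>
    Subtype.val_injective.extend_apply c 0 e
  have hout : ∀ (c : B → ℝ) (e), e ∉ B → ext c e = 0 := fun c e he =>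
    Function.extend_apply' (f := (Subtype.val : B → Sym2 V)) c 0 e
      (by rintro ⟨⟨a, ha⟩, rfl⟩; exact he ha)
  have hinj : Function.Injective (L ∘ₗ ext) := by
    rw [← LinearMap.ker_eq_bot, LinearMap.ker_eq_bot']
    intro c hc
    have : ext c = 0 := by
      apply h _ _ (hout c)
      intro u hu i
      by_cases huB : u ∈ vertexSpan B
      · exact congrFun hc (⟨u, huB, hu⟩, i)
      · refine Finset.sum_eq_zero fun v _ => ?_
        rw [hout c _ fun h' => huB (left_mem_vertexSpan h'), zero_mul]
    ext e
    rw [← hin c e, this]; rfl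
  have := LinearMap.finrank_le_finrank_of_injective hinj
  simp only [Module.finrank_fintype_fun_eq_card, Fintype.card_prod, Fintype.card_fin] at this
  rw [← Nat.card_coe_set_eq, ← Nat.card_coe_set_eq, Nat.card_eq_fintype_card,
    Nat.card_eq_fintype_card]
  omega

theorem sum_force (p : Pl V) (ω : Sym2 V → ℝ) (i : Fin 2) : ∑ u, force p ω u i = 0 := by
  have h := sum_rowF_eq p ω (fun _ => Pi.single i 1)
  rw [Finset.sum_eq_zero] at h
  · rw [h]
    refine Finset.sum_congr rfl fun u _ => ?_
    rw [Finset.sum_eq_single i (by intro j _ hj; simp [hj]) (by simp)]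
    simp
  · intro e _
    induction e with | _ a b => simp [bil]

theorem PinIndep.ncard_le' {p : Pl V} {X : Set V} {B : Set (Sym2 V)} (h : PinIndep p X B)
    (hB : B.Nonempty) (hX : ∀ u ∈ vertexSpan B, u ∉ X) :
    B.ncard + 2 ≤ 2 * (vertexSpan B).ncard := by
  obtain ⟨e, he⟩ := hB
  induction e with | _ y v =>
  have hy : y ∈ vertexSpan B := left_mem_vertexSpan he
  have h0 : ∀ ω : Sym2 V → ℝ, (∀ e ∉ B, ω e = 0) → ∀ u ∉ vertexSpan B, ∀ i, force p ω u i = 0 := by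
    intro ω h2 u huB i
    exact Finset.sum_eq_zero fun v _ => by rw [h2 _ fun h' => huB (left_mem_vertexSpan h'), zero_mul]
  have h1 : PinIndep p (insert y X) B := by
    intro ω h1 h2
    apply h ω _ h2
    intro u hu i
    have key : ∀ w, w ≠ y → force p ω w i = 0 := by
      intro w hw
      by_cases hwX : w ∈ X
      · exact h0 ω h2 w (fun h' => hX w h' hwX) i
      · exact h1 w (by simp [hw, hwX]) i
    by_cases huy : u = y
    · subst huy
      have := sum_force p ω i
      rwa [Finset.sum_eq_single u (fun w _ hw => key w hw) (by simp)] at this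
    · exact key u huy
  have h2 := h1.ncard_le
  have h3 : vertexSpan B \ insert y X = vertexSpan B \ {y} := by
    ext u
    simp only [Set.mem_sdiff, Set.mem_insert_iff, Set.mem_singleton_iff, not_or]
    exact ⟨fun h => ⟨h.1, h.2.1⟩, fun h => ⟨h.1, h.2, hX u h.1⟩⟩
  have h4 := Set.ncard_sdiff_singleton_add_one hy (Set.toFinite _)
  rw [h3] at h2
  omega

/-- A nonempty pinned independent edge set has a free vertex of degree at most three. -/
theorem PinIndep.exists_deg_le {p : Pl V} {X : Set V} {B : Set (Sym2 V)} (h : PinIndep p X B)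
    (hB : B.Nonempty) :
    ∃ w ∈ vertexSpan B, w ∉ X ∧ (nbr B w).ncard ≤ 3 := by
  classical
  by_contra hcon
  push Not at hcon
  have hs := sum_ncard_nbr h.loopless
  set Y := vertexSpan B \ X with hY
  have h4 : 4 * Y.ncard ≤ ∑ w ∈ Y.toFinset, (nbr B w).ncard := by
    rw [Set.ncard_eq_toFinset_card', mul_comm, ← smul_eq_mul]
    refine Finset.card_nsmul_le_sum _ _ _ fun w hw => ?_
    simp only [hY, Set.mem_toFinset, Set.mem_sdiff] at hw
    exact hcon w hw.1 hw.2
  have h5 : ∑ w ∈ Y.toFinset, (nbr B w).ncard ≤ ∑ w, (nbr B w).ncard :=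
    Finset.sum_le_sum_of_subset (Finset.subset_univ _)
  have h6 := h.ncard_le
  rw [← hY] at h6
  by_cases ht : ∃ u ∈ vertexSpan B, u ∈ X
  · obtain ⟨u, hu, huX⟩ := ht
    have h7 : ∑ w ∈ Y.toFinset, (nbr B w).ncard < ∑ w, (nbr B w).ncard := by
      refine Finset.sum_lt_sum_of_subset (Finset.subset_univ _) (Finset.mem_univ u)
        (by simp [hY, huX]) ?_ (fun _ _ _ => Nat.zero_le _)
      obtain ⟨v, hv⟩ := mem_vertexSpan.mp hu
      exact (Set.ncard_pos (Set.toFinite _)).mpr ⟨v, hv⟩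
    omega
  · push Not at ht
    have h7 := h.ncard_le' hB ht
    have h8 : Y.ncard = (vertexSpan B).ncard := by
      congr 1; ext u; simp only [hY, Set.mem_sdiff]; exact ⟨fun h => h.1, fun h => ⟨h, ht u h⟩⟩
    omega

/-- A vertex in equilibrium cannot carry one or two non-parallel stressed edges. -/
theorem star_le_two {p : Pl V} {ω : Sym2 V → ℝ} {w : V} (h0 : ∀ x, x ≠ w → ∃ i, p w i ≠ p x i)
    (hA : ∀ x y, x ≠ w → y ≠ w → x ≠ y → area p w x y ≠ 0) (hf : ∀ i, force p ω w i = 0)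
    {N : Set V} (hN : N.ncard ≤ 2) (hω : ∀ v, v ≠ w → v ∉ N → ω s(w, v) = 0) :
    ∀ v, v ≠ w → ω s(w, v) = 0 := by
  intro v hv
  by_cases hvN : v ∈ N
  swap
  · exact hω v hv hvN
  by_cases h1 : ∃ y ∈ N, y ≠ v ∧ y ≠ w
  · obtain ⟨y, hy, hyv, hyw⟩ := h1
    have hNe : N = {v, y} := by
      symm
      refine Set.eq_of_subset_of_ncard_le ?_ ?_ (Set.toFinite _)
      · rintro u (rfl | rfl) <;> assumption
      · rw [Set.ncard_pair hyv.symm]; exact hN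
    exact (star_two hf (fun u h2 h3 h4 => hω u h2 (by simp [hNe, h3, h4])) hyv.symm
      (hA v y hv hyw hyv.symm)).1
  · push Not at h1
    obtain ⟨i, hi⟩ := h0 v hv
    have := hf i
    rw [force_eq_sum p {v} (fun u hu huw => hω u huw fun huN => huw (h1 u huN (by simpa using hu)))] at this
    simpa [sub_ne_zero.mpr hi] using this

theorem GenPos.star_le_two {p : Pl V} (hp : GenPos p) {ω : Sym2 V → ℝ} {w : V}
    (hf : ∀ i, force p ω w i = 0)
    {N : Set V} (hN : N.ncard ≤ 2) (hω : ∀ v, v ≠ w → v ∉ N → ω s(w, v) = 0) :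
    ∀ v, v ≠ w → ω s(w, v) = 0 :=
  Rigidity.star_le_two (fun x hx => ⟨0, hp.1 w x hx.symm⟩)
    (fun x y hx hy hxy => hp.2 w x y hx.symm hxy hy.symm) hf hN hω

end Counting

section Reduction

variable [Fintype V] [DecidableEq V]

theorem area_swap (p : Pl V) (x y z : V) : area p y x z = - area p x y z := by
  unfold area; ring

theorem ncard_delV_add {B : Set (Sym2 V)} {w : V} (hB : ∀ e ∈ B, ¬ e.IsDiag)
    (h : (nbr B w).ncard = 3) : (delV B w).ncard + 3 = B.ncard := by
  obtain ⟨x, y, z, hxy, hxz, hyz, hN⟩ := Set.ncard_eq_three.mp h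
  have hne : ∀ v ∈ nbr B w, w ≠ v := fun v hv => nbr_ne hB hv
  rw [hN] at hne
  have hwx := hne x (by simp)
  have hwy := hne y (by simp)
  have hwz := hne z (by simp)
  have h5 : ({s(w, x), s(w, y), s(w, z)} : Set (Sym2 V)).ncard = 3 :=
    Set.ncard_eq_three.mpr ⟨_, _, _, by simp [hxy, hwy], by simp [hxz, hwz], by simp [hyz, hwz], rfl⟩
  have h6 : Disjoint (delV B w) {s(w, x), s(w, y), s(w, z)} := by
    rw [Set.disjoint_left]
    rintro e he (rfl | rfl | rfl) <;> exact notMem_delV B w _ he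
  have h7 := Set.ncard_union_eq h6 (Set.toFinite _) (Set.toFinite _)
  rw [← eq_delV_union hN, h5] at h7
  exact h7.symm

/-- The pinned independent star of degree three at `w` has an unlinked pair of ends. -/
theorem PinIndep.exists_not_PLk {p : Pl V} (hp : GenPos p) {X : Set V} {B : Set (Sym2 V)}
    (hB : PinIndep p X B) {w : V} (hw : (nbr B w).ncard = 3) :
    ∃ x y z, x ≠ y ∧ x ≠ z ∧ y ≠ z ∧ w ≠ x ∧ w ≠ y ∧ w ≠ z ∧
      B = delV B w ∪ {s(w, x), s(w, y), s(w, z)} ∧ ¬ PLk p X (delV B w) x y := by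
  obtain ⟨x, y, z, hxy, hxz, hyz, hN⟩ := Set.ncard_eq_three.mp hw
  have hne : ∀ v ∈ nbr B w, w ≠ v := fun v hv => nbr_ne hB.loopless hv
  rw [hN] at hne
  have hwx := hne x (by simp)
  have hwy := hne y (by simp)
  have hwz := hne z (by simp)
  by_contra hcon
  push Not at hcon
  refine not_PinIndep_of_PLk (hp.2 x y z hxy hyz hxz) (hp.2 w y z hwy hyz hwz) hwx hwy hwz hxy hxz hyz
    (notMem_delV B w) (hcon x y z hxy hxz hyz hwx hwy hwz (eq_delV_union hN))
    (hcon x z y hxz hxy hyz.symm hwx hwz hwy (eq_delV_union ?_))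
    (hcon y z x hyz hxy.symm hxz.symm hwy hwz hwx (eq_delV_union ?_)) ?_
  · rw [hN]; ext v; simp; tauto
  · rw [hN]; ext v; simp; tauto
  · rw [← eq_delV_union hN]; exact hB

theorem flat_area_ne_zero {p : Pl V} (hp : Generic p) {X : Set V} {w x y : V} (hw : w ∉ X)
    (hx : x ≠ w) (hy : y ≠ w) (hxy : x ≠ y) : area (flat X p) w x y ≠ 0 := by
  classical
  have key : ∀ r : Pl V, area (flat X r) w x y = MvPolynomial.aeval (fun vi : V × Fin 2 => r vi.1 vi.2)
      (((MvPolynomial.X (x, 0) - MvPolynomial.X (w, 0)) *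
        ((if y ∈ X then 0 else MvPolynomial.X (y, 1)) - MvPolynomial.X (w, 1)) -
      ((if x ∈ X then 0 else MvPolynomial.X (x, 1)) - MvPolynomial.X (w, 1)) *
        (MvPolynomial.X (y, 0) - MvPolynomial.X (w, 0)) : MvPolynomial (V × Fin 2) ℚ)) := by
    intro r
    by_cases hxX : x ∈ X <;> by_cases hyX : y ∈ X <;> simp [area, flat, hw, hxX, hyX]
  intro h
  rw [key] at h
  have h0 := hp (by rw [h, map_zero] : _ = MvPolynomial.aeval _ (0 : MvPolynomial (V × Fin 2) ℚ))
  have h1 := key (fun v i => if v = w ∧ i = 1 then 1 else if v = y ∧ i = 0 then 1 else 0)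
  rw [h0, map_zero] at h1
  simp [area, flat, hw, hx, hy, hxy, hy.symm] at h1

/-- Pinned independence survives projecting the pinned points to a line. -/
theorem PinIndep.flat {p : Pl V} (hp : Generic p) {X : Set V} {B : Set (Sym2 V)}
    (h : PinIndep p X B) : PinIndep (Rigidity.flat X p) X B := by
  obtain ⟨n, hn⟩ : ∃ n, n = B.ncard := ⟨_, rfl⟩
  induction n using Nat.strong_induction_on generalizing B with
  | _ n ih =>
  rcases B.eq_empty_or_nonempty with rfl | hne
  · intro ω _ h2; ext e; exact h2 e (by simp)
  obtain ⟨w, hw, hwX, hdeg⟩ := h.exists_deg_le hne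
  have hlt := ncard_delV_lt hw
  have hdiag := h.loopless
  rcases Nat.lt_or_ge (nbr B w).ncard 3 with h3 | h3
  · intro ω h1 h2
    have hstar := star_le_two (p := Rigidity.flat X p) (ω := ω) (w := w)
      (fun x hx => ⟨0, by simpa [Rigidity.flat] using hp.genPos.1 w x hx.symm⟩)
      (fun x y hx hy hxy => flat_area_ne_zero hp hwX hx hy hxy) (h1 w hwX) (N := nbr B w) (by omega)
      (fun v _ hv => h2 _ hv)
    refine ih _ (hn ▸ hlt) (h.mono (delV_subset B w)) rfl ω h1 fun e he => ?_
    by_cases heB : e ∈ B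
    · have hwe : w ∈ e := by by_contra hc; exact he ⟨heB, hc⟩
      obtain ⟨v, rfl⟩ := Sym2.mem_iff_exists.mp hwe
      exact hstar v (nbr_ne hdiag heB).symm
    · exact h2 e heB
  · obtain ⟨x, y, z, hxy, hxz, hyz, hwx, hwy, hwz, hBe, hP⟩ :=
      h.exists_not_PLk hp.genPos (le_antisymm hdeg h3)
    have hxyB : s(x, y) ∉ delV B w := fun h' => hP (PLk.of_mem h')
    have hxyX : ¬ (x ∈ X ∧ y ∈ X) := by
      rintro ⟨hx, hy⟩
      refine hP ⟨0, fun _ _ => rfl, fun u hu i => ?_⟩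
      rw [force_single p hxy, if_neg (by rintro rfl; exact hu hx), if_neg (by rintro rfl; exact hu hy)]
      simp [force]
    have hA : area (Rigidity.flat X p) x y z ≠ 0 := by
      by_cases hx : x ∈ X
      · rw [← neg_ne_zero, ← area_swap]
        exact flat_area_ne_zero hp (fun hy => hxyX ⟨hx, hy⟩) hxy hyz.symm hxz
      · exact flat_area_ne_zero hp hx hxy.symm hxz.symm hyz
    have hcard : (insert s(x, y) (delV B w)).ncard < n := by
      have h7 := ncard_delV_add hdiag (le_antisymm hdeg h3)
      have := Set.ncard_insert_le s(x, y) (delV B w)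
      omega
    have h8 := ih _ hcard ((h.mono (delV_subset B w)).insert_of_not_PLk hP) rfl
    have h9 := PinIndep.one_extension hwx hwy hwz hxy hxz hyz hA (notMem_delV B w) hwX hxyB h8
    rw [← hBe] at h9
    have he : ∀ t : Fin 2 → ℝ, Function.update (Rigidity.flat X p) w t =
        Rigidity.flat X (Function.update (Rigidity.flat X p) w t) := by
      intro t
      ext u i
      by_cases hu : u ∈ X ∧ i = 1
      · have : u ≠ w := by rintro rfl; exact hwX hu.1
        simp [Rigidity.flat, hu, this]
      · simp [Rigidity.flat, hu]
    rw [he] at h9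
    exact PinIndep.flat_generic hp h9

end Reduction

section Circuits

variable [Fintype V] [DecidableEq V]

/-- The generic circuits, as elementary supports of stresses. -/
abbrev Circ (p : Pl V) (C : Set (Sym2 V)) : Prop := IsElem (stressOn p Set.univ) C

theorem isElem_stressOn_iff {p : Pl V} {E C : Set (Sym2 V)} :
    IsElem (stressOn p E) C ↔ C ⊆ E ∧ Circ p C := by
  constructor
  · rintro ⟨⟨ω, hω, hω0, rfl⟩, h2⟩
    have hE : Function.support ω ⊆ E := fun e he => by by_contra h; exact he (hω.2 e h)
    refine ⟨hE, ⟨ω, stressOn_mono (Set.subset_univ _) hω, hω0, rfl⟩, fun τ hτ hτ0 hs => h2 τ ?_ hτ0 hs⟩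
    exact ⟨hτ.1, fun e he => by by_contra h; exact he (hE (hs h))⟩
  · rintro ⟨hE, ⟨ω, hω, hω0, rfl⟩, h2⟩
    refine ⟨⟨ω, ⟨hω.1, fun e he => by by_contra h; exact he (hE h)⟩, hω0, rfl⟩,
      fun τ hτ hτ0 hs => h2 τ (stressOn_mono (Set.subset_univ _) hτ) hτ0 hs⟩

theorem Circ.indep_of_ssubset {p : Pl V} {C B : Set (Sym2 V)} (hC : Circ p C) (h : B ⊂ C) :
    Indep p B := by
  rw [indep_iff]
  intro ω hω
  by_contra h0
  have hs : Function.support ω ⊆ B := fun e he => by by_contra h'; exact he (hω.2 e h')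
  have := hC.2 ω (stressOn_mono (Set.subset_univ _) hω) h0 (hs.trans h.subset)
  exact h.not_subset (this ▸ hs)

theorem Circ.not_indep {p : Pl V} {C : Set (Sym2 V)} (hC : Circ p C) : ¬ Indep p C := by
  obtain ⟨ω, hω, h0, rfl⟩ := hC.1
  intro h
  exact h0 (indep_iff.mp h ω ⟨hω.1, fun e he => by simpa using he⟩)

theorem Circ.three_le {p : Pl V} (hp : GenPos p) {C : Set (Sym2 V)} (hC : Circ p C)
    (hl : ∀ e ∈ C, ¬ e.IsDiag) {w : V} (hw : w ∈ vertexSpan C) : 3 ≤ (nbr C w).ncard := by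
  by_contra hlt
  obtain ⟨ω, hω, h0, rfl⟩ := hC.1
  obtain ⟨v, hv⟩ := mem_vertexSpan.mp hw
  exact hv (hp.star_le_two (hω.1 w) (N := nbr (Function.support ω) w) (by omega)
    (fun u _ hu => by simpa [nbr] using hu) v (nbr_ne hl hv).symm)

theorem Circ.exists_deg_le {p : Pl V} {C : Set (Sym2 V)} (hC : Circ p C)
    (hl : ∀ e ∈ C, ¬ e.IsDiag) : ∃ w ∈ vertexSpan C, (nbr C w).ncard ≤ 3 := by
  by_contra hcon
  push Not at hcon
  obtain ⟨e, he⟩ : C.Nonempty := by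
    obtain ⟨⟨ω, -, h0, rfl⟩, -⟩ := hC
    exact Function.support_nonempty_iff.mpr h0
  have hcard := Set.ncard_sdiff_singleton_add_one he (Set.toFinite C)
  obtain ⟨w, hw⟩ : (vertexSpan C).Nonempty := by
    induction e with | _ a b => exact ⟨a, left_mem_vertexSpan he⟩
  have h4 : 4 * (vertexSpan C).ncard ≤ 2 * C.ncard := by
    classical
    rw [← sum_ncard_nbr hl, Set.ncard_eq_toFinset_card', mul_comm, ← smul_eq_mul]
    refine (Finset.card_nsmul_le_sum _ (fun w => (nbr C w).ncard) 4
      (fun w hw => hcon w (by simpa using hw))).trans ?_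
    exact Finset.sum_le_univ_sum_of_nonneg (fun _ => Nat.zero_le _)
  have h5 : 0 < (vertexSpan C).ncard := (Set.ncard_pos (Set.toFinite _)).mpr ⟨w, hw⟩
  have hi : Indep p (C \ {e}) := hC.indep_of_ssubset
    ⟨Set.sdiff_subset, fun h => (h he).2 rfl⟩
  have h6 := Set.ncard_le_ncard (vertexSpan_mono (Set.sdiff_subset : C \ {e} ⊆ C)) (Set.toFinite _)
  have h7 := PinIndep.ncard_le' hi (Set.nonempty_iff_ne_empty.mpr fun h => by
    rw [h, Set.ncard_empty] at hcard; omega) (by simp)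
  omega

theorem RigidOn.insert_of_lk {p : Pl V} (hp : GenPos p) {F : Set (Sym2 V)} {X : Set V}
    (hX : RigidOn p F X) {x y w : V} (hxy : x ≠ y) (hx : x ∈ X) (hy : y ∈ X)
    (hwx : Lk p F w x) (hwy : Lk p F w y) : RigidOn p F (Insert.insert w X) := by
  by_cases hw : w ∈ X
  · rwa [Set.insert_eq_of_mem hw]
  · exact hX.insert hp hxy hx hy hwx hwy hw

theorem vertexSpan_singleton (a b : V) : vertexSpan {s(a, b)} = {a, b} := by
  ext u; simp [vertexSpan]

theorem exists_rigid_piece {p : Pl V} (hp : GenPos p) {B : Set (Sym2 V)} {a b : V} (h : Lk p B a b)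
    (hr : ∀ D ⊆ insert s(a, b) B, Circ p D → RigidOn p D (vertexSpan D)) :
    ∃ Q ⊆ B, ∃ X, a ∈ X ∧ b ∈ X ∧ vertexSpan Q ⊆ X ∧ RigidOn p Q X := by
  by_cases hB : s(a, b) ∈ B
  · refine ⟨{s(a, b)}, by simpa using hB, {a, b}, by simp, by simp, (vertexSpan_singleton a b).subset, ?_⟩
    apply rigidOn_of_lk hp
    have h1 : Lk p {s(a, b)} a b := Lk.of_mem rfl
    rintro x (rfl | rfl) y (rfl | rfl)
    exacts [Lk.self _ _ _, h1, h1.symm, Lk.self _ _ _]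
  · obtain ⟨ω, hω, h1⟩ := exists_stress_of_lk h hB
    obtain ⟨D, hD, heD, -⟩ := exists_isElem_of_mem_support hω (e := s(a, b)) (by simp [h1])
    obtain ⟨hDB, hDc⟩ := isElem_stressOn_iff.mp hD
    obtain ⟨⟨τ, hτ, hτ0, rfl⟩, -⟩ := hDc
    refine ⟨Function.support τ \ {s(a, b)}, fun e he => (hDB he.1).resolve_left he.2,
      vertexSpan (Function.support τ), left_mem_vertexSpan heD, right_mem_vertexSpan heD,
      vertexSpan_mono Set.sdiff_subset, (hr _ hDB (isElem_stressOn_iff.mp hD).2).trans fun u v huv => ?_⟩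
    have hlk : Lk p (Function.support τ \ {s(a, b)}) a b :=
      lk_of_stress (ω := τ) hτ.1 (fun e he he' => by
        by_contra hc; exact he' ⟨hc, he⟩) heD
    by_cases huv' : s(u, v) = s(a, b)
    · rcases Sym2.eq_iff.mp huv' with ⟨rfl, rfl⟩ | ⟨rfl, rfl⟩
      exacts [hlk, hlk.symm]
    · exact Lk.of_mem ⟨huv, huv'⟩

/-- Generic circuits are rigid. -/
theorem Circ.rigidOn {p : Pl V} (hp : Generic p) {C : Set (Sym2 V)} (hC : Circ p C)
    (hl : ∀ e ∈ C, ¬ e.IsDiag) : RigidOn p C (vertexSpan C) := by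
  obtain ⟨n, hn⟩ : ∃ n, n = C.ncard := ⟨_, rfl⟩
  induction n using Nat.strong_induction_on generalizing C with
  | _ n ih =>
  have hg := hp.genPos
  obtain ⟨w, hw, hdeg⟩ := hC.exists_deg_le hl
  have h3 := le_antisymm hdeg (hC.three_le hg hl hw)
  obtain ⟨x, y, z, hxy, hxz, hyz, hN⟩ := Set.ncard_eq_three.mp h3
  have hne : ∀ v ∈ nbr C w, w ≠ v := fun v hv => nbr_ne hl hv
  rw [hN] at hne
  have hwx := hne x (by simp)
  have hwy := hne y (by simp)
  have hwz := hne z (by simp)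
  have hCe := eq_delV_union hN
  have hind : Indep p (delV C w) := hC.indep_of_ssubset
    ⟨delV_subset C w, fun h => by
      obtain ⟨v, hv⟩ := mem_vertexSpan.mp hw
      exact notMem_delV C w v (h hv)⟩
  have key : ∀ x y z, x ≠ y → x ≠ z → y ≠ z → w ≠ x → w ≠ y → w ≠ z →
      C = delV C w ∪ {s(w, x), s(w, y), s(w, z)} →
      ∃ Q ⊆ delV C w, ∃ X, x ∈ X ∧ y ∈ X ∧ vertexSpan Q ⊆ X ∧ RigidOn p Q X := by
    intro x y z hxy hxz hyz hwx hwy hwz hCe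
    have hlk : Lk p (delV C w) x y := by
      by_contra hlk
      have hP : ¬ PLk p ∅ (delV C w) x y := fun h => hlk (lk_of_PLk h)
      have h1 := PinIndep.one_extension hwx hwy hwz hxy hxz hyz (hg.2 x y z hxy hyz hxz)
        (notMem_delV C w) (by simp) (fun h => hlk (Lk.of_mem h)) (hind.insert_of_not_PLk hP)
      rw [← hCe] at h1
      exact hC.not_indep (PinIndep.generic hp h1)
    refine exists_rigid_piece hg hlk fun D hD hDc => ih _ ?_ hDc (fun e he => ?_) rfl
    · have h7 := ncard_delV_add hl h3
      have h8 := Set.ncard_insert_le s(x, y) (delV C w)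
      have h9 := Set.ncard_le_ncard hD (Set.toFinite _)
      omega
    · rcases hD he with rfl | h
      · simpa using hxy
      · exact hl e h.1
  obtain ⟨Q₁, hQ₁, X₁, hx₁, hy₁, hs₁, hr₁⟩ := key x y z hxy hxz hyz hwx hwy hwz hCe
  obtain ⟨Q₂, hQ₂, X₂, hx₂, hz₂, hs₂, hr₂⟩ := key x z y hxz hxy hyz.symm hwx hwz hwy
    (eq_delV_union (by rw [hN]; ext v; simp; tauto))
  obtain ⟨Q₃, hQ₃, X₃, hy₃, hz₃, hs₃, hr₃⟩ := key y z x hyz hxy.symm hxz.symm hwy hwz hwx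
    (eq_delV_union (by rw [hN]; ext v; simp; tauto))
  set T := Q₁ ∪ Q₂ ∪ Q₃ with hT
  have hr₁' : RigidOn p T X₁ := hr₁.mono (fun e h => Or.inl (Or.inl h)) subset_rfl
  have hr₂' : RigidOn p T X₂ := hr₂.mono (fun e h => Or.inl (Or.inr h)) subset_rfl
  have hr₃' : RigidOn p T X₃ := hr₃.mono (fun e h => Or.inr h) subset_rfl
  have hTC : T ⊆ delV C w := Set.union_subset (Set.union_subset hQ₁ hQ₂) hQ₃
  have hxyT := hr₁'.lk hx₁ hy₁
  have hxzT := hr₂'.lk hx₂ hz₂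
  have hyzT := hr₃'.lk hy₃ hz₃
  have h0 : RigidOn p T {x, y, z} := by
    apply rigidOn_of_lk hg
    rintro a (rfl | rfl | rfl) b (rfl | rfl | rfl)
    exacts [Lk.self _ _ _, hxyT, hxzT, hxyT.symm, Lk.self _ _ _, hyzT, hxzT.symm, hyzT.symm, Lk.self _ _ _]
  have h4 := ((h0.union hg hr₁' hxy (by simp) hx₁ (by simp) hy₁).union hg hr₂' hxz (by simp) hx₂
    (by simp) hz₂).union hg hr₃' hyz (by simp) hy₃ (by simp) hz₃
  have hdep : ¬ Indep p (T ∪ {s(w, x), s(w, y), s(w, z)}) :=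
    not_PinIndep_of_PLk (hg.2 x y z hxy hyz hxz) (hg.2 w y z hwy hyz hwz) hwx hwy hwz hxy hxz hyz
      (fun v h => notMem_delV C w v (hTC h)) (hxyT.PLk _) (hxzT.PLk _) (hyzT.PLk _)
  have hTe : T ∪ {s(w, x), s(w, y), s(w, z)} = C := by
    by_contra hne
    exact hdep (hC.indep_of_ssubset ((hCe ▸ Set.union_subset_union_left _ hTC :
      T ∪ {s(w, x), s(w, y), s(w, z)} ⊆ C).ssubset_of_ne hne))
  have hT' : T ⊆ C := hTC.trans (delV_subset C w)
  have h5 := (h4.mono hT' subset_rfl).insert_of_lk hg (x := x) (y := y) (w := w) hxy (by simp) (by simp)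
    (Lk.of_mem (show s(w, x) ∈ C by rw [← hTe]; simp)) (Lk.of_mem (show s(w, y) ∈ C by rw [← hTe]; simp))
  refine h5.mono subset_rfl ?_
  rw [← hTe, vertexSpan_union, hT, vertexSpan_union, vertexSpan_union]
  refine Set.union_subset (Set.union_subset (Set.union_subset ?_ ?_) ?_) ?_
  · exact fun u hu => by simp [hs₁ hu]
  · exact fun u hu => by simp [hs₂ hu]
  · exact fun u hu => by simp [hs₃ hu]
  · rintro u ⟨e, (rfl | rfl | rfl), hu⟩ <;> rcases Sym2.mem_iff.mp hu with rfl | rfl <;> simp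

end Circuits

section Connected

variable [Fintype V] [DecidableEq V]

abbrev Loopless (F : Set (Sym2 V)) : Prop := ∀ e ∈ F, ¬ e.IsDiag

/-- Restricting to `D` maps stresses on `F` to stresses. -/
def IsSeparator (p : Pl V) (F D : Set (Sym2 V)) : Prop :=
  ∀ ω ∈ stressOn p F, D.indicator ω ∈ stressOn p F

/-- Connectivity of the generic rigidity matroid restricted to `F`. -/
def RCon (p : Pl V) (F : Set (Sym2 V)) : Prop :=
  F.Nonempty ∧ ∀ D ⊆ F, D.Nonempty → IsSeparator p F D → D = F

theorem stress_eq_zero {p : Pl V} {F : Set (Sym2 V)} {ω : Sym2 V → ℝ} (h : ω ∈ stressOn p F)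
    {e : Sym2 V} (he : e ∉ F) : ω e = 0 := h.2 e he

theorem stressOn_of_subset {p : Pl V} {F F' : Set (Sym2 V)} {ω : Sym2 V → ℝ}
    (h : ω ∈ stressOn p F) (hF : ∀ e ∉ F', ω e = 0) : ω ∈ stressOn p F' := ⟨h.1, hF⟩

theorem indicator_stressOn_subset {p : Pl V} {F D : Set (Sym2 V)} {ω : Sym2 V → ℝ}
    (h : D.indicator ω ∈ stressOn p F) : D.indicator ω ∈ stressOn p D :=
  stressOn_of_subset h fun _ he => Set.indicator_of_notMem he ω

theorem IsSeparator.compl {p : Pl V} {F D : Set (Sym2 V)} (h : IsSeparator p F D) :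
    IsSeparator p F (F \ D) := by
  intro ω hω
  have : (F \ D).indicator ω = ω - D.indicator ω := by
    ext e
    by_cases hF : e ∈ F <;> by_cases hD : e ∈ D <;> simp [hF, hD]
    · exact (stress_eq_zero hω hF).symm
  rw [this]
  exact Submodule.sub_mem _ hω (h ω hω)

theorem isSeparator_elemClass (p : Pl V) (F : Set (Sym2 V)) (e : Sym2 V) :
    IsSeparator p F (elemClass (stressOn p F) e) := fun _ hω => indicator_elemClass_mem e hω

theorem elemClass_stressOn_subset {p : Pl V} {F : Set (Sym2 V)} {e : Sym2 V} (he : e ∈ F) :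
    elemClass (stressOn p F) e ⊆ F := by
  rintro f (rfl | ⟨C, hC, -, hf⟩)
  · exact he
  · exact (isElem_stressOn_iff.mp hC).1 hf

theorem RCon.elemClass_eq {p : Pl V} {F : Set (Sym2 V)} (h : RCon p F) {e : Sym2 V} (he : e ∈ F) :
    elemClass (stressOn p F) e = F :=
  h.2 _ (elemClass_stressOn_subset he) ⟨e, Or.inl rfl⟩ (isSeparator_elemClass p F e)

theorem RCon.exists_circ {p : Pl V} {F : Set (Sym2 V)} (h : RCon p F) {e f : Sym2 V} (he : e ∈ F)
    (hf : f ∈ F) (hef : e ≠ f) : ∃ C ⊆ F, Circ p C ∧ e ∈ C ∧ f ∈ C := by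
  rw [← h.elemClass_eq he] at hf
  obtain ⟨C, hC, h1, h2⟩ := hf.resolve_left hef
  exact ⟨C, (isElem_stressOn_iff.mp hC).1, (isElem_stressOn_iff.mp hC).2, h1, h2⟩

theorem elemClass_comm {p : Pl V} {F : Set (Sym2 V)} {e f : Sym2 V} (h : f ∈ elemClass (stressOn p F) e) :
    e ∈ elemClass (stressOn p F) f := by
  rcases h with rfl | ⟨C, hC, h1, h2⟩
  exacts [Or.inl rfl, Or.inr ⟨C, hC, h2, h1⟩]

theorem elemClass_eq_of_mem {p : Pl V} {F : Set (Sym2 V)} {e f : Sym2 V}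
    (h : f ∈ elemClass (stressOn p F) e) : elemClass (stressOn p F) f = elemClass (stressOn p F) e :=
  (elemClass_subset h (isSeparator_elemClass p F e)).antisymm
    (elemClass_subset (elemClass_comm h) (isSeparator_elemClass p F f))

theorem rCon_elemClass {p : Pl V} {F : Set (Sym2 V)} {e : Sym2 V} (he : e ∈ F) :
    RCon p (elemClass (stressOn p F) e) := by
  refine ⟨⟨e, Or.inl rfl⟩, fun D hD hne hs => hD.antisymm ?_⟩
  obtain ⟨f, hf⟩ := hne
  rw [← elemClass_eq_of_mem (hD hf)]
  refine elemClass_subset hf fun ω hω => ?_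
  have h1 := hs _ (indicator_stressOn_subset (indicator_elemClass_mem e hω))
  rw [Set.indicator_indicator, Set.inter_eq_left.mpr hD] at h1
  exact stressOn_mono (elemClass_stressOn_subset he) h1

theorem RCon.union {p : Pl V} {F F' : Set (Sym2 V)} (h : RCon p F) (h' : RCon p F') {e : Sym2 V}
    (he : e ∈ F) (he' : e ∈ F') : RCon p (F ∪ F') := by
  refine ⟨h.1.inl, fun D hD hne hs => ?_⟩
  have aux : ∀ G, G ⊆ F ∪ F' → IsSeparator p G (D ∩ G) := by
    intro G hG ω hω
    have h1 := hs ω (stressOn_mono hG hω)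
    have h2 : (D ∩ G).indicator ω = D.indicator ω := by
      ext f
      by_cases hf : f ∈ G
      · by_cases hfD : f ∈ D <;> simp [hf, hfD]
      · by_cases hfD : f ∈ D <;> simp [hf, hfD, stress_eq_zero hω hf]
    rw [h2]
    exact stressOn_of_subset h1 fun f hf => by
      by_cases hfD : f ∈ D <;> simp [hfD, stress_eq_zero hω hf]
  have h1 := fun hn => h.2 _ Set.inter_subset_right hn (aux F Set.subset_union_left)
  have h2 := fun hn => h'.2 _ Set.inter_subset_right hn (aux F' Set.subset_union_right)
  refine hD.antisymm ?_
  by_cases heD : e ∈ D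
  · exact Set.union_subset (Set.inter_eq_right.mp (h1 ⟨e, heD, he⟩))
      (Set.inter_eq_right.mp (h2 ⟨e, heD, he'⟩))
  · obtain ⟨f, hf⟩ := hne
    rcases hD hf with hfF | hfF
    · exact absurd (Set.inter_eq_right.mp (h1 ⟨f, hf, hfF⟩) he) heD
    · exact absurd (Set.inter_eq_right.mp (h2 ⟨f, hf, hfF⟩) he') heD

theorem Circ.rCon {p : Pl V} {C : Set (Sym2 V)} (hC : Circ p C) : RCon p C := by
  obtain ⟨⟨ω, hω, h0, rfl⟩, h2⟩ := hC
  refine ⟨Function.support_nonempty_iff.mpr h0, fun D hD ⟨e, he⟩ hs => ?_⟩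
  have h1 := hs ω (stressOn_of_subset hω fun e he => by simpa using he)
  have h3 : Function.support (D.indicator ω) = D := by
    rw [Set.support_indicator]; exact Set.inter_eq_left.mpr hD
  rw [← h3]
  refine h2 _ (stressOn_mono (Set.subset_univ _) h1) ?_ (h3.trans_subset hD)
  intro h4
  exact hD he (by simpa [he] using congrFun h4 e)

theorem RCon.rigidOn {p : Pl V} (hp : Generic p) {F : Set (Sym2 V)} (h : RCon p F) (hl : Loopless F)
    (hF : F.Nontrivial) : RigidOn p F (vertexSpan F) := by
  obtain ⟨e, he⟩ := h.1
  induction e with | _ a b =>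
  have hab : a ≠ b := by simpa using hl _ he
  have key : ∀ x ∈ vertexSpan F, ∃ X, RigidOn p F X ∧ x ∈ X ∧ a ∈ X ∧ b ∈ X := by
    rintro x ⟨f, hf, hx⟩
    obtain ⟨C, hC, hCc, h1, h2⟩ : ∃ C ⊆ F, Circ p C ∧ s(a, b) ∈ C ∧ f ∈ C := by
      by_cases hef : s(a, b) = f
      · obtain ⟨g, hg, hne⟩ := hF.exists_ne s(a, b)
        obtain ⟨C, h1, h2, h3, -⟩ := h.exists_circ he hg hne.symm
        exact ⟨C, h1, h2, h3, hef ▸ h3⟩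
      · exact h.exists_circ he hf hef
    exact ⟨vertexSpan C, (hCc.rigidOn hp fun e he => hl e (hC he)).mono hC subset_rfl,
      ⟨f, h2, hx⟩, left_mem_vertexSpan h1, right_mem_vertexSpan h1⟩
  refine rigidOn_of_lk hp.genPos fun x hx y hy => ?_
  obtain ⟨X, hX, h1, h2, h3⟩ := key x hx
  obtain ⟨Y, hY, h4, h5, h6⟩ := key y hy
  exact (hX.union hp.genPos hY hab h2 h5 h3 h6).lk (Or.inl h1) (Or.inr h4)

/-- An edge linked by a set of edges lies in the class of one of them. -/
theorem exists_mem_elemClass_of_lk {p : Pl V} (hp : GenPos p) {E D : Set (Sym2 V)} (hD : D ⊆ E) {x y : V}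
    (hxy : x ≠ y) (h : Lk p D x y) (hE : s(x, y) ∈ E) : ∃ f ∈ D, s(x, y) ∈ elemClass (stressOn p E) f := by
  by_cases hxD : s(x, y) ∈ D
  · exact ⟨_, hxD, Or.inl rfl⟩
  obtain ⟨ω, hω, h1⟩ := exists_stress_of_lk h hxD
  obtain ⟨C, hC, heC, -⟩ := exists_isElem_of_mem_support hω (e := s(x, y)) (by simp [h1])
  obtain ⟨hCs, hCc⟩ := isElem_stressOn_iff.mp hC
  obtain ⟨f, hf, hne⟩ : ∃ f ∈ C, f ≠ s(x, y) := by
    by_contra hcon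
    push Not at hcon
    obtain ⟨⟨τ, hτ, -, rfl⟩, -⟩ := hCc
    refine heC (hp.star_le_two (hτ.1 x) (N := {y}) (by simp) (fun v _ hv => ?_) y hxy.symm)
    by_contra h0
    have := hcon s(x, v) h0
    simp only [Sym2.eq_iff] at this
    rcases this with ⟨-, h⟩ | ⟨h, -⟩
    exacts [hv h, hxy h]
  have hfD := (hCs hf).resolve_left hne
  refine ⟨f, hfD, Or.inr ⟨C, isElem_stressOn_iff.mpr ⟨hCs.trans ?_, hCc⟩, hf, heC⟩⟩
  exact Set.insert_subset hE hD

end Connected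

section Separation

variable [Fintype V] [DecidableEq V]

/-- `{x, y}` separates `U` from `W` in the graph with edge set `F`. -/
structure Sep (F : Set (Sym2 V)) (x y : V) (U W : Set V) : Prop where
  left : U.Nonempty
  right : W.Nonempty
  disj : ∀ u ∈ U, u ∉ W
  x_left : x ∉ U
  y_left : y ∉ U
  x_right : x ∉ W
  y_right : y ∉ W
  cover : ∀ u ∈ vertexSpan F, u = x ∨ u = y ∨ u ∈ U ∨ u ∈ W
  sub_left : U ⊆ vertexSpan F
  sub_right : W ⊆ vertexSpan F
  no_edge : ∀ u ∈ U, ∀ w ∈ W, s(u, w) ∉ F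

/-- `F` is the edge set of a 3-connected graph. -/
def ThreeConn (F : Set (Sym2 V)) : Prop :=
  4 ≤ (vertexSpan F).ncard ∧ ∀ x y U W, ¬ Sep F x y U W

/-- The edges meeting `U`. -/
def touch (F : Set (Sym2 V)) (U : Set V) : Set (Sym2 V) := {e ∈ F | ∃ v ∈ e, v ∈ U}

theorem Sep.symm {F : Set (Sym2 V)} {x y : V} {U W : Set V} (h : Sep F x y U W) : Sep F x y W U where
  left := h.right
  right := h.left
  disj w hw hu := h.disj w hu hw
  x_left := h.x_right
  y_left := h.y_right
  x_right := h.x_left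
  y_right := h.y_left
  cover u hu := by have := h.cover u hu; tauto
  sub_left := h.sub_right
  sub_right := h.sub_left
  no_edge w hw u hu := by rw [Sym2.eq_swap]; exact h.no_edge u hu w hw

theorem touch_subset (F : Set (Sym2 V)) (U : Set V) : touch F U ⊆ F := fun _ h => h.1

theorem mem_touch {F : Set (Sym2 V)} {U : Set V} {u v : V} :
    s(u, v) ∈ touch F U ↔ s(u, v) ∈ F ∧ (u ∈ U ∨ v ∈ U) := by
  simp [touch]

theorem Sep.xy_notMem {F : Set (Sym2 V)} {x y : V} {U W : Set V} (h : Sep F x y U W) :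
    s(x, y) ∉ touch F U := fun h' => by
  have := (mem_touch.mp h').2
  have := h.x_left; have := h.y_left; tauto

theorem Sep.touch_nonempty {F : Set (Sym2 V)} {x y : V} {U W : Set V} (h : Sep F x y U W) :
    (touch F U).Nonempty := by
  obtain ⟨u, hu⟩ := h.left
  obtain ⟨e, he, hue⟩ := h.sub_left hu
  exact ⟨e, he, u, hue, hu⟩

theorem Sep.touch_ne {F : Set (Sym2 V)} {x y : V} {U W : Set V} (h : Sep F x y U W) :
    touch F U ≠ F := by
  intro hF
  obtain ⟨w, hw⟩ := h.right
  obtain ⟨v, hv⟩ := mem_vertexSpan.mp (h.sub_right hw)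
  rw [← hF, mem_touch] at hv
  rcases hv.2 with h' | h'
  · exact h.disj w h' hw
  · exact h.no_edge v h' w hw (Sym2.eq_swap ▸ hv.1)

theorem Sep.vertexSpan_touch_subset {F : Set (Sym2 V)} {x y : V} {U W : Set V} (h : Sep F x y U W) :
    vertexSpan (touch F U) ⊆ insert x (insert y U) := by
  intro u hu
  obtain ⟨v, hv⟩ := mem_vertexSpan.mp hu
  rw [mem_touch] at hv
  by_cases huU : u ∈ U
  · simp [huU]
  have hvU := hv.2.resolve_left huU
  rcases h.cover u (left_mem_vertexSpan hv.1) with rfl | rfl | h1 | h1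
  · simp
  · simp
  · exact absurd h1 huU
  · exact absurd (Sym2.eq_swap ▸ hv.1) (h.no_edge v hvU u h1)

theorem Sep.subset_vertexSpan_touch {F : Set (Sym2 V)} {x y : V} {U W : Set V} (h : Sep F x y U W) :
    U ⊆ vertexSpan (touch F U) := by
  intro u hu
  obtain ⟨v, hv⟩ := mem_vertexSpan.mp (h.sub_left hu)
  exact left_mem_vertexSpan (mem_touch.mpr ⟨hv, Or.inl hu⟩)

theorem force_indicator_touch {p : Pl V} {F : Set (Sym2 V)} {x y : V} {U W : Set V} (h : Sep F x y U W)
    {ω : Sym2 V → ℝ} (hω : ω ∈ stressOn p F) {u : V} (hx : u ≠ x) (hy : u ≠ y) (i : Fin 2) :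
    force p ((touch F U).indicator ω) u i = 0 := by
  by_cases hu : u ∈ U
  · rw [← hω.1 u i]
    unfold force
    refine Finset.sum_congr rfl fun v _ => ?_
    by_cases hF : s(u, v) ∈ F
    · rw [Set.indicator_of_mem (mem_touch.mpr ⟨hF, Or.inl hu⟩)]
    · rw [Set.indicator_of_notMem fun h' => hF h'.1, stress_eq_zero hω hF]
  · unfold force
    refine Finset.sum_eq_zero fun v _ => ?_
    rw [Set.indicator_of_notMem, zero_mul]
    intro h'
    have := h.vertexSpan_touch_subset (left_mem_vertexSpan h')
    simp only [Set.mem_insert_iff] at this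
    tauto

theorem force_eq_zero_of_one {p : Pl V} {ω : Sym2 V → ℝ} {x : V} (h : ∀ u, u ≠ x → ∀ i, force p ω u i = 0)
    (u : V) (i : Fin 2) : force p ω u i = 0 := by
  by_cases hu : u = x
  · subst hu
    have := sum_force p ω i
    rwa [Finset.sum_eq_single u (fun v _ hv => h v hv i) (by simp)] at this
  · exact h u hu i

theorem rigidOn_pair {p : Pl V} (hp : GenPos p) (x y : V) : RigidOn p {s(x, y)} {x, y} := by
  apply rigidOn_of_lk hp
  have h1 : Lk p {s(x, y)} x y := Lk.of_mem rfl
  rintro a (rfl | rfl) b (rfl | rfl)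
  exacts [Lk.self _ _ _, h1, h1.symm, Lk.self _ _ _]

theorem not_lk_of_notMem {p : Pl V} (hp : GenPos p) {F : Set (Sym2 V)} {x y : V} (hxy : x ≠ y)
    (hx : x ∉ vertexSpan F) : ¬ Lk p F x y := by
  intro h
  have h1 := h (fun u i => if u = x then p x i - p y i else 0) (fun u v huv => by
    have h1 : u ≠ x := by rintro rfl; exact hx (left_mem_vertexSpan huv)
    have h2 : v ≠ x := by rintro rfl; exact hx (right_mem_vertexSpan huv)
    simp [bil, h1, h2])
  have h2 := hp.sqd_pos hxy
  simp [bil, hxy.symm] at h1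
  unfold sqd at h2
  nlinarith

section Cut

variable {p : Pl V} {F : Set (Sym2 V)} {x y : V} {U W : Set V}

theorem Sep.exists_stress (h : Sep F x y U W) (hp : GenPos p) {ω : Sym2 V → ℝ} (hω : ω ∈ stressOn p F) :
    ∃ τ ∈ stressOn p (insert s(x, y) (touch F U)), ∀ e, e ≠ s(x, y) → τ e = (touch F U).indicator ω e := by
  obtain ⟨τ, h1, h2⟩ := exists_stress_of_pinned (rigidOn_pair hp x y) (B := touch F U)
    (ω := (touch F U).indicator ω) (fun u hu i => force_indicator_touch h hω
      (fun h' => hu (by simp [h'])) (fun h' => hu (by simp [h'])) i)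
    (fun e he => Set.indicator_of_notMem he ω)
  exact ⟨τ, by rwa [Set.union_singleton] at h1, fun e he => h2 e he⟩

theorem RCon.sep_lk (hF : RCon p F) (hp : GenPos p) (h : Sep F x y U W) :
    x ≠ y ∧ Lk p (touch F U) x y := by
  by_contra hcon
  have hnl : x ≠ y → ¬ Lk p (touch F U) x y := fun h1 h2 => hcon ⟨h1, h2⟩
  refine h.touch_ne (hF.2 _ (touch_subset F U) h.touch_nonempty fun ω hω => ?_)
  refine ⟨?_, fun e he => Set.indicator_of_notMem (fun h' => he h'.1) ω⟩
  by_cases hxy : x = y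
  · exact force_eq_zero_of_one (x := x) fun u hu i => force_indicator_touch h hω hu (hxy ▸ hu) i
  · obtain ⟨τ, hτ, h1⟩ := h.exists_stress hp hω
    have h0 : τ s(x, y) = 0 := by
      by_contra h0
      exact hnl hxy (lk_of_stress hτ.1 (fun e he he' => hτ.2 e (by simp [he, he'])) h0)
    have : (touch F U).indicator ω = τ := by
      ext e
      by_cases he : e = s(x, y)
      · rw [he, h0, Set.indicator_of_notMem h.xy_notMem]
      · exact (h1 e he).symm
    rw [this]
    exact hτ.1

theorem RCon.sep_ne (hF : RCon p F) (hp : GenPos p) (h : Sep F x y U W) : x ≠ y := (hF.sep_lk hp h).1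

theorem RCon.sep_mem (hF : RCon p F) (hp : GenPos p) (h : Sep F x y U W) :
    x ∈ vertexSpan (touch F U) ∧ y ∈ vertexSpan (touch F U) := by
  obtain ⟨hxy, hl⟩ := hF.sep_lk hp h
  constructor <;> by_contra hcon
  · exact not_lk_of_notMem hp hxy hcon hl
  · exact not_lk_of_notMem hp hxy.symm hcon hl.symm

theorem RCon.vertexSpan_touch (hF : RCon p F) (hp : GenPos p) (h : Sep F x y U W) :
    vertexSpan (touch F U) = insert x (insert y U) :=
  h.vertexSpan_touch_subset.antisymm (Set.insert_subset (hF.sep_mem hp h).1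
    (Set.insert_subset (hF.sep_mem hp h).2 h.subset_vertexSpan_touch))

theorem RCon.sep_rCon (hF : RCon p F) (hp : GenPos p) (h : Sep F x y U W) :
    RCon p (insert s(x, y) (touch F U)) := by
  have key : ∀ D ⊆ touch F U, D.Nonempty → ¬ IsSeparator p (insert s(x, y) (touch F U)) D := by
    intro D hD hne hs
    have h1 := hF.2 D (hD.trans (touch_subset F U)) hne fun ω hω => by
      obtain ⟨τ, hτ, h1⟩ := h.exists_stress hp hω
      have h2 := hs τ hτ
      have h3 : D.indicator τ = D.indicator ω := by
        ext e
        by_cases he : e ∈ D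
        · rw [Set.indicator_of_mem he, Set.indicator_of_mem he, h1 e, Set.indicator_of_mem (hD he)]
          rintro rfl; exact h.xy_notMem (hD he)
        · rw [Set.indicator_of_notMem he, Set.indicator_of_notMem he]
      rw [h3] at h2
      exact ⟨h2.1, fun e he => Set.indicator_of_notMem (fun h' => he (touch_subset F U (hD h'))) ω⟩
    exact h.touch_ne ((touch_subset F U).antisymm (h1 ▸ hD))
  refine ⟨⟨_, Or.inl rfl⟩, fun D hD hne hs => hD.antisymm ?_⟩
  by_cases hxy : s(x, y) ∈ D
  · by_contra hcon
    refine key _ ?_ (Set.sdiff_nonempty.mpr hcon) hs.compl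
    rintro e ⟨he, heD⟩
    exact he.resolve_left (by rintro rfl; exact heD hxy)
  · exact absurd hs (key D (fun e he => (hD he).resolve_left (by rintro rfl; exact hxy he)) hne)

theorem RCon.sep_rigidOn (hF : RCon p F) (hp : Generic p) (hl : Loopless F) (h : Sep F x y U W) :
    RigidOn p (touch F U) (insert x (insert y U)) := by
  obtain ⟨hxy, hlk⟩ := hF.sep_lk hp.genPos h
  obtain ⟨e, he⟩ := h.touch_nonempty
  have h1 := (hF.sep_rCon hp.genPos h).rigidOn hp (Set.forall_mem_insert.mpr ⟨by simpa using hxy,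
    fun e he => hl e he.1⟩) ⟨s(x, y), by simp, e, by simp [he], by rintro rfl; exact h.xy_notMem he⟩
  rw [← hF.vertexSpan_touch hp.genPos h]
  refine (h1.mono subset_rfl (vertexSpan_mono (Set.subset_insert _ _))).trans ?_
  intro u v huv
  by_cases huv' : s(u, v) = s(x, y)
  · rcases Sym2.eq_iff.mp huv' with ⟨rfl, rfl⟩ | ⟨rfl, rfl⟩
    exacts [hlk, hlk.symm]
  · exact Lk.of_mem (huv.resolve_left huv')

end Cut

theorem exists_star_stress {p : Pl V} (hp : GenPos p) {F : Set (Sym2 V)} (hr : RigidOn p F (vertexSpan F))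
    {w x y z : V} (hw : w ∉ vertexSpan F) (hx : x ∈ vertexSpan F) (hy : y ∈ vertexSpan F)
    (hz : z ∈ vertexSpan F) (hxy : x ≠ y) (hxz : x ≠ z) (hyz : y ≠ z) :
    ∃ ω ∈ stressOn p ({s(w, x), s(w, y), s(w, z)} ∪ F), ω s(w, x) ≠ 0 := by
  have hwx : w ≠ x := by rintro rfl; exact hw hx
  have hwy : w ≠ y := by rintro rfl; exact hw hy
  have hwz : w ≠ z := by rintro rfl; exact hw hz
  obtain ⟨a, b, c, d, e, f, ha, hf⟩ := exists_K4_stress (p := p) w x y z (hp.2 x y z hxy hyz hxz)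
    (hp.2 w y z hwy hyz hwz) hwx hwy hwz hxy hxz hyz
  obtain ⟨τ, hτ, h1⟩ := exists_stress_of_pinned hr (B := {s(w, x), s(w, y), s(w, z)})
    (ω := a • Pi.single s(w, x) 1 + b • Pi.single s(w, y) 1 + c • Pi.single s(w, z) 1)
    (fun u hu i => by
      have hux : u ≠ x := by rintro rfl; exact hu hx
      have huy : u ≠ y := by rintro rfl; exact hu hy
      have huz : u ≠ z := by rintro rfl; exact hu hz
      have h0 := hf u i
      simp only [force_add, force_smul] at h0 ⊢
      rw [force_single p hxy, force_single p hxz, force_single p hyz] at h0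
      simpa [hux, huy, huz] using h0)
    (fun e he => by
      simp only [Set.mem_insert_iff, Set.mem_singleton_iff, not_or] at he
      simp [he])
  refine ⟨τ, hτ, ?_⟩
  rw [h1 _ fun h => hw (left_mem_vertexSpan h)]
  simp [hwy, hwz, hxy, hxz, ha]

/-- Attaching a vertex of degree three. -/
theorem RCon.add_star {p : Pl V} (hp : GenPos p) {F : Set (Sym2 V)} (hF : RCon p F)
    (hr : RigidOn p F (vertexSpan F))
    {w x y z : V} (hw : w ∉ vertexSpan F) (hx : x ∈ vertexSpan F) (hy : y ∈ vertexSpan F)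
    (hz : z ∈ vertexSpan F) (hxy : x ≠ y) (hxz : x ≠ z) (hyz : y ≠ z) :
    RCon p ({s(w, x), s(w, y), s(w, z)} ∪ F) := by
  have hwx : w ≠ x := by rintro rfl; exact hw hx
  have hwy : w ≠ y := by rintro rfl; exact hw hy
  have hwz : w ≠ z := by rintro rfl; exact hw hz
  set J : Set (Sym2 V) := {s(w, x), s(w, y), s(w, z)} ∪ F with hJ
  have hJw : ∀ v, v ≠ w → v ≠ x → v ≠ y → v ≠ z → s(w, v) ∉ J := by
    rintro v hv hvx hvy hvz (h | h)
    · simp only [Set.mem_insert_iff, Set.mem_singleton_iff, Sym2.eq_iff] at h; grind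
    · exact hw (left_mem_vertexSpan h)
  -- a stress nowhere zero on the star
  obtain ⟨ω, hω, h1⟩ := exists_star_stress hp hr hw hx hy hz hxy hxz hyz
  have hstar : ∀ τ ∈ stressOn p J, τ s(w, x) = 0 ∨ τ s(w, y) = 0 ∨ τ s(w, z) = 0 →
      τ s(w, x) = 0 ∧ τ s(w, y) = 0 ∧ τ s(w, z) = 0 := by
    intro τ hτ h
    have h2 : ∀ a b c : V, (∀ v, v ≠ w → v ≠ a → v ≠ b → v ≠ c → s(w, v) ∉ J) → τ s(w, c) = 0 →
        ∀ v, v ≠ w → τ s(w, v) = 0 := by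
      intro a b c hc h0
      refine hp.star_le_two (hτ.1 w) (N := {a, b}) (Set.ncard_insert_le a {b} |>.trans (by simp))
        fun v hv hvN => ?_
      simp only [Set.mem_insert_iff, Set.mem_singleton_iff, not_or] at hvN
      by_cases hvc : v = c
      · rw [hvc, h0]
      · exact hτ.2 _ (hc v hv hvN.1 hvN.2 hvc)
    have h3 : ∀ v, v ≠ w → τ s(w, v) = 0 := by
      rcases h with h | h | h
      · exact h2 y z x (fun v hv h1 h2 h3 => hJw v hv h3 h1 h2) h
      · exact h2 x z y (fun v hv h1 h2 h3 => hJw v hv h1 h3 h2) h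
      · exact h2 x y z hJw h
    exact ⟨h3 x hwx.symm, h3 y hwy.symm, h3 z hwz.symm⟩
  have hω0 : ω s(w, x) ≠ 0 ∧ ω s(w, y) ≠ 0 ∧ ω s(w, z) ≠ 0 := by
    refine ⟨h1, fun h => h1 ?_, fun h => h1 ?_⟩
    · exact (hstar ω hω (Or.inr (Or.inl h))).1
    · exact (hstar ω hω (Or.inr (Or.inr h))).1
  have hall : ∀ D, IsSeparator p J D → s(w, x) ∈ D → s(w, x) ∈ D ∧ s(w, y) ∈ D ∧ s(w, z) ∈ D := by
    intro D hs hD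
    by_contra hcon
    have h2 := hstar _ (hs ω hω) (by
      by_contra h3
      push Not at h3
      refine hcon ⟨hD, ?_, ?_⟩ <;> by_contra h4
      · exact h3.2.1 (Set.indicator_of_notMem h4 _)
      · exact h3.2.2 (Set.indicator_of_notMem h4 _))
    rw [Set.indicator_of_mem hD] at h2
    exact h1 h2.1
  have hinter : ∀ D, IsSeparator p J D → IsSeparator p F (D ∩ F) := by
    intro D hs τ hτ
    have h2 := hs τ (stressOn_mono Set.subset_union_right hτ)
    have h3 : (D ∩ F).indicator τ = D.indicator τ := by
      ext e
      by_cases he : e ∈ F <;> by_cases heD : e ∈ D <;> simp [he, heD, stress_eq_zero hτ]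
    rw [h3]
    refine ⟨h2.1, fun e he => ?_⟩
    by_cases heD : e ∈ D <;> simp [heD, hτ.2 e he]
  have key : ∀ D ⊆ J, s(w, x) ∈ D → IsSeparator p J D → D = J := by
    intro D hD hwD hs
    obtain ⟨-, h3, h4⟩ := hall D hs hwD
    refine hD.antisymm (Set.union_subset (by
      rintro e (rfl | rfl | rfl) <;> assumption) ?_)
    rcases (D ∩ F).eq_empty_or_nonempty with h5 | h5
    · exfalso
      have h6 := (hs ω hω).1 x
      have h7 : ∀ i, D.indicator ω s(x, w) * (p x i - p w i) = 0 := by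
        intro i
        rw [← h6 i]
        unfold force
        rw [Finset.sum_eq_single w _ (by simp)]
        intro v _ hv
        by_cases hxv : s(x, v) ∈ D
        · rcases hD hxv with h | h
          · simp only [Set.mem_insert_iff, Set.mem_singleton_iff, Sym2.eq_iff] at h; grind
          · exact absurd h5 (Set.nonempty_iff_ne_empty.mp ⟨_, hxv, h⟩)
        · rw [Set.indicator_of_notMem hxv, zero_mul]
      rw [Sym2.eq_swap, Set.indicator_of_mem hwD] at h7
      exact hp.1 x w hwx.symm (sub_eq_zero.mp ((mul_eq_zero.mp (h7 0)).resolve_left h1))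
    · exact Set.inter_eq_right.mp (hF.2 _ Set.inter_subset_right h5 (hinter D hs))
  refine ⟨hF.1.inr, fun D hD hne hs => ?_⟩
  by_cases hwD : s(w, x) ∈ D
  · exact key D hD hwD hs
  · have h2 := key _ Set.sdiff_subset ⟨by simp [hJ], hwD⟩ hs.compl
    obtain ⟨e, he⟩ := hne
    rw [← h2] at hD
    exact absurd he (hD he).2

end Separation

section Reductions

variable [Fintype V] [DecidableEq V]

theorem nbr_mono {B B' : Set (Sym2 V)} (h : B ⊆ B') (w : V) : nbr B w ⊆ nbr B' w := fun _ hv => h hv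

theorem RCon.exists_circ_of_mem {p : Pl V} {F : Set (Sym2 V)} (h : RCon p F) (hF : F.Nontrivial)
    {e : Sym2 V} (he : e ∈ F) : ∃ C ⊆ F, Circ p C ∧ e ∈ C := by
  obtain ⟨g, hg, hne⟩ := hF.exists_ne e
  obtain ⟨C, h1, h2, h3, -⟩ := h.exists_circ he hg hne.symm
  exact ⟨C, h1, h2, h3⟩

theorem RCon.three_le {p : Pl V} (hp : GenPos p) {F : Set (Sym2 V)} (h : RCon p F) (hl : Loopless F)
    (hF : F.Nontrivial) {w : V} (hw : w ∈ vertexSpan F) : 3 ≤ (nbr F w).ncard := by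
  obtain ⟨v, hv⟩ := mem_vertexSpan.mp hw
  obtain ⟨C, h1, h2, h3⟩ := h.exists_circ_of_mem hF hv
  exact (h2.three_le hp (fun e he => hl e (h1 he)) (left_mem_vertexSpan h3)).trans
    (Set.ncard_le_ncard (nbr_mono h1 w) (Set.toFinite _))

theorem nbr_subset_vertexSpan {F : Set (Sym2 V)} (w : V) : nbr F w ⊆ vertexSpan F :=
  fun _ hv => right_mem_vertexSpan hv

theorem Circ.four_le {p : Pl V} (hp : GenPos p) {C : Set (Sym2 V)} (hC : Circ p C) (hl : Loopless C) :
    4 ≤ (vertexSpan C).ncard := by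
  obtain ⟨e, he⟩ := hC.rCon.1
  induction e with | _ a b =>
  have ha := left_mem_vertexSpan he
  have h1 := hC.three_le hp hl ha
  have h2 : a ∉ nbr C a := fun h => nbr_ne hl h rfl
  have h3 := Set.ncard_insert_of_notMem h2 (Set.toFinite _)
  have h4 := Set.ncard_le_ncard (Set.insert_subset ha (nbr_subset_vertexSpan a)) (Set.toFinite _)
  omega

theorem ThreeConn.three_le_attach {F : Set (Sym2 V)} (hF : ThreeConn F) {X : Set V} (hX : X ⊆ vertexSpan F)
    (h3 : 3 ≤ X.ncard) (hne : ¬ vertexSpan F ⊆ X) :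
    3 ≤ {v ∈ X | ∃ y, y ∉ X ∧ s(y, v) ∈ F}.ncard := by
  by_contra hcon
  set N := {v ∈ X | ∃ y, y ∉ X ∧ s(y, v) ∈ F} with hN
  have hNX : N ⊆ X := fun v hv => hv.1
  obtain ⟨M, hNM, hMX, hM⟩ := Set.exists_subsuperset_card_eq hNX (n := 2) (by omega) (by omega)
  obtain ⟨x, y, hxy, rfl⟩ := Set.ncard_eq_two.mp hM
  have hx := hMX (show x ∈ ({x, y} : Set V) by simp)
  have hy := hMX (show y ∈ ({x, y} : Set V) by simp)
  obtain ⟨t, ht, htx⟩ := Set.not_subset.mp hne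
  refine hF.2 x y (X \ {x, y}) (vertexSpan F \ X) ⟨?_, ⟨t, ht, htx⟩, fun u hu hu' => hu'.2 hu.1, by simp,
    by simp, fun h => h.2 hx, fun h => h.2 hy, fun u hu => ?_, fun u hu => hX hu.1, fun u hu => hu.1, ?_⟩
  · rw [Set.sdiff_nonempty]
    intro h
    have := Set.ncard_le_ncard h (Set.toFinite _)
    omega
  · simp only [Set.mem_sdiff, Set.mem_insert_iff, Set.mem_singleton_iff]; tauto
  · intro u hu w hw huw
    exact hu.2 (hNM ⟨hu.1, w, hw.2, Sym2.eq_swap ▸ huw⟩)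

/-- A 3-connected, matroid-connected graph without vertices of degree three has a removable edge. -/
theorem RCon.exists_removable {p : Pl V} (hp : Generic p) {F : Set (Sym2 V)} (hF : RCon p F)
    (hl : Loopless F) (h3 : ThreeConn F) (hdeg : ∀ w ∈ vertexSpan F, 4 ≤ (nbr F w).ncard) :
    ∃ e ∈ F, RCon p (F \ {e}) := by
  classical
  have hnt : F.Nontrivial := by
    obtain ⟨e, he⟩ := hF.1
    induction e with | _ a b =>
    by_contra hcon
    rw [Set.not_nontrivial_iff] at hcon
    have h4 := hdeg a (left_mem_vertexSpan he)
    have : nbr F a ⊆ {b} := fun v hv => by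
      have := hcon hv he
      simp only [Sym2.eq_iff] at this
      rcases this with ⟨-, rfl⟩ | ⟨h, h'⟩
      exacts [rfl, h'.trans h]
    have := Set.ncard_le_ncard this (Set.toFinite _)
    rw [Set.ncard_singleton] at this; omega
  -- a maximal proper connected subset
  obtain ⟨H, hH, hmax⟩ : ∃ H, (H ⊂ F ∧ RCon p H ∧ H.Nontrivial) ∧
      ∀ H', (H' ⊂ F ∧ RCon p H' ∧ H'.Nontrivial) → H'.ncard ≤ H.ncard := by
    have hne : {H : Set (Sym2 V) | H ⊂ F ∧ RCon p H ∧ H.Nontrivial}.Nonempty := by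
      obtain ⟨e, he⟩ := hF.1
      obtain ⟨C, h1, h2, h4⟩ := hF.exists_circ_of_mem hnt he
      have hlC : Loopless C := fun e he => hl e (h1 he)
      refine ⟨C, h1.ssubset_of_ne ?_, h2.rCon, ?_⟩
      · rintro rfl
        obtain ⟨w, hw, h5⟩ := h2.exists_deg_le hlC
        have := hdeg w hw
        omega
      · induction e with | _ a b =>
        have h6 := h2.three_le hp.genPos hlC (left_mem_vertexSpan h4)
        obtain ⟨f, hf, g, hg, hfg⟩ := (Set.one_lt_ncard (s := nbr C a)).mp (by omega)
        exact ⟨_, hf, _, hg, fun h => hfg (Sym2.congr_right.mp h)⟩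
    obtain ⟨H, hH, hm⟩ := Set.exists_max_image _ Set.ncard (Set.toFinite _) hne
    exact ⟨H, hH, hm⟩
  obtain ⟨hHF, hHc, hHn⟩ := hH
  have hlH : Loopless H := fun e he => hl e (hHF.subset he)
  have hHr := hHc.rigidOn hp hlH hHn
  obtain ⟨C, hC, hmin⟩ : ∃ C, (C ⊆ F ∧ Circ p C ∧ (C ∩ H).Nonempty ∧ ¬ C ⊆ H) ∧
      ∀ C', (C' ⊆ F ∧ Circ p C' ∧ (C' ∩ H).Nonempty ∧ ¬ C' ⊆ H) → (C \ H).ncard ≤ (C' \ H).ncard := by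
    have hne : {C : Set (Sym2 V) | C ⊆ F ∧ Circ p C ∧ (C ∩ H).Nonempty ∧ ¬ C ⊆ H}.Nonempty := by
      obtain ⟨e, he⟩ := hHc.1
      obtain ⟨f, hf, hfH⟩ := Set.exists_of_ssubset hHF
      obtain ⟨C, h1, h2, h4, h5⟩ := hF.exists_circ (hHF.subset he) hf (by rintro rfl; exact hfH he)
      exact ⟨C, h1, h2, ⟨e, h4, he⟩, fun h => hfH (h h5)⟩
    obtain ⟨C, hC, hm⟩ := Set.exists_min_image _ (fun C => (C \ H).ncard) (Set.toFinite _) hne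
    exact ⟨C, hC, hm⟩
  obtain ⟨hCF, hCc, ⟨g, hgC, hgH⟩, hCH⟩ := hC
  have hHC : H ∪ C = F := by
    by_contra hcon
    have h1 := hmax (H ∪ C) ⟨(Set.union_subset hHF.subset hCF).ssubset_of_ne hcon,
      hHc.union hCc.rCon hgH hgC, hHn.mono Set.subset_union_left⟩
    have h2 := Set.eq_of_subset_of_ncard_le Set.subset_union_left h1 (Set.toFinite _)
    exact hCH (h2 ▸ Set.subset_union_right)
  obtain ⟨e, heC, heH⟩ := Set.not_subset.mp hCH
  have hpin : PinIndep p (vertexSpan H) ((C \ H) \ {e}) := by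
    intro ω h1 h2
    by_contra h0
    obtain ⟨f, hf⟩ := Function.ne_iff.mp h0
    have hfD : f ∈ (C \ H) \ {e} := by by_contra h; exact hf (h2 f h)
    obtain ⟨τ, hτ, h4⟩ := exists_stress_of_pinned hHr h1 h2
    obtain ⟨C', hC', hfC', hC's⟩ := exists_isElem_of_mem_support hτ (e := f) (by rwa [h4 f hfD.1.2])
    obtain ⟨hC'sub, hC'c⟩ := isElem_stressOn_iff.mp hC'
    have heC' : e ∉ C' := by
      intro h
      rcases hC'sub h with h | h
      exacts [h.2 rfl, heH h]
    by_cases hint : (C' ∩ H).Nonempty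
    · have h5 := hmin C' ⟨hC'sub.trans (Set.union_subset (fun _ h => hCF h.1.1) hHF.subset), hC'c, hint,
        fun h => hfD.1.2 (h hfC')⟩
      have h6 : C' \ H ⊂ C \ H := by
        refine ⟨fun a ha => ((hC'sub ha.1).resolve_right ha.2).1, fun h => heC' (h ⟨heC, heH⟩).1⟩
      exact absurd (Set.ncard_lt_ncard h6 (Set.toFinite _)) (by omega)
    · rw [Set.not_nonempty_iff_eq_empty] at hint
      have h5 : C' ⊆ C := fun a ha => by
        rcases hC'sub ha with h | h
        · exact h.1.1
        · exact absurd hint (Set.nonempty_iff_ne_empty.mp ⟨a, ha, h⟩)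
      exact heC' (hC'c.eq_of_subset hCc h5 ▸ heC)
  have hcard := Set.ncard_sdiff_singleton_add_one (show e ∈ C \ H from ⟨heC, heH⟩) (Set.toFinite _)
  have hle := hpin.ncard_le
  have hDF : vertexSpan ((C \ H) \ {e}) ⊆ vertexSpan F :=
    vertexSpan_mono fun a ha => hCF ha.1.1
  by_cases hV : vertexSpan F ⊆ vertexSpan H
  · rw [Set.sdiff_eq_empty.mpr (hDF.trans hV), Set.ncard_empty] at hle
    have h1 : (C \ H) \ {e} = ∅ := (Set.ncard_eq_zero (Set.toFinite _)).mp (by omega)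
    refine ⟨e, hCF heC, ?_⟩
    have : F \ {e} = H := by
      rw [← hHC]
      ext a
      constructor
      · rintro ⟨ha | ha, hae⟩
        · exact ha
        · by_contra haH
          exact absurd h1 (Set.nonempty_iff_ne_empty.mp ⟨a, ⟨ha, haH⟩, hae⟩)
      · exact fun ha => ⟨Or.inl ha, by rintro rfl; exact heH ha⟩
    rwa [this]
  · exfalso
    obtain ⟨g', hg'⟩ := hHc.1
    obtain ⟨C₁, hC₁, hC₁c, -⟩ := hHc.exists_circ_of_mem hHn hg'
    have hH4 := (hC₁c.four_le hp.genPos (fun e he => hlH e (hC₁ he))).trans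
      (Set.ncard_le_ncard (vertexSpan_mono hC₁) (Set.toFinite _))
    have hN := h3.three_le_attach (vertexSpan_mono hHF.subset) (by omega) hV
    set N := {v ∈ vertexSpan H | ∃ y, y ∉ vertexSpan H ∧ s(y, v) ∈ F} with hNdef
    set Y := vertexSpan F \ vertexSpan H with hY
    have hDmem : ∀ y v, y ∉ vertexSpan H → s(y, v) ∈ F → s(y, v) ∈ C \ H := by
      intro y v hy hyv
      have : s(y, v) ∉ H := fun h => hy (left_mem_vertexSpan h)
      rw [← hHC] at hyv
      exact ⟨hyv.resolve_left this, this⟩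
    have hsum := sum_ncard_nbr (B := C \ H) fun e he => hl e (hCF he.1)
    have h1 : Y.toFinset.card • 4 ≤ ∑ w ∈ Y.toFinset, (nbr (C \ H) w).ncard := by
      refine Finset.card_nsmul_le_sum _ _ 4 fun y hy => ?_
      rw [Set.mem_toFinset] at hy
      exact (hdeg y hy.1).trans (Set.ncard_le_ncard (fun v hv => hDmem y v hy.2 hv) (Set.toFinite _))
    have h2 : N.toFinset.card • 1 ≤ ∑ w ∈ N.toFinset, (nbr (C \ H) w).ncard := by
      refine Finset.card_nsmul_le_sum _ _ 1 fun v hv => ?_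
      rw [Set.mem_toFinset] at hv
      obtain ⟨-, y, hy, hyv⟩ := hv
      refine (Set.ncard_pos (Set.toFinite _)).mpr ⟨y, ?_⟩
      show s(v, y) ∈ C \ H
      rw [Sym2.eq_swap]
      exact hDmem y v hy hyv
    have hdisj : Disjoint Y.toFinset N.toFinset := by
      rw [Set.disjoint_toFinset, Set.disjoint_left]
      exact fun y hy hyN => hy.2 hyN.1
    have h4 : ∑ w ∈ Y.toFinset, (nbr (C \ H) w).ncard + ∑ w ∈ N.toFinset, (nbr (C \ H) w).ncard ≤
        2 * (C \ H).ncard := by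
      rw [← Finset.sum_union hdisj, ← hsum]
      exact Finset.sum_le_univ_sum_of_nonneg (fun _ => Nat.zero_le _)
    rw [smul_eq_mul, ← Set.ncard_eq_toFinset_card'] at h1 h2
    have h5 : (vertexSpan ((C \ H) \ {e}) \ vertexSpan H).ncard ≤ Y.ncard :=
      Set.ncard_le_ncard (Set.sdiff_subset_sdiff_left hDF) (Set.toFinite _)
    omega

end Reductions

section VertexRemoval

variable [Fintype V] [DecidableEq V]

theorem Lk.delV {p : Pl V} (hp : GenPos p) {F : Set (Sym2 V)} (hl : Loopless F) {w a b : V}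
    (h2 : (nbr F w).ncard ≤ 2) (ha : a ≠ w) (hb : b ≠ w) (h : Lk p F a b) :
    Lk p (delV F w) a b := by
  by_cases hF : s(a, b) ∈ Rigidity.delV F w
  · exact Lk.of_mem hF
  have hF' : s(a, b) ∉ F := fun h => hF ⟨h, by simp [ha.symm, hb.symm]⟩
  obtain ⟨ω, hω, h1⟩ := exists_stress_of_lk h hF'
  have hs := hp.star_le_two (hω.1 w) h2 (fun v _ hv => hω.2 _ (by
    rintro (h | h)
    · simp only [Sym2.eq_iff] at h
      grind
    · exact hv h))
  refine lk_of_stress hω.1 (fun e he heF => ?_) (by rw [h1]; exact one_ne_zero)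
  by_cases hw : w ∈ e
  · obtain ⟨v, rfl⟩ := hw
    by_cases hv : v = w
    · subst hv
      refine hω.2 _ ?_
      rintro (h | h)
      · exact he h
      · exact hl _ h (by simp)
    · exact hs v hv
  · exact hω.2 _ (by
      rintro (h | h)
      · exact he h
      · exact heF ⟨h, hw⟩)

theorem RCon.lk_sdiff {p : Pl V} {F : Set (Sym2 V)} (h : RCon p F) (hF : F.Nontrivial) {x y : V}
    (he : s(x, y) ∈ F) : Lk p (F \ {s(x, y)}) x y := by
  obtain ⟨C, hCF, hC, heC⟩ := h.exists_circ_of_mem hF he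
  obtain ⟨ω, hω, -, hs⟩ := hC.1
  refine lk_of_stress hω.1 (fun e he heF => ?_) (show s(x, y) ∈ Function.support ω from hs ▸ heC)
  by_contra h0
  exact heF ⟨hCF (hs ▸ show e ∈ Function.support ω from h0), he⟩

theorem RCon.rigidOn_sdiff {p : Pl V} (hp : Generic p) {F : Set (Sym2 V)} (h : RCon p F)
    (hl : Loopless F) (hF : F.Nontrivial) {e : Sym2 V} (he : e ∈ F) :
    RigidOn p (F \ {e}) (vertexSpan F) := by
  refine RigidOn.trans (fun u v huv => ?_) (h.rigidOn hp hl hF)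
  by_cases h1 : s(u, v) = e
  · subst h1
    exact h.lk_sdiff hF huv
  · exact Lk.of_mem ⟨huv, h1⟩

theorem RCon.rigidOn_delV {p : Pl V} (hp : Generic p) {F : Set (Sym2 V)} (h : RCon p F)
    (hl : Loopless F) (hF : F.Nontrivial) {w : V} (hw : w ∈ vertexSpan F)
    (h3 : (nbr F w).ncard ≤ 3) : RigidOn p (delV F w) (vertexSpan F \ {w}) := by
  obtain ⟨x, hx⟩ := mem_vertexSpan.mp hw
  have hr := h.rigidOn_sdiff hp hl hF hx
  have hd : delV (F \ {s(w, x)}) w = delV F w := by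
    ext e
    constructor
    · exact fun he => ⟨he.1.1, he.2⟩
    · refine fun he => ⟨⟨he.1, ?_⟩, he.2⟩
      rintro rfl
      exact he.2 (by simp)
  have hn : (nbr (F \ {s(w, x)}) w).ncard ≤ 2 := by
    have h4 : nbr (F \ {s(w, x)}) w ⊆ nbr F w \ {x} := by
      rintro v ⟨hv, hv'⟩
      refine ⟨hv, ?_⟩
      rintro rfl
      exact hv' rfl
    have h5 := Set.ncard_sdiff_singleton_add_one (show x ∈ nbr F w from hx) (Set.toFinite _)
    have h6 := Set.ncard_le_ncard h4 (Set.toFinite _)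
    omega
  refine rigidOn_of_lk hp.genPos fun a ha b hb => ?_
  rw [← hd]
  exact Lk.delV hp.genPos (fun e he => hl e he.1) hn ha.2 hb.2 (hr.lk ha.1 hb.1)

theorem RCon.vertexSpan_delV {p : Pl V} (hp : GenPos p) {F : Set (Sym2 V)} (h : RCon p F)
    (hl : Loopless F) (hF : F.Nontrivial) (w : V) :
    vertexSpan (delV F w) = vertexSpan F \ {w} := by
  refine Set.Subset.antisymm (fun u hu => ⟨vertexSpan_mono (delV_subset F w) hu, ?_⟩) fun u hu => ?_
  · rintro rfl
    obtain ⟨v, hv⟩ := mem_vertexSpan.mp hu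
    exact notMem_delV _ _ _ hv
  · have h3 := h.three_le hp hl hF hu.1
    have : ¬ nbr F u ⊆ {w} := fun h' => by
      have := Set.ncard_le_ncard h' (Set.toFinite _)
      rw [Set.ncard_singleton] at this
      omega
    obtain ⟨v, hv, hvw⟩ := Set.not_subset.mp this
    refine mem_vertexSpan.mpr ⟨v, hv, ?_⟩
    have h1 : u ≠ w := hu.2
    have h2 : v ≠ w := hvw
    simp [h1.symm, h2.symm]

theorem rigidOn_elemClass {p : Pl V} (hp : Generic p) {E : Set (Sym2 V)} (hl : Loopless E)
    {e : Sym2 V} (he : e ∈ E) :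
    RigidOn p (elemClass (stressOn p E) e) (vertexSpan (elemClass (stressOn p E) e)) := by
  have hsub := elemClass_stressOn_subset (p := p) he
  rcases (elemClass (stressOn p E) e).subsingleton_or_nontrivial with h | h
  · rw [h.eq_singleton_of_mem (Or.inl rfl : e ∈ _)]
    induction e with | _ x y
    rw [vertexSpan_singleton]
    exact rigidOn_pair hp.genPos x y
  · exact (rCon_elemClass he).rigidOn hp (fun f hf => hl f (hsub hf)) h

theorem elemClass_eq_of_lk {p : Pl V} (hp : GenPos p) {E : Set (Sym2 V)} {e f : Sym2 V} (he : e ∈ E)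
    (hf : f ∈ E) {x y : V} (hxy : x ≠ y) (h1 : Lk p (elemClass (stressOn p E) e) x y)
    (h2 : Lk p (elemClass (stressOn p E) f) x y) :
    elemClass (stressOn p E) e = elemClass (stressOn p E) f := by
  have hse := elemClass_stressOn_subset (p := p) he
  have hsf := elemClass_stressOn_subset (p := p) hf
  by_cases hE : s(x, y) ∈ E
  · obtain ⟨g, hg, hg'⟩ := exists_mem_elemClass_of_lk hp hse hxy h1 hE
    obtain ⟨k, hk, hk'⟩ := exists_mem_elemClass_of_lk hp hsf hxy h2 hE
    rw [← elemClass_eq_of_mem hg, ← elemClass_eq_of_mem hg', elemClass_eq_of_mem hk',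
      elemClass_eq_of_mem hk]
  by_contra hne
  have hdisj : ∀ g ∈ elemClass (stressOn p E) e, g ∉ elemClass (stressOn p E) f := fun g hg hg' =>
    hne ((elemClass_eq_of_mem hg).symm.trans (elemClass_eq_of_mem hg'))
  obtain ⟨ω₁, hω₁, h3⟩ := exists_stress_of_lk h1 fun h => hE (hse h)
  obtain ⟨ω₂, hω₂, h4⟩ := exists_stress_of_lk h2 fun h => hE (hsf h)
  have hω : ω₁ - ω₂ ∈ stressOn p E := by
    refine ⟨fun u i => by rw [force_sub, hω₁.1, hω₂.1, sub_zero], fun g hg => ?_⟩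
    by_cases hg' : g = s(x, y)
    · subst hg'
      rw [Pi.sub_apply, h3, h4, sub_self]
    · rw [Pi.sub_apply, hω₁.2 g (by rintro (h | h); exacts [hg' h, hg (hse h)]),
        hω₂.2 g (by rintro (h | h); exacts [hg' h, hg (hsf h)]), sub_self]
  have h5 := indicator_elemClass_mem e hω
  have h6 : ∀ g, g ≠ s(x, y) →
      (elemClass (stressOn p E) e).indicator (ω₁ - ω₂) g = ω₁ g := by
    intro g hg
    by_cases hgD : g ∈ elemClass (stressOn p E) e
    · rw [Set.indicator_of_mem hgD, Pi.sub_apply,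
        hω₂.2 g (by rintro (h | h); exacts [hg h, hdisj g hgD h]), sub_zero]
    · rw [Set.indicator_of_notMem hgD, hω₁.2 g (by rintro (h | h); exacts [hg h, hgD h])]
  refine not_lk_of_notMem hp (F := ∅) hxy (by simp [vertexSpan]) (lk_of_stress
    (ω := ω₁ - (elemClass (stressOn p E) e).indicator (ω₁ - ω₂))
    (fun u i => by rw [force_sub, hω₁.1, h5.1, sub_zero]) (fun g hg _ => ?_) ?_)
  · rw [Pi.sub_apply, h6 g hg, sub_self]
  · rw [Pi.sub_apply, Set.indicator_of_notMem (fun h => hE (hse h)), h3]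
    norm_num

theorem exists_mem_KK_of_mem {p : Pl V} (hp : GenPos p) {F : Set (Sym2 V)} (hF : RCon p F)
    {w : V} (hw : w ∈ vertexSpan F) {e : Sym2 V}
    (he : e ∈ delV F w ∪ KK (nbr F w)) :
    ∃ f ∈ KK (nbr F w), f ∈ elemClass (stressOn p (delV F w ∪ KK (nbr F w))) e := by
  set J := delV F w ∪ KK (nbr F w) with hJ
  set D := elemClass (stressOn p J) e with hDdef
  by_contra! hcon
  have hDJ : D ⊆ J := elemClass_stressOn_subset he
  have hD' : D ⊆ delV F w := fun f hf => (hDJ hf).resolve_right fun h => hcon f h hf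
  have hs : IsSeparator p F D := by
    intro ω hω
    obtain ⟨τ, hτ, h1⟩ := exists_stress_of_pinned (rigidOn_KK hp (nbr F w))
      (ω := (delV F w).indicator ω) (B := delV F w) (fun u hu i => by
        by_cases huw : u = w
        · subst huw
          unfold force
          refine Finset.sum_eq_zero fun v _ => ?_
          rw [Set.indicator_of_notMem (notMem_delV F u v), zero_mul]
        · rw [← hω.1 u i]
          unfold force
          refine Finset.sum_congr rfl fun v _ => ?_
          by_cases huv : s(u, v) ∈ delV F w
          · rw [Set.indicator_of_mem huv]
          · rw [Set.indicator_of_notMem huv, hω.2 s(u, v) ?_]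
            intro h
            by_cases hvw : v = w
            · subst hvw
              rw [Sym2.eq_swap] at h
              exact hu h
            · exact huv ⟨h, by simp [Ne.symm huw, Ne.symm hvw]⟩)
      (fun e he => Set.indicator_of_notMem he _)
    have h2 := indicator_elemClass_mem e hτ
    have h3 : D.indicator τ = D.indicator ω := by
      ext g
      by_cases hg : g ∈ D
      · rw [Set.indicator_of_mem hg, Set.indicator_of_mem hg, h1 g fun h => hcon g h hg,
          Set.indicator_of_mem (hD' hg)]
      · rw [Set.indicator_of_notMem hg, Set.indicator_of_notMem hg]
    rw [← h3]
    exact stressOn_mono (hD'.trans (delV_subset F w)) (indicator_stressOn_subset h2)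
  have h4 := hF.2 D (hD'.trans (delV_subset F w)) ⟨e, Or.inl rfl⟩ hs
  obtain ⟨x, hx⟩ := mem_vertexSpan.mp hw
  rw [← h4] at hx
  exact notMem_delV _ _ _ (hD' hx)

theorem loopless_delV_union_KK {F : Set (Sym2 V)} (hl : Loopless F) (w : V) (N : Set V) :
    Loopless (delV F w ∪ KK N) := by
  rintro e (he | he)
  exacts [hl e he.1, he.1]

theorem RCon.vertexSpan_delV_union_KK {p : Pl V} (hp : GenPos p) {F : Set (Sym2 V)} (h : RCon p F)
    (hl : Loopless F) (hF : F.Nontrivial) (w : V) :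
    vertexSpan (delV F w ∪ KK (nbr F w)) = vertexSpan F \ {w} := by
  rw [vertexSpan_union, h.vertexSpan_delV hp hl hF]
  refine Set.union_eq_left.mpr ?_
  rintro u ⟨e, he, hu⟩
  have h1 : s(w, u) ∈ F := he.2 u hu
  exact ⟨right_mem_vertexSpan h1, fun h => hl _ h1 (by rw [h]; simp)⟩

theorem RCon.rCon_delV_union_KK {p : Pl V} (hp : Generic p) {F : Set (Sym2 V)} (hF : RCon p F)
    (hl : Loopless F) (hn : F.Nontrivial) (h3 : ThreeConn F) (h5 : 5 ≤ (vertexSpan F).ncard)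
    {w : V} (hw : (nbr F w).ncard = 3) : RCon p (delV F w ∪ KK (nbr F w)) := by
  have hgp := hp.genPos
  obtain ⟨x₀, y₀, z₀, hxy₀, hxz₀, hyz₀, hN⟩ := Set.ncard_eq_three.mp hw
  have hwF : w ∈ vertexSpan F := left_mem_vertexSpan (show x₀ ∈ nbr F w by simp [hN])
  have hlJ := loopless_delV_union_KK hl w (nbr F w)
  have hVJ := hF.vertexSpan_delV_union_KK hgp hl hn w
  have hmeet := fun e he => exists_mem_KK_of_mem hgp hF hwF (e := e) he
  set J := delV F w ∪ KK (nbr F w) with hJ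
  have hKJ : KK (nbr F w) ⊆ J := Set.subset_union_right
  have hlk : ∀ e ∈ J, ∀ a ∈ vertexSpan (elemClass (stressOn p J) e),
      ∀ b ∈ vertexSpan (elemClass (stressOn p J) e), Lk p (elemClass (stressOn p J) e) a b :=
    fun e he a ha b hb => (rigidOn_elemClass hp hlJ he).lk ha hb
  have hin : ∀ e ∈ J, ∀ a ∈ vertexSpan (elemClass (stressOn p J) e),
      ∀ b ∈ vertexSpan (elemClass (stressOn p J) e), a ≠ b → s(a, b) ∈ J →
      s(a, b) ∈ elemClass (stressOn p J) e := by
    intro e he a ha b hb hab habJ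
    obtain ⟨f, hf, hf'⟩ := exists_mem_elemClass_of_lk hgp (elemClass_stressOn_subset he) hab
      (hlk e he a ha b hb) habJ
    rwa [elemClass_eq_of_mem hf] at hf'
  by_cases htwo : ∃ e ∈ J, ∃ f ∈ KK (nbr F w), ∃ g ∈ KK (nbr F w), f ≠ g ∧
      f ∈ elemClass (stressOn p J) e ∧ g ∈ elemClass (stressOn p J) e
  · obtain ⟨e, he, f, hf, g, hg, hfg, hfe, hge⟩ := htwo
    have hNV : nbr F w ⊆ vertexSpan (elemClass (stressOn p J) e) := by
      induction f with | _ a b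
      induction g with | _ c d
      rw [mem_KK, hN] at hf hg
      have h1 := left_mem_vertexSpan hfe
      have h2 := right_mem_vertexSpan hfe
      have h3 := left_mem_vertexSpan hge
      have h4 := right_mem_vertexSpan hge
      rw [hN]
      rintro u hu
      simp only [Set.mem_insert_iff, Set.mem_singleton_iff] at hf hg hu
      have : u = a ∨ u = b ∨ u = c ∨ u = d := by
        simp only [ne_eq, Sym2.eq_iff] at hfg
        grind
      rcases this with rfl | rfl | rfl | rfl <;> assumption
    have hKD : KK (nbr F w) ⊆ elemClass (stressOn p J) e := by
      intro k hk
      induction k with | _ a b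
      obtain ⟨hab, ha, hb⟩ := mem_KK.mp hk
      exact hin e he a (hNV ha) b (hNV hb) hab (hKJ hk)
    have hDJ : elemClass (stressOn p J) e = J := by
      refine (elemClass_stressOn_subset he).antisymm fun k hk => ?_
      obtain ⟨l, hlK, hlk⟩ := hmeet k hk
      rw [← elemClass_eq_of_mem (hKD hlK), elemClass_eq_of_mem hlk]
      exact Or.inl rfl
    have := rCon_elemClass (p := p) he
    rwa [hDJ] at this
  exfalso
  have hone : ∀ e ∈ J, ∀ f ∈ KK (nbr F w), ∀ g ∈ KK (nbr F w),
      f ∈ elemClass (stressOn p J) e → g ∈ elemClass (stressOn p J) e → f = g := by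
    intro e he f hf g hg h1 h2
    by_contra h
    exact htwo ⟨e, he, f, hf, g, hg, h, h1, h2⟩
  have hex : ∃ u ∈ vertexSpan F, u ≠ w ∧ u ∉ nbr F w := by
    by_contra! hcon
    have h1 : vertexSpan F ⊆ insert w (nbr F w) := fun u hu => by
      by_cases h : u = w
      exacts [Or.inl h, Or.inr (hcon u hu h)]
    have h2 := Set.ncard_le_ncard h1 (Set.toFinite _)
    have h4 := Set.ncard_insert_le w (nbr F w)
    omega
  obtain ⟨u, huF, huw, huN⟩ := hex
  have huJ : u ∈ vertexSpan J := hVJ ▸ ⟨huF, huw⟩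
  obtain ⟨e, he, hue⟩ := huJ
  obtain ⟨g, hg, hge⟩ := hmeet e he
  induction g with | _ x y
  obtain ⟨hxy, hx, hy⟩ := mem_KK.mp hg
  set D := elemClass (stressOn p J) e with hD
  have hDJ : D ⊆ J := elemClass_stressOn_subset he
  have hxD : x ∈ vertexSpan D := left_mem_vertexSpan hge
  have hyD : y ∈ vertexSpan D := right_mem_vertexSpan hge
  have hVD : vertexSpan D ⊆ vertexSpan F \ {w} := hVJ ▸ vertexSpan_mono hDJ
  have hND : ∀ a ∈ nbr F w, a ∈ vertexSpan D → a = x ∨ a = y := by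
    intro a ha haD
    by_contra! hcon
    have h1 : s(a, x) ∈ KK (nbr F w) := mem_KK.mpr ⟨hcon.1, ha, hx⟩
    have h2 := hone e he _ h1 _ hg (hin e he a haD x hxD hcon.1 (hKJ h1)) hge
    simp only [Sym2.eq_iff] at h2
    grind
  refine h3.2 x y (vertexSpan D \ {x, y}) (vertexSpan F \ vertexSpan D)
    { left := ⟨u, ⟨e, Or.inl rfl, hue⟩, ?_⟩
      right := ⟨w, hwF, fun h => (hVD h).2 rfl⟩
      disj := fun a ha ha' => ha'.2 ha.1
      x_left := fun h => h.2 (by simp)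
      y_left := fun h => h.2 (by simp)
      x_right := fun h => h.2 hxD
      y_right := fun h => h.2 hyD
      cover := fun a ha => ?_
      sub_left := fun a ha => (hVD ha.1).1
      sub_right := fun a ha => ha.1
      no_edge := fun a ha b hb hab => ?_ }
  · rintro (rfl | rfl)
    exacts [huN hx, huN hy]
  · by_cases h1 : a ∈ vertexSpan D
    · by_cases h2 : a = x
      · exact Or.inl h2
      by_cases h4 : a = y
      · exact Or.inr (Or.inl h4)
      exact Or.inr (Or.inr (Or.inl ⟨h1, by simp [h2, h4]⟩))
    · exact Or.inr (Or.inr (Or.inr ⟨ha, h1⟩))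
  · by_cases hbw : b = w
    · subst hbw
      have haN : a ∈ nbr F b := by
        show s(b, a) ∈ F
        rwa [Sym2.eq_swap]
      have := hND a haN ha.1
      exact ha.2 (by simpa using this)
    have haw : a ≠ w := (hVD ha.1).2
    have habJ : s(a, b) ∈ J := Or.inl ⟨hab, by simp [haw.symm, Ne.symm hbw]⟩
    obtain ⟨k, hk, hkD⟩ := hmeet _ habJ
    have haD' : a ∈ vertexSpan (elemClass (stressOn p J) s(a, b)) :=
      left_mem_vertexSpan (v := b) (Or.inl rfl)
    have hbD' : b ∈ vertexSpan (elemClass (stressOn p J) s(a, b)) :=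
      right_mem_vertexSpan (u := a) (Or.inl rfl)
    have hc : ∃ c, (c = x ∨ c = y) ∧ c ∈ vertexSpan (elemClass (stressOn p J) s(a, b)) := by
      induction k with | _ k₁ k₂
      have h1 := left_mem_vertexSpan hkD
      have h2 := right_mem_vertexSpan hkD
      obtain ⟨hk0, hk1, hk2⟩ := mem_KK.mp hk
      rw [hN] at hk1 hk2 hx hy
      simp only [Set.mem_insert_iff, Set.mem_singleton_iff] at hk1 hk2 hx hy
      by_cases h4 : k₁ = x ∨ k₁ = y
      · exact ⟨k₁, h4, h1⟩
      · exact ⟨k₂, by grind, h2⟩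
    obtain ⟨c, hc, hcD'⟩ := hc
    have hcD : c ∈ vertexSpan D := by rcases hc with rfl | rfl <;> assumption
    have hac : a ≠ c := by
      rintro rfl
      exact ha.2 (by simpa using hc)
    have := elemClass_eq_of_lk hgp he habJ hac (hlk e he a ha.1 c hcD) (hlk _ habJ a haD' c hcD')
    rw [← this] at hbD'
    exact hb.2 hbD'

theorem RCon.threeConn_delV_union_KK {p : Pl V} (hp : GenPos p) {F : Set (Sym2 V)} (hF : RCon p F)
    (hl : Loopless F) (hn : F.Nontrivial) (h3 : ThreeConn F) (h5 : 5 ≤ (vertexSpan F).ncard)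
    {w : V} (hwF : w ∈ vertexSpan F) (hJ : RCon p (delV F w ∪ KK (nbr F w))) :
    ThreeConn (delV F w ∪ KK (nbr F w)) := by
  have hVJ := hF.vertexSpan_delV_union_KK hp hl hn w
  refine ⟨?_, fun a b U W h => ?_⟩
  · rw [hVJ]
    have := Set.ncard_sdiff_singleton_add_one hwF (Set.toFinite _)
    omega
  wlog hNW : ∀ u ∈ W, u ∉ nbr F w generalizing U W with H
  · refine H W U h.symm fun u hu huN => hNW fun u' hu' huN' => ?_
    refine h.no_edge u hu u' hu' (Or.inr (mem_KK.mpr ⟨?_, huN, huN'⟩))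
    rintro rfl
    exact h.disj _ hu hu'
  have hab := hJ.sep_mem hp h
  have hne : ∀ u ∈ vertexSpan (delV F w ∪ KK (nbr F w)), u ≠ w := fun u hu => by
    rw [hVJ] at hu
    exact hu.2
  have haw : a ≠ w := hne a (vertexSpan_mono (touch_subset _ _) hab.1)
  have hbw : b ≠ w := hne b (vertexSpan_mono (touch_subset _ _) hab.2)
  have hwW : w ∉ W := fun h' => hne w (h.sub_right h') rfl
  have hsub : vertexSpan (delV F w ∪ KK (nbr F w)) ⊆ vertexSpan F := hVJ ▸ Set.sdiff_subset
  refine h3.2 a b (insert w U) W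
    { left := ⟨w, by simp⟩
      right := h.right
      disj := ?_
      x_left := ?_
      y_left := ?_
      x_right := h.x_right
      y_right := h.y_right
      cover := fun u hu => ?_
      sub_left := Set.insert_subset hwF (h.sub_left.trans hsub)
      sub_right := h.sub_right.trans hsub
      no_edge := ?_ }
  · rintro u (rfl | hu)
    exacts [hwW, h.disj u hu]
  · rintro (h' | h')
    exacts [haw h', h.x_left h']
  · rintro (h' | h')
    exacts [hbw h', h.y_left h']
  · by_cases huw : u = w
    · simp [huw]
    · rcases h.cover u (hVJ ▸ ⟨hu, huw⟩) with h1 | h1 | h1 | h1 <;> simp [h1]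
  · rintro u (rfl | hu) c hc huc
    · exact hNW c hc huc
    · refine h.no_edge u hu c hc (Or.inl ⟨huc, ?_⟩)
      have h1 := hne u (h.sub_left hu)
      have h2 := hne c (h.sub_right hc)
      simp [h1.symm, h2.symm]

end VertexRemoval

section Derivations

open TensorProduct in
/-- A derivation on a formally étale extension is determined by, and can be prescribed on, the
base. -/
theorem exists_derivation_of_formallyEtale (R S T : Type*) [CommRing R] [CommRing S] [CommRing T]
    [Algebra R S] [Algebra R T] [Algebra S T] [IsScalarTower R S T] [Algebra.FormallyEtale S T]
    (D : Derivation R S T) : ∃ δ : Derivation R T T, ∀ s, δ (algebraMap S T s) = D s := by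
  refine ⟨((D.liftKaehlerDifferential.liftBaseChange T).comp
    (KaehlerDifferential.tensorKaehlerEquivOfFormallyEtale R S T).symm.toLinearMap).compDer
    (KaehlerDifferential.D R T), fun s => ?_⟩
  simp [KaehlerDifferential.tensorKaehlerEquivOfFormallyEtale_symm_D_algebraMap]

theorem exists_derivation_of_isTranscendenceBasis {R L ι : Type*} [CommRing R] [IsDomain R] [Field L]
    [CharZero L] [Algebra R L] {x : ι → L} (hx : IsTranscendenceBasis R x) (a : ι → L) :
    ∃ δ : Derivation R L L, ∀ i, δ (x i) = a i := by
  let _ : Algebra (MvPolynomial ι R) L := (MvPolynomial.aeval x).toAlgebra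
  have : IsScalarTower R (MvPolynomial ι R) L := IsScalarTower.of_algebraMap_eq fun r => by
    simp [RingHom.algebraMap_toAlgebra]
  have : FaithfulSMul (MvPolynomial ι R) L :=
    (faithfulSMul_iff_algebraMap_injective _ _).mpr hx.1
  let _ := FractionRing.liftAlgebra (MvPolynomial ι R) L
  have : Algebra.IsAlgebraic (MvPolynomial ι R) L := by
    have := hx.isAlgebraic
    exact Algebra.IsAlgebraic.of_ringHom_of_comp_eq (S := Algebra.adjoin R (Set.range x)) (B := L)
      (hx.1.aevalEquiv : MvPolynomial ι R →+* Algebra.adjoin R (Set.range x)) (RingHom.id L)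
      hx.1.aevalEquiv.surjective Function.injective_id (RingHom.ext fun y => rfl)
  have : Algebra.IsAlgebraic (FractionRing (MvPolynomial ι R)) L :=
    IsFractionRing.comap_isAlgebraic_iff (A := MvPolynomial ι R).mp inferInstance
  have : CharZero (FractionRing (MvPolynomial ι R)) :=
    (algebraMap (FractionRing (MvPolynomial ι R)) L).charZero
  have : Algebra.FormallyEtale (FractionRing (MvPolynomial ι R)) L :=
    Algebra.FormallyEtale.of_isSeparable _ _
  have : Algebra.FormallyEtale (MvPolynomial ι R) (FractionRing (MvPolynomial ι R)) :=
    Algebra.FormallyEtale.of_isLocalization (nonZeroDivisors (MvPolynomial ι R))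
  have : Algebra.FormallyEtale (MvPolynomial ι R) L :=
    Algebra.FormallyEtale.comp _ (FractionRing (MvPolynomial ι R)) _
  obtain ⟨δ, hδ⟩ := exists_derivation_of_formallyEtale R (MvPolynomial ι R) L
    (MvPolynomial.mkDerivation R a)
  refine ⟨δ, fun i => ?_⟩
  have hX : algebraMap (MvPolynomial ι R) L (MvPolynomial.X i) = x i := MvPolynomial.aeval_X x i
  rw [← hX, hδ, MvPolynomial.mkDerivation_X]

theorem exists_derivation {R L ι : Type*} [CommRing R] [IsDomain R] [Field L] [CharZero L]
    [Algebra R L] {x : ι → L} (hx : AlgebraicIndependent R x) (a : ι → L) :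
    ∃ δ : Derivation R L L, ∀ i, δ (x i) = a i := by
  obtain ⟨t, ht, hb⟩ := exists_isTranscendenceBasis_superset hx.coe_range
  have := hx.injective
  obtain ⟨δ, hδ⟩ := exists_derivation_of_isTranscendenceBasis hb
    (fun y => open Classical in if h : ∃ i, x i = y then a h.choose else 0)
  refine ⟨δ, fun i => ?_⟩
  rw [hδ ⟨x i, ht ⟨i, rfl⟩⟩]
  have h : ∃ j, x j = x i := ⟨i, rfl⟩
  rw [dif_pos h, hx.injective h.choose_spec]

theorem exists_derivation_ne_zero {R L : Type*} [CommRing R] [IsDomain R] [Field L] [CharZero L]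
    [Algebra R L] {t : L} (ht : Transcendental R t) : ∃ δ : Derivation R L L, δ t ≠ 0 := by
  obtain ⟨δ, hδ⟩ := exists_derivation (algebraicIndependent_unique_type_iff (ι := Unit)
    (x := fun _ => t) |>.mpr ht) fun _ => 1
  exact ⟨δ, by rw [hδ ()]; exact one_ne_zero⟩

end Derivations

section LengthEquivalence

/-- The velocity of a placement induced by a derivation of the coordinate field. -/
def der (δ : Derivation ℚ ℝ ℝ) (p : Pl V) : Pl V := fun u i => δ (p u i)

theorem derivation_sqd (δ : Derivation ℚ ℝ ℝ) (p : Pl V) (u v : V) :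
    δ (sqd p u v) = 2 * bil p (der δ p) u v := by
  simp only [sqd, bil, der, map_add, map_sub, Derivation.leibniz_pow, smul_eq_mul, nsmul_eq_mul]
  push_cast
  ring

theorem Generic.exists_derivation {p : Pl V} (hp : Generic p) (m : Pl V) :
    ∃ δ : Derivation ℚ ℝ ℝ, der δ p = m := by
  obtain ⟨δ, hδ⟩ := Rigidity.exists_derivation hp fun ui => m ui.1 ui.2
  exact ⟨δ, funext fun u => funext fun i => hδ (u, i)⟩

/-- The edges in `F` have the same lengths in `p` and `q`. -/
def LenEq (F : Set (Sym2 V)) (p q : Pl V) : Prop := ∀ u v, s(u, v) ∈ F → sqd q u v = sqd p u v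

theorem LenEq.mono {F F' : Set (Sym2 V)} {p q : Pl V} (h : LenEq F p q) (hF : F' ⊆ F) :
    LenEq F' p q := fun u v huv => h u v (hF huv)

theorem LenEq.bil_der {F : Set (Sym2 V)} {p q : Pl V} (h : LenEq F p q) (δ : Derivation ℚ ℝ ℝ)
    {u v : V} (huv : s(u, v) ∈ F) : bil q (der δ q) u v = bil p (der δ p) u v := by
  have := derivation_sqd δ q u v
  rw [h u v huv, derivation_sqd] at this
  linarith

variable [Fintype V] [DecidableEq V]

theorem exists_pinIndep_basis (p : Pl V) (X : Set V) (F : Set (Sym2 V)) :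
    ∃ B ⊆ F, PinIndep p X B ∧ ∀ u v, s(u, v) ∈ F → PLk p X B u v := by
  obtain ⟨B, hB⟩ := (Set.toFinite {B | B ⊆ F ∧ PinIndep p X B}).exists_maximal
    ⟨∅, Set.empty_subset _, fun ω _ hω => funext fun e => hω e (Set.notMem_empty e)⟩
  refine ⟨B, hB.prop.1, hB.prop.2, fun u v huv => ?_⟩
  by_contra hn
  have := hB.le_of_ge (y := insert s(u, v) B)
    ⟨Set.insert_subset huv hB.prop.1, hB.prop.2.insert_of_not_PLk hn⟩ (Set.subset_insert _ _)
  exact hn (PLk.of_mem (this (Set.mem_insert _ _)))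

theorem Indep.not_lk {p : Pl V} {B : Set (Sym2 V)} {x y : V} (hB : Indep p (insert s(x, y) B))
    (h : s(x, y) ∉ B) : ¬ Lk p B x y := by
  intro hl
  obtain ⟨ω, hω, h1⟩ := exists_stress_of_lk hl h
  rw [indep_iff.mp hB ω hω] at h1
  exact zero_ne_one h1

theorem Indep.of_lenEq {p q : Pl V} (hp : Generic p) {B : Set (Sym2 V)} (hB : Indep p B)
    (h : LenEq B p q) : Indep q B := by
  rw [indep_iff] at hB ⊢
  intro ω hω
  refine hB ω ⟨force_eq_zero_of_sum fun m => ?_, hω.2⟩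
  obtain ⟨δ, rfl⟩ := hp.exists_derivation m
  rw [← sum_rowF_of_stress hω.1 (der δ q)]
  refine Finset.sum_congr rfl fun e _ => ?_
  by_cases he : e ∈ B
  · induction e using Sym2.ind with
    | _ u v => exact congrArg _ (h.bil_der δ he).symm
  · rw [hω.2 e he, zero_mul, zero_mul]

theorem Lk.of_lenEq {p q : Pl V} (hp : Generic p) {F : Set (Sym2 V)} {x y : V} (hl : Lk p F x y)
    (h : LenEq F p q) : Lk q F x y := by
  obtain ⟨B, hBF, hB, hBs⟩ := exists_pinIndep_basis p ∅ F
  have hlB : Lk p B x y := Lk.trans (fun u v huv => lk_of_PLk (hBs u v huv)) hl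
  refine Lk.mono hBF ?_
  by_cases hxy : s(x, y) ∈ B
  · exact .of_mem hxy
  by_contra hn
  have h1 : Indep q (insert s(x, y) B) :=
    (Indep.of_lenEq hp hB (h.mono hBF)).insert_of_not_PLk fun hl => hn (lk_of_PLk hl)
  exact Indep.not_lk (PinIndep.generic hp h1) hxy hlB

end LengthEquivalence

section TwoSums

open Polynomial in
/-- If scaling by `c` preserves the algebraic relations of `d ≠ 0` over `T`, then `c` is a root of
unity. -/
theorem exists_pow_eq_one {T K : Type*} [CommRing T] [IsDomain T] [Field K] [Algebra T K]
    [FaithfulSMul T K] {c : T} {d : K} (hd : d ≠ 0) (hT : IsAlgebraic T d)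
    (h : ∀ Φ : T[X], aeval d Φ = 0 → aeval (algebraMap T K c * d) Φ = 0) :
    ∃ k ≠ 0, c ^ k = 1 := by
  classical
  have hex : ∃ n, ∃ Φ : T[X], Φ ≠ 0 ∧ aeval d Φ = 0 ∧ Φ.natDegree = n :=
    let ⟨Φ, h0, h1⟩ := hT; ⟨_, Φ, h0, h1, rfl⟩
  obtain ⟨Φ, h0, h1, hk⟩ := Nat.find_spec hex
  have hmin : ∀ Ψ : T[X], aeval d Ψ = 0 → Ψ.natDegree < Φ.natDegree → Ψ = 0 := fun Ψ hΨ hlt => by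
    by_contra hne
    exact Nat.find_min hex (hk ▸ hlt) ⟨Ψ, hne, hΨ, rfl⟩
  clear hk hex
  have hk0 : Φ.natDegree ≠ 0 := fun hk => by
    rw [eq_C_of_natDegree_eq_zero hk, aeval_C,
      map_eq_zero_iff _ (FaithfulSMul.algebraMap_injective T K)] at h1
    exact h0 (by rw [eq_C_of_natDegree_eq_zero hk, h1, C_0])
  refine ⟨Φ.natDegree, hk0, ?_⟩
  have hc0 : Φ.coeff 0 ≠ 0 := fun hc => by
    obtain ⟨Ψ, rfl⟩ := X_dvd_iff.mpr hc
    have hΨ : Ψ ≠ 0 := right_ne_zero_of_mul h0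
    refine hΨ (hmin Ψ ?_ ?_)
    · rw [map_mul, aeval_X] at h1
      exact (mul_eq_zero.mp h1).resolve_left hd
    · rw [natDegree_X_mul hΨ]
      exact Nat.lt_succ_self _
  have hz : Φ.comp (C c * X) - C (c ^ Φ.natDegree) * Φ = 0 := by
    refine hmin _ ?_ ?_
    · rw [map_sub, map_mul, h1, mul_zero, sub_zero, aeval_comp, map_mul, aeval_C, aeval_X]
      exact h Φ h1
    · rw [← Nat.le_sub_one_iff_lt (Nat.pos_of_ne_zero hk0), natDegree_le_iff_coeff_eq_zero]
      intro N hN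
      rw [coeff_sub, comp_C_mul_X_coeff, coeff_C_mul]
      rcases (show Φ.natDegree ≤ N by lia).eq_or_lt with rfl | hlt
      · ring
      · rw [coeff_eq_zero_of_natDegree_lt hlt]
        ring
  have := congrArg (coeff · 0) hz
  simp only [coeff_sub, comp_C_mul_X_coeff, coeff_C_mul, coeff_zero] at this
  have h2 : Φ.coeff 0 * (1 - c ^ Φ.natDegree) = 0 := by linear_combination this
  exact (sub_eq_zero.mp ((mul_eq_zero.mp h2).resolve_left hc0)).symm

/-- The similarity velocity field with prescribed values at two distinct points. -/
theorem exists_similarity_of_pair {p : Pl V} {x y : V} (hxy : sqd p x y ≠ 0) (m : Pl V) :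
    ∃ a b l θ : ℝ, ∀ u, u = x ∨ u = y →
      m u 0 = a + l * p u 0 - θ * p u 1 ∧ m u 1 = b + l * p u 1 + θ * p u 0 := by
  set l := bil p m x y / sqd p x y
  obtain ⟨a, b, θ, h⟩ := exists_trivial_of_pair hxy (m := m - l • p) (by
    have : l * sqd p x y = bil p m x y := div_mul_cancel₀ _ hxy
    simp only [bil, sqd, Pi.sub_apply, Pi.smul_apply, smul_eq_mul] at this ⊢
    linear_combination -this)
  refine ⟨a, b, l, θ, fun u hu => ?_⟩
  obtain ⟨h0, h1⟩ := h u hu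
  simp only [Pi.sub_apply, Pi.smul_apply, smul_eq_mul] at h0 h1
  constructor <;> linarith

theorem bil_eq_of_eq {p m m' : Pl V} {u v : V} (hu : m u = m' u) (hv : m v = m' v) :
    bil p m u v = bil p m' u v := by
  simp only [bil, hu, hv]

theorem bil_sub (p m m' : Pl V) (u v : V) : bil p (m - m') u v = bil p m u v - bil p m' u v := by
  simp only [bil, Pi.sub_apply]
  ring

theorem bil_smul (p : Pl V) (l : ℝ) (m : Pl V) (u v : V) : bil p (l • m) u v = l * bil p m u v := by
  simp only [bil, Pi.smul_apply, smul_eq_mul]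
  ring

theorem bil_same (p : Pl V) (u v : V) : bil p p u v = sqd p u v := by
  simp only [bil, sqd]
  ring

variable [Fintype V] [DecidableEq V]

theorem LenEq.derivation_mul {p q : Pl V} (hp : Generic p) {A B : Set (Sym2 V)} {s t : V}
    (hst : s ≠ t) (hAB : ∀ u ∈ vertexSpan A, u ∈ vertexSpan B → u = s ∨ u = t) (hA : Lk p A s t)
    (hB : Lk p B s t) (hq : LenEq (A ∪ B) p q) (δ : Derivation ℚ ℝ ℝ) :
    sqd p s t * δ (sqd q s t) = sqd q s t * δ (sqd p s t) := by
  classical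
  have hqA : LenEq A p q := hq.mono Set.subset_union_left
  have hqB : LenEq B p q := hq.mono Set.subset_union_right
  obtain ⟨a, b, l, θ, h⟩ := exists_similarity_of_pair (hp.genPos.sqd_pos hst).ne' (der δ p)
  obtain ⟨δ', hδ'⟩ := hp.exists_derivation fun u i =>
    if u ∈ vertexSpan B then ![a + l * p u 0 - θ * p u 1, b + l * p u 1 + θ * p u 0] i
    else der δ p u i
  have hs : ∀ u, u = s ∨ u = t → der δ' p u = der δ p u := fun u hu => by
    rw [hδ']
    funext i
    dsimp only
    split_ifs
    · fin_cases i
      · exact (h u hu).1.symm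
      · exact (h u hu).2.symm
    · rfl
  have hδA : ∀ u ∈ vertexSpan A, der δ' p u = der δ p u := fun u hu => by
    by_cases hu' : u ∈ vertexSpan B
    · exact hs u (hAB u hu hu')
    · rw [hδ']
      funext i
      exact if_neg hu'
  have hδB : ∀ u v, s(u, v) ∈ B → bil p (der δ' p) u v = l * sqd p u v := fun u v huv => by
    have hu : u ∈ vertexSpan B := ⟨_, huv, by simp⟩
    have hv : v ∈ vertexSpan B := ⟨_, huv, by simp⟩
    rw [hδ']
    simp only [bil, sqd, if_pos hu, if_pos hv, Matrix.cons_val_zero, Matrix.cons_val_one]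
    ring
  have h1 : bil q (der δ' q) s t = l * sqd q s t := by
    have := hB.of_lenEq hp hqB (der δ' q - l • q) fun u v huv => by
      rw [bil_sub, bil_smul, bil_same, hqB.bil_der δ' huv, hδB u v huv, hqB u v huv, sub_self]
    rw [bil_sub, bil_smul, bil_same] at this
    linarith
  have h2 : bil q (der δ q) s t = bil q (der δ' q) s t := by
    have := hA.of_lenEq hp hqA (der δ q - der δ' q) fun u v huv => by
      rw [bil_sub, hqA.bil_der δ huv, hqA.bil_der δ' huv,
        bil_eq_of_eq (hδA u ⟨_, huv, by simp⟩) (hδA v ⟨_, huv, by simp⟩), sub_self]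
    rw [bil_sub] at this
    linarith
  have h3 : bil p (der δ p) s t = l * sqd p s t := by
    obtain ⟨h0, h1⟩ := h s (.inl rfl)
    obtain ⟨h2, h3⟩ := h t (.inr rfl)
    simp only [bil, sqd, h0, h1, h2, h3]
    ring
  rw [derivation_sqd, derivation_sqd, h2, h1, h3]
  ring

/-- Two linking edge sets that share only `s` and `t` determine the distance of `s` and `t`. -/
theorem LenEq.sqd_eq_of_two_lk {p q : Pl V} (hp : Generic p) {A B : Set (Sym2 V)} {s t : V}
    (hst : s ≠ t) (hAB : ∀ u ∈ vertexSpan A, u ∈ vertexSpan B → u = s ∨ u = t) (hA : Lk p A s t)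
    (hB : Lk p B s t) (hq : LenEq (A ∪ B) p q) : sqd q s t = sqd p s t := by
  have hd : sqd p s t ≠ 0 := (hp.genPos.sqd_pos hst).ne'
  have hc : IsAlgebraic ℚ (sqd q s t / sqd p s t) := by
    by_contra ht
    obtain ⟨δ, hδ⟩ := exists_derivation_ne_zero ht
    refine hδ ?_
    have h1 := δ.leibniz (sqd q s t / sqd p s t) (sqd p s t)
    rw [div_mul_cancel₀ _ hd, smul_eq_mul, smul_eq_mul] at h1
    have h2 := LenEq.derivation_mul hp hst hAB hA hB hq δ
    rw [h1] at h2
    have h3 : sqd p s t * (sqd q s t / sqd p s t) = sqd q s t := mul_div_cancel₀ _ hd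
    have : sqd p s t * sqd p s t * δ (sqd q s t / sqd p s t) = 0 := by
      linear_combination h2 - δ (sqd p s t) * h3
    simpa [hd] using this
  let L := algebraicClosure ℚ ℝ
  have hpL : AlgebraicIndependent L fun ui : V × Fin 2 => p ui.1 ui.2 := hp.algebraicClosure
  let ep : MvPolynomial (V × Fin 2) L →ₐ[L] ℝ := MvPolynomial.aeval fun ui => p ui.1 ui.2
  let eq : MvPolynomial (V × Fin 2) L →ₐ[L] ℝ := MvPolynomial.aeval fun ui => q ui.1 ui.2
  let S : V → V → MvPolynomial (V × Fin 2) L := fun u v =>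
    (MvPolynomial.X (u, 0) - MvPolynomial.X (v, 0)) ^ 2 +
      (MvPolynomial.X (u, 1) - MvPolynomial.X (v, 1)) ^ 2
  have hSp : ∀ u v, ep (S u v) = sqd p u v := fun u v => by simp [ep, S, sqd]
  have hSq : ∀ u v, eq (S u v) = sqd q u v := fun u v => by simp [eq, S, sqd]
  let T : Subalgebra L (MvPolynomial (V × Fin 2) L) := AlgHom.equalizer ep eq
  let _ : Algebra T ℝ := (ep.comp T.val).toRingHom.toAlgebra
  have hT : ∀ r : T, algebraMap T ℝ r = ep r := fun r => rfl
  have : FaithfulSMul T ℝ := (faithfulSMul_iff_algebraMap_injective _ _).mpr fun r r' h =>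
    Subtype.ext (hpL h)
  have hTA : ∀ u v, s(u, v) ∈ A → S u v ∈ T := fun u v huv => by
    change ep _ = eq _
    rw [hSp, hSq, hq u v (.inl huv)]
  have halg : IsAlgebraic T (sqd p s t) := by
    by_contra ht
    obtain ⟨δ, hδ⟩ := exists_derivation_ne_zero ht
    let δ' : Derivation ℚ ℝ ℝ := Derivation.mk' (δ : ℝ →+ ℝ).toRatLinearMap fun a b => δ.leibniz a b
    have hδ' : ∀ x, δ' x = δ x := fun x => rfl
    have := hA (der δ' p) fun u v huv => by
      have h1 := derivation_sqd δ' p u v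
      have h2 : δ (sqd p u v) = 0 := by
        rw [← hSp u v]
        exact δ.map_algebraMap ⟨S u v, hTA u v huv⟩
      rw [hδ', h2] at h1
      linarith
    refine hδ ?_
    rw [← hδ', derivation_sqd, this, mul_zero]
  let c : L := ⟨sqd q s t / sqd p s t, (mem_algebraicClosure_iff).mpr hc⟩
  have hcT : algebraMap T ℝ (algebraMap L T c) = sqd q s t / sqd p s t := by
    rw [hT]
    exact ep.commutes c
  obtain ⟨k, hk, h1⟩ := exists_pow_eq_one (c := algebraMap L T c) hd halg fun Φ hΦ => by
    rw [hcT, div_mul_cancel₀ _ hd]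
    have h1 : ep ((Φ.map (algebraMap T (MvPolynomial (V × Fin 2) L))).eval (S s t)) = 0 := by
      rw [← hΦ, Polynomial.aeval_def, ← hSp, Polynomial.eval_map]
      exact Polynomial.hom_eval₂ Φ _ ep.toRingHom (S s t)
    have h2 := (map_eq_zero_iff ep hpL).mp h1
    have h3 := congrArg eq h2
    rw [map_zero, Polynomial.eval_map] at h3
    rw [← h3, Polynomial.aeval_def, ← hSq]
    refine ((Polynomial.hom_eval₂ Φ _ eq.toRingHom (S s t)).trans ?_).symm
    refine Polynomial.eval₂_congr (RingHom.ext fun r => ?_) rfl rfl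
    exact r.2.symm
  have h2 : (sqd q s t / sqd p s t) ^ k = 1 := by
    rw [← hcT, ← map_pow, h1, map_one]
  have h3 : 0 ≤ sqd q s t / sqd p s t := by
    refine div_nonneg ?_ ?_ <;> exact add_nonneg (sq_nonneg _) (sq_nonneg _)
  exact (div_eq_one_iff_eq hd).mp ((pow_eq_one_iff_of_nonneg h3 hk).mp h2)

end TwoSums

section DegreeThree

theorem derivation_two (δ : Derivation ℚ ℝ ℝ) : δ 2 = 0 := by
  simpa using δ.map_natCast 2

theorem derivation_four (δ : Derivation ℚ ℝ ℝ) : δ 4 = 0 := by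
  simpa using δ.map_natCast 4

/-- Differentiating the Gram relation of three plane vectors twice along the free vector. -/
theorem gram_relations {δ₀ δ₁ : Derivation ℚ ℝ ℝ} {g h k D y₀ y₁ z₀ z₁ s₀ s₁ U V : ℝ}
    (hg₀ : δ₀ g = 0) (hg₁ : δ₁ g = 0) (hh₀ : δ₀ h = 0) (hh₁ : δ₁ h = 0) (hk₀ : δ₀ k = 0)
    (hk₁ : δ₁ k = 0) (hD₀ : δ₀ D = 0) (hD₁ : δ₁ D = 0)
    (hy₀ : δ₀ y₀ = 0) (hy₀' : δ₁ y₀ = 0) (hy₁' : δ₁ y₁ = 0)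
    (hz₀ : δ₀ z₀ = 0) (hz₀' : δ₁ z₀ = 0) (hz₁' : δ₁ z₁ = 0)
    (hs₀ : δ₀ s₀ = 1) (hs₀' : δ₁ s₀ = 0) (hs₁ : δ₀ s₁ = 0) (hs₁' : δ₁ s₁ = 1)
    (hU₀ : δ₀ U = 2 * y₀) (hU₁ : δ₁ U = 2 * y₁) (hV₀ : δ₀ V = 2 * z₀) (hV₁ : δ₁ V = 2 * z₁)
    (H : 4 * (s₀ * s₀ + s₁ * s₁) * D = g * (V * V) - 2 * h * (U * V) + k * (U * U)) :
    D = g * (z₀ * z₀) - 2 * h * (y₀ * z₀) + k * (y₀ * y₀) ∧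
    D = g * (z₁ * z₁) - 2 * h * (y₁ * z₁) + k * (y₁ * y₁) ∧
    0 = g * (z₀ * z₁) - h * (y₀ * z₁ + y₁ * z₀) + k * (y₀ * y₁) := by
  have e₀ : 2 * s₀ * D = g * (V * z₀) - h * (U * z₀ + y₀ * V) + k * (U * y₀) := by
    have := congrArg δ₀ H
    simp only [map_add, map_sub, Derivation.leibniz, smul_eq_mul, derivation_two, derivation_four, hg₀, hh₀, hk₀,
      hD₀, hs₀, hs₁, hU₀, hV₀] at this
    linear_combination this / 4
  have e₁ : 2 * s₁ * D = g * (V * z₁) - h * (U * z₁ + y₁ * V) + k * (U * y₁) := by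
    have := congrArg δ₁ H
    simp only [map_add, map_sub, Derivation.leibniz, smul_eq_mul, derivation_two, derivation_four, hg₁, hh₁, hk₁,
      hD₁, hs₀', hs₁', hU₁, hV₁] at this
    linear_combination this / 4
  refine ⟨?_, ?_, ?_⟩
  · have := congrArg δ₀ e₀
    simp only [map_add, map_sub, Derivation.leibniz, smul_eq_mul, derivation_two, hg₀, hh₀, hk₀,
      hD₀, hs₀, hU₀, hV₀, hy₀, hz₀] at this
    linear_combination this / 2
  · have := congrArg δ₁ e₁
    simp only [map_add, map_sub, Derivation.leibniz, smul_eq_mul, derivation_two, hg₁, hh₁, hk₁,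
      hD₁, hs₁', hU₁, hV₁, hy₁', hz₁'] at this
    linear_combination this / 2
  · have := congrArg δ₁ e₀
    simp only [map_add, map_sub, Derivation.leibniz, smul_eq_mul, derivation_two, hg₁, hh₁, hk₁,
      hD₁, hs₀', hU₁, hV₁, hy₀', hz₀'] at this
    linear_combination this / 2

theorem sub_eq_zero_of_sqd {a b c d : ℝ} (h : (a - b) ^ 2 + (c - d) ^ 2 = 0) :
    b - a = 0 ∧ d - c = 0 := by
  constructor <;> nlinarith [sq_nonneg (a - b), sq_nonneg (c - d)]

theorem gram_dichotomy {g h k D y₀ y₁ z₀ z₁ : ℝ} (hn : y₀ * z₁ - y₁ * z₀ ≠ 0)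
    (hD : D = g * k - h * h)
    (E1 : D = g * (z₀ * z₀) - 2 * h * (y₀ * z₀) + k * (y₀ * y₀))
    (E2 : D = g * (z₁ * z₁) - 2 * h * (y₁ * z₁) + k * (y₁ * y₁))
    (E3 : 0 = g * (z₀ * z₁) - h * (y₀ * z₁ + y₁ * z₀) + k * (y₀ * y₁)) :
    g = 0 ∨ g = y₀ * y₀ + y₁ * y₁ ∧ k = z₀ * z₀ + z₁ * z₁ ∧ h = y₀ * z₀ + y₁ * z₁ := by
  obtain ⟨n, hndef⟩ : ∃ n, n = y₀ * z₁ - y₁ * z₀ := ⟨_, rfl⟩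
  rw [← hndef] at hn
  have rg : n ^ 2 * g = D * (y₀ * y₀ + y₁ * y₁) := by
    rw [hndef]
    linear_combination -y₁ ^ 2 * E1 - y₀ ^ 2 * E2 + 2 * y₀ * y₁ * E3
  have rk : n ^ 2 * k = D * (z₀ * z₀ + z₁ * z₁) := by
    rw [hndef]
    linear_combination -z₁ ^ 2 * E1 - z₀ ^ 2 * E2 + 2 * z₀ * z₁ * E3
  have rh : n ^ 2 * h = D * (y₀ * z₀ + y₁ * z₁) := by
    rw [hndef]
    linear_combination -y₁ * z₁ * E1 - y₀ * z₀ * E2 + (y₀ * z₁ + y₁ * z₀) * E3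
  have hDn : D = 0 ∨ D = n ^ 2 := by
    have : n ^ 2 * (D * (D - n ^ 2)) = 0 := by
      have e : n ^ 2 * n ^ 2 * D = n ^ 2 * g * (n ^ 2 * k) - (n ^ 2 * h) ^ 2 := by rw [hD]; ring
      rw [rg, rk, rh] at e
      rw [hndef] at e ⊢
      linear_combination -e
    rcases mul_eq_zero.mp ((mul_eq_zero.mp this).resolve_left (pow_ne_zero 2 hn)) with h | h
    · exact .inl h
    · exact .inr (sub_eq_zero.mp h)
  have hn2 : n ^ 2 ≠ 0 := pow_ne_zero 2 hn
  rcases hDn with h0 | h0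
  · rw [h0, zero_mul] at rg
    exact .inl ((mul_eq_zero.mp rg).resolve_left hn2)
  · rw [h0] at rg rk rh
    exact .inr ⟨mul_left_cancel₀ hn2 rg, mul_left_cancel₀ hn2 rk, mul_left_cancel₀ hn2 rh⟩

variable [Fintype V] [DecidableEq V]

/-- A vertex of degree three on a linked triple determines the lengths of that triple. -/
theorem LenEq.sqd_eq_of_star {p q : Pl V} (hp : Generic p) {B F : Set (Sym2 V)} {w x y z : V}
    (hwx : w ≠ x) (hwy : w ≠ y) (hwz : w ≠ z) (hxy : x ≠ y) (hxz : x ≠ z) (hyz : y ≠ z)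
    (hBF : B ⊆ F) (hw : w ∉ vertexSpan B) (hx : s(w, x) ∈ F) (hy : s(w, y) ∈ F)
    (hz : s(w, z) ∈ F) (h1 : Lk p B x y) (h2 : Lk p B x z) (h3 : Lk p B y z) (hq : LenEq F p q) :
    sqd q x y = sqd p x y ∧ sqd q x z = sqd p x z ∧ sqd q y z = sqd p y z := by
  have hqB := hq.mono hBF
  obtain ⟨δ₀, hδ₀⟩ := hp.exists_derivation (Pi.single w ![1, 0])
  obtain ⟨δ₁, hδ₁⟩ := hp.exists_derivation (Pi.single w ![0, 1])
  have key : ∀ (δ : Derivation ℚ ℝ ℝ) (a : Fin 2 → ℝ), der δ p = Pi.single w a →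
      ∀ u v, Lk p B u v → δ (sqd q u v) = 0 := by
    intro δ a hδ u v huv
    rw [derivation_sqd, huv.of_lenEq hp hqB _ ?_, mul_zero]
    intro u' v' huv'
    rw [hqB.bil_der δ huv', hδ]
    have hu : u' ≠ w := fun h => hw (h ▸ ⟨_, huv', by simp⟩)
    have hv : v' ≠ w := fun h => hw (h ▸ ⟨_, huv', by simp⟩)
    simp [bil, hu, hv]
  have val : ∀ (δ : Derivation ℚ ℝ ℝ) (a : Fin 2 → ℝ), der δ p = Pi.single w a →
      ∀ u i, δ (p u i) = if u = w then a i else 0 := by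
    intro δ a hδ u i
    have := congrFun (congrFun hδ u) i
    rw [der] at this
    rw [this, Pi.single_apply]
    split_ifs <;> rfl
  have lx := hq w x hx
  have ly := hq w y hy
  have lz := hq w z hz
  set g := sqd q x y with hg
  set k := sqd q x z with hk
  set h := (g + k - sqd q y z) / 2 with hh
  have c0 : ∀ u i, δ₀ (p u i) = if u = w then (![1, 0] : Fin 2 → ℝ) i else 0 := val _ _ hδ₀
  have c1 : ∀ u i, δ₁ (p u i) = if u = w then (![0, 1] : Fin 2 → ℝ) i else 0 := val _ _ hδ₁
  have hg0 : δ₀ g = 0 := key _ _ hδ₀ _ _ h1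
  have hg1 : δ₁ g = 0 := key _ _ hδ₁ _ _ h1
  have hk0 : δ₀ k = 0 := key _ _ hδ₀ _ _ h2
  have hk1 : δ₁ k = 0 := key _ _ hδ₁ _ _ h2
  have hh0 : δ₀ h = 0 := by
    have : δ₀ (2 * h) = 0 := by
      rw [hh, mul_div_cancel₀ _ two_ne_zero, map_sub, map_add, hg0, hk0, key _ _ hδ₀ _ _ h3]
      ring
    rw [Derivation.leibniz, derivation_two] at this
    simpa using this
  have hh1 : δ₁ h = 0 := by
    have : δ₁ (2 * h) = 0 := by
      rw [hh, mul_div_cancel₀ _ two_ne_zero, map_sub, map_add, hg1, hk1, key _ _ hδ₁ _ _ h3]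
      ring
    rw [Derivation.leibniz, derivation_two] at this
    simpa using this
  set D := g * k - h * h with hD
  have hD0 : δ₀ D = 0 := by simp [hD, hg0, hk0, hh0]
  have hD1 : δ₁ D = 0 := by simp [hD, hg1, hk1, hh1]
  set y₀ := p y 0 - p x 0 with hy0
  set y₁ := p y 1 - p x 1 with hy1
  set z₀ := p z 0 - p x 0 with hz0
  set z₁ := p z 1 - p x 1 with hz1
  set s₀ := p w 0 - p x 0 with hs0
  set s₁ := p w 1 - p x 1 with hs1
  set U := g - (y₀ * y₀ + y₁ * y₁) + 2 * (s₀ * y₀ + s₁ * y₁) with hU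
  set W := k - (z₀ * z₀ + z₁ * z₁) + 2 * (s₀ * z₀ + s₁ * z₁) with hW
  simp only [sqd] at lx ly lz hg hk hh
  have hU' : U = 2 * ((q w 0 - q x 0) * (q y 0 - q x 0) + (q w 1 - q x 1) * (q y 1 - q x 1)) := by
    simp only [hU, hg, hy0, hy1, hs0, hs1]
    linear_combination ly - lx
  have hW' : W = 2 * ((q w 0 - q x 0) * (q z 0 - q x 0) + (q w 1 - q x 1) * (q z 1 - q x 1)) := by
    simp only [hW, hk, hz0, hz1, hs0, hs1]
    linear_combination lz - lx
  have hh' : h = (q y 0 - q x 0) * (q z 0 - q x 0) + (q y 1 - q x 1) * (q z 1 - q x 1) := by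
    rw [hh, hg, hk]
    ring
  have hs : s₀ * s₀ + s₁ * s₁ = (q w 0 - q x 0) ^ 2 + (q w 1 - q x 1) ^ 2 := by
    rw [lx, hs0, hs1]
    ring
  have H : 4 * (s₀ * s₀ + s₁ * s₁) * D = g * (W * W) - 2 * h * (U * W) + k * (U * U) := by
    rw [hs, hD, hU', hW', hh', hg, hk]
    ring
  have dy0 : δ₀ y₀ = 0 := by simp [hy0, c0, hwx.symm, hwy.symm]
  have dy1 : δ₀ y₁ = 0 := by simp [hy1, c0, hwx.symm, hwy.symm]
  have dy0' : δ₁ y₀ = 0 := by simp [hy0, c1, hwx.symm, hwy.symm]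
  have dy1' : δ₁ y₁ = 0 := by simp [hy1, c1, hwx.symm, hwy.symm]
  have dz0 : δ₀ z₀ = 0 := by simp [hz0, c0, hwx.symm, hwz.symm]
  have dz1 : δ₀ z₁ = 0 := by simp [hz1, c0, hwx.symm, hwz.symm]
  have dz0' : δ₁ z₀ = 0 := by simp [hz0, c1, hwx.symm, hwz.symm]
  have dz1' : δ₁ z₁ = 0 := by simp [hz1, c1, hwx.symm, hwz.symm]
  have ds0 : δ₀ s₀ = 1 := by simp [hs0, c0, hwx.symm]
  have ds1 : δ₀ s₁ = 0 := by simp [hs1, c0, hwx.symm]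
  have ds0' : δ₁ s₀ = 0 := by simp [hs0, c1, hwx.symm]
  have ds1' : δ₁ s₁ = 1 := by simp [hs1, c1, hwx.symm]
  have dU0 : δ₀ U = 2 * y₀ := by simp [hU, derivation_two, hg0, dy0, dy1, ds0, ds1]
  have dU1 : δ₁ U = 2 * y₁ := by simp [hU, derivation_two, hg1, dy0', dy1', ds0', ds1']
  have dW0 : δ₀ W = 2 * z₀ := by simp [hW, derivation_two, hk0, dz0, dz1, ds0, ds1]
  have dW1 : δ₁ W = 2 * z₁ := by simp [hW, derivation_two, hk1, dz0', dz1', ds0', ds1']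
  obtain ⟨E1, E2, E3⟩ := gram_relations hg0 hg1 hh0 hh1 hk0 hk1 hD0 hD1 dy0 dy0' dy1' dz0 dz0'
    dz1' ds0 ds0' ds1 ds1' dU0 dU1 dW0 dW1 H
  have hn : y₀ * z₁ - y₁ * z₀ ≠ 0 := by
    have := hp.genPos.2 x y z hxy hyz hxz
    rwa [area] at this
  rcases gram_dichotomy hn hD E1 E2 E3 with hg' | ⟨rg', rk', rh'⟩
  · exfalso
    obtain ⟨hx0, hx1⟩ := sub_eq_zero_of_sqd (hg.symm.trans hg')
    have hU0 : U = 0 := by rw [hU', hx0, hx1]; ring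
    have a0 : y₀ = 0 := by
      rw [hU0, map_zero] at dU0
      linarith
    have a1 : y₁ = 0 := by
      rw [hU0, map_zero] at dU1
      linarith
    exact hn (by rw [a0, a1]; ring)
  · refine ⟨?_, ?_, ?_⟩
    · rw [rg', hy0, hy1, sqd]
      ring
    · rw [rk', hz0, hz1, sqd]
      ring
    · have : sqd q y z = g + k - 2 * h := by rw [hh, sqd]; ring
      rw [this, rg', rk', rh', hy0, hy1, hz0, hz1, sqd]
      ring

end DegreeThree

section GlobalRigidity

theorem sqd_expand (p : Pl V) (x u v : V) : sqd p u v = sqd p u x + sqd p v x -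
    2 * ((p u 0 - p x 0) * (p v 0 - p x 0) + (p u 1 - p x 1) * (p v 1 - p x 1)) := by
  simp only [sqd]
  ring

/-- The distances to three affinely independent points determine the mutual distance. -/
theorem sqd_eq_of_three {p q : Pl V} {x y z u v : V} (hA : area p x y z ≠ 0)
    (hxy : sqd q y x = sqd p y x) (hxz : sqd q z x = sqd p z x) (hyz : sqd q y z = sqd p y z)
    (hux : sqd q u x = sqd p u x) (huy : sqd q u y = sqd p u y) (huz : sqd q u z = sqd p u z)
    (hvx : sqd q v x = sqd p v x) (hvy : sqd q v y = sqd p v y) (hvz : sqd q v z = sqd p v z) :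
    sqd q u v = sqd p u v := by
  have key : ∀ r s : V, sqd q r x = sqd p r x → sqd q s x = sqd p s x → sqd q r s = sqd p r s →
      (q r 0 - q x 0) * (q s 0 - q x 0) + (q r 1 - q x 1) * (q s 1 - q x 1) =
      (p r 0 - p x 0) * (p s 0 - p x 0) + (p r 1 - p x 1) * (p s 1 - p x 1) := by
    intro r s hr hs hrs
    rw [sqd_expand q x, sqd_expand p x] at hrs
    linarith
  have kyz := key y z hxy hxz hyz
  have kuy := key u y hux hxy huy
  have kuz := key u z hux hxz huz
  have kvy := key v y hvx hxy hvy
  have kvz := key v z hvx hxz hvz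
  have form : ∀ a : Pl V, area a x y z ^ 2 *
      ((a u 0 - a x 0) * (a v 0 - a x 0) + (a u 1 - a x 1) * (a v 1 - a x 1)) =
      sqd a z x * (((a u 0 - a x 0) * (a y 0 - a x 0) + (a u 1 - a x 1) * (a y 1 - a x 1)) *
        ((a v 0 - a x 0) * (a y 0 - a x 0) + (a v 1 - a x 1) * (a y 1 - a x 1))) -
      ((a y 0 - a x 0) * (a z 0 - a x 0) + (a y 1 - a x 1) * (a z 1 - a x 1)) *
      (((a u 0 - a x 0) * (a y 0 - a x 0) + (a u 1 - a x 1) * (a y 1 - a x 1)) *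
        ((a v 0 - a x 0) * (a z 0 - a x 0) + (a v 1 - a x 1) * (a z 1 - a x 1)) +
        ((a u 0 - a x 0) * (a z 0 - a x 0) + (a u 1 - a x 1) * (a z 1 - a x 1)) *
        ((a v 0 - a x 0) * (a y 0 - a x 0) + (a v 1 - a x 1) * (a y 1 - a x 1))) +
      sqd a y x * (((a u 0 - a x 0) * (a z 0 - a x 0) + (a u 1 - a x 1) * (a z 1 - a x 1)) *
        ((a v 0 - a x 0) * (a z 0 - a x 0) + (a v 1 - a x 1) * (a z 1 - a x 1))) := by
    intro a
    simp only [area, sqd]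
    ring
  have harea : area q x y z ^ 2 = area p x y z ^ 2 := by
    have gram : ∀ a : Pl V, sqd a y x * sqd a z x - ((a y 0 - a x 0) * (a z 0 - a x 0) +
        (a y 1 - a x 1) * (a z 1 - a x 1)) ^ 2 = area a x y z ^ 2 := by
      intro a
      simp only [area, sqd]
      ring
    rw [← gram q, ← gram p, hxy, hxz, kyz]
  have := form q
  rw [harea, hxy, hxz, kyz, kuy, kuz, kvy, kvz, ← form p] at this
  have := mul_left_cancel₀ (pow_ne_zero 2 hA) this
  rw [sqd_expand q x, sqd_expand p x, hux, hvx, this]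

variable [Fintype V] [DecidableEq V]

theorem Sep.of_no_edge {F : Set (Sym2 V)} {x y : V} {U : Set V} (hU : U.Nonempty)
    (hUF : U ⊆ vertexSpan F) (hx : x ∉ U) (hy : y ∉ U)
    (h : ∀ u ∈ U, ∀ w, s(u, w) ∈ F → w = x ∨ w = y ∨ w ∈ U)
    (hW : ∃ w ∈ vertexSpan F, w ∉ U ∧ w ≠ x ∧ w ≠ y) :
    Sep F x y U {w | w ∈ vertexSpan F ∧ w ∉ U ∧ w ≠ x ∧ w ≠ y} where
  left := hU
  right := hW
  disj u hu hw := hw.2.1 hu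
  x_left := hx
  y_left := hy
  x_right h := h.2.2.1 rfl
  y_right h := h.2.2.2 rfl
  cover u hu := by
    simp only [Set.mem_ofPred_eq]
    tauto
  sub_left := hUF
  sub_right w hw := hw.1
  no_edge u hu w hw he := by
    have := h u hu w he
    simp only [Set.mem_ofPred_eq] at hw
    tauto

theorem nontrivial_of_vertexSpan {F : Set (Sym2 V)} (h : 4 ≤ (vertexSpan F).ncard) :
    F.Nontrivial := by
  by_contra hn
  rcases (Set.not_nontrivial_iff.mp hn).eq_empty_or_singleton with rfl | ⟨e, rfl⟩
  · have : vertexSpan (∅ : Set (Sym2 V)) = ∅ := by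
      ext v
      simp [vertexSpan]
    rw [this, Set.ncard_empty] at h
    lia
  · induction e using Sym2.ind with
    | _ a b =>
      rw [vertexSpan_singleton] at h
      have := Set.ncard_insert_le a {b}
      rw [Set.ncard_singleton] at this
      lia

theorem mem_of_ncard_eq_four {p : Pl V} (hp : GenPos p) {F : Set (Sym2 V)} (hF : RCon p F)
    (hl : Loopless F) (h4 : (vertexSpan F).ncard = 4) {u v : V} (hu : u ∈ vertexSpan F)
    (hv : v ∈ vertexSpan F) (huv : u ≠ v) : s(u, v) ∈ F := by
  have h3 := hF.three_le hp hl (nontrivial_of_vertexSpan h4.ge) hu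
  have hsub : nbr F u ⊆ vertexSpan F \ {u} := fun w hw =>
    ⟨nbr_subset_vertexSpan u hw, fun h => nbr_ne hl hw h.symm⟩
  have hc := Set.ncard_sdiff_singleton_add_one hu
  have := Set.eq_of_subset_of_ncard_le hsub (by lia)
  exact this.ge ⟨hv, huv.symm⟩

theorem RCon.sqd_eq_of_sep {p q : Pl V} (hp : Generic p) {F : Set (Sym2 V)} (hF : RCon p F)
    {x y : V} {U W : Set V} (h : Sep F x y U W) (hq : LenEq F p q) : sqd q x y = sqd p x y := by
  refine LenEq.sqd_eq_of_two_lk hp (hF.sep_ne hp.genPos h) (A := touch F U) (B := touch F W) ?_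
    (hF.sep_lk hp.genPos h).2 (hF.sep_lk hp.genPos h.symm).2
    (hq.mono (Set.union_subset (touch_subset F U) (touch_subset F W)))
  intro u hu hu'
  have h1 := h.vertexSpan_touch_subset hu
  have h2 := h.symm.vertexSpan_touch_subset hu'
  simp only [Set.mem_insert_iff] at h1 h2
  have := h.disj u
  tauto

theorem ThreeConn.of_minimal_sep {p : Pl V} (hp : GenPos p) {F : Set (Sym2 V)} (hF : RCon p F)
    {x y : V} {U W : Set V} (h : Sep F x y U W) (h2 : 2 ≤ U.ncard)
    (hmin : ∀ x' y' U' W', Sep F x' y' U' W' → U.ncard ≤ U'.ncard) :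
    ThreeConn (insert s(x, y) (touch F U)) := by
  have hxy := hF.sep_ne hp h
  have hV : vertexSpan (insert s(x, y) (touch F U)) = insert x (insert y U) := by
    rw [Set.insert_eq, vertexSpan_union, vertexSpan_singleton, hF.vertexSpan_touch hp h]
    ext u
    simp only [Set.mem_union, Set.mem_insert_iff, Set.mem_singleton_iff]
    tauto
  have hxF : x ∈ vertexSpan F := vertexSpan_mono (touch_subset F U) (hF.sep_mem hp h).1
  have hyF : y ∈ vertexSpan F := vertexSpan_mono (touch_subset F U) (hF.sep_mem hp h).2
  refine ⟨?_, ?_⟩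
  · rw [hV, Set.ncard_insert_of_notMem (by simp [hxy, h.x_left]),
      Set.ncard_insert_of_notMem h.y_left]
    lia
  have main : ∀ a b A B, Sep (insert s(x, y) (touch F U)) a b A B → x ∉ A → y ∉ A → False := by
    intro a b A B hs hxA hyA
    obtain ⟨ha, hb⟩ := (hF.sep_rCon hp h).sep_mem hp hs
    have hab := (hF.sep_rCon hp h).sep_ne hp hs
    have haV := vertexSpan_mono (touch_subset _ A) ha
    have hbV := vertexSpan_mono (touch_subset _ A) hb
    rw [hV] at haV hbV
    have hAV := hs.sub_left
    have hBV := hs.sub_right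
    rw [hV] at hAV hBV
    have hAU : A ⊆ U := fun u hu => by
      rcases hAV hu with rfl | rfl | h
      · exact (hxA hu).elim
      · exact (hyA hu).elim
      · exact h
    have hmem : ∀ u, u ∈ insert x (insert y U) → u ∈ vertexSpan F := by
      rintro u (rfl | rfl | hu)
      · exact hxF
      · exact hyF
      · exact h.sub_left hu
    have := hmin a b A _ (Sep.of_no_edge hs.left (hAU.trans h.sub_left) hs.x_left hs.y_left (by
      intro u hu w huw
      have huw' : s(u, w) ∈ insert s(x, y) (touch F U) :=
        .inr (mem_touch.mpr ⟨huw, .inl (hAU hu)⟩)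
      have hn : w ∉ B := fun hw => hs.no_edge u hu w hw huw'
      have := hs.cover w (right_mem_vertexSpan huw')
      tauto) (by
      obtain ⟨w, hw⟩ := hs.right
      exact ⟨w, hmem w (hBV hw), fun h => hs.disj w h hw, fun h => hs.x_right (h ▸ hw),
        fun h => hs.y_right (h ▸ hw)⟩))
    have hUA := Set.eq_of_subset_of_ncard_le hAU this
    obtain ⟨w, hw⟩ := hs.right
    have hwA : w ∉ A := fun h => hs.disj w h hw
    have hwa : w ≠ a := fun h => hs.x_right (h ▸ hw)
    have hwb : w ≠ b := fun h => hs.y_right (h ▸ hw)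
    have hw' := hBV hw
    have haA := hs.x_left
    have hbA := hs.y_left
    rw [← hUA] at hw' haV hbV
    simp only [Set.mem_insert_iff] at hw' haV hbV
    grind
  intro a b A B hs
  have h1 := hs.no_edge
  have hxyF : s(x, y) ∈ insert s(x, y) (touch F U) := .inl rfl
  by_cases hA : x ∉ A ∧ y ∉ A
  · exact main a b A B hs hA.1 hA.2
  refine main a b B A hs.symm ?_ ?_
  · intro hx
    refine hA ⟨fun h => hs.disj x h hx, fun hy => h1 y hy x hx (.inl Sym2.eq_swap)⟩
  · intro hy
    exact hA ⟨fun hx => h1 x hx y hy hxyF, fun h => hs.disj y h hy⟩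

end GlobalRigidity

section GlobalRigidityOfThreeConn

variable [Fintype V] [DecidableEq V]

theorem sqd_eq_of_union {p q : Pl V} {X Y : Set V} (hX : ∀ u ∈ X, ∀ v ∈ X, sqd q u v = sqd p u v)
    (hY : ∀ u ∈ Y, ∀ v ∈ Y, sqd q u v = sqd p u v) {x y z : V} (hx : x ∈ X ∩ Y) (hy : y ∈ X ∩ Y)
    (hz : z ∈ X ∩ Y) (hA : area p x y z ≠ 0) :
    ∀ u ∈ X ∪ Y, ∀ v ∈ X ∪ Y, sqd q u v = sqd p u v := by
  have key : ∀ w ∈ X ∩ Y, ∀ u ∈ X ∪ Y, sqd q u w = sqd p u w := by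
    rintro w hw u (hu | hu)
    · exact hX u hu w hw.1
    · exact hY u hu w hw.2
  intro u hu v hv
  exact sqd_eq_of_three hA (hX y hy.1 x hx.1) (hX z hz.1 x hx.1) (hX y hy.1 z hz.1)
    (key x hx u hu) (key y hy u hu) (key z hz u hu) (key x hx v hv) (key y hy v hv) (key z hz v hv)

theorem RCon.sqd_eq_of_ncard_nbr_eq_three {p q : Pl V} (hp : Generic p) {F : Set (Sym2 V)}
    (hF : RCon p F) (hl : Loopless F) (h3 : ThreeConn F) (h5 : 5 ≤ (vertexSpan F).ncard)
    (hq : LenEq F p q) {w : V} (hwF : w ∈ vertexSpan F) (hw : (nbr F w).ncard = 3)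
    (ih : ∀ F' : Set (Sym2 V), (vertexSpan F').ncard < (vertexSpan F).ncard → RCon p F' →
      Loopless F' → ThreeConn F' → LenEq F' p q →
      ∀ u ∈ vertexSpan F', ∀ v ∈ vertexSpan F', sqd q u v = sqd p u v) :
    ∀ u ∈ vertexSpan F, ∀ v ∈ vertexSpan F, sqd q u v = sqd p u v := by
  have hg := hp.genPos
  have hn := nontrivial_of_vertexSpan h3.1
  have hJ := hF.rCon_delV_union_KK hp hl hn h3 h5 hw
  have hJ3 := hF.threeConn_delV_union_KK hg hl hn h3 h5 hwF hJ
  have hJV := hF.vertexSpan_delV_union_KK hg hl hn w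
  have hr := hF.rigidOn_delV hp hl hn hwF hw.le
  have hdel := hF.vertexSpan_delV hg hl hn w
  obtain ⟨x, y, z, hxy, hxz, hyz, hN⟩ := Set.ncard_eq_three.mp hw
  have hx : x ∈ nbr F w := by simp [hN]
  have hy : y ∈ nbr F w := by simp [hN]
  have hz : z ∈ nbr F w := by simp [hN]
  have hm : ∀ u ∈ nbr F w, u ∈ vertexSpan F \ {w} := fun u hu =>
    ⟨nbr_subset_vertexSpan w hu, (nbr_ne hl hu).symm⟩
  obtain ⟨e1, e2, e3⟩ := LenEq.sqd_eq_of_star hp (nbr_ne hl hx) (nbr_ne hl hy) (nbr_ne hl hz) hxy hxz hyz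
    (delV_subset F w) (by simp [hdel]) hx hy hz (hr.lk (hm x hx) (hm y hy))
    (hr.lk (hm x hx) (hm z hz)) (hr.lk (hm y hy) (hm z hz)) hq
  have hlen : LenEq (delV F w ∪ KK (nbr F w)) p q := by
    rintro u v (h | h)
    · exact hq u v (delV_subset F w h)
    · obtain ⟨-, hu, hv⟩ := mem_KK.mp h
      rw [hN] at hu hv
      rcases hu with rfl | rfl | rfl <;> rcases hv with rfl | rfl | rfl <;>
        first
        | assumption
        | simp only [sqd_self]
        | rw [sqd_comm q, sqd_comm p]; assumption
  have hX := ih _ (by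
    rw [hJV]
    have := Set.ncard_sdiff_singleton_add_one hwF
    lia) hJ (loopless_delV_union_KK hl w _) hJ3 hlen
  rw [hJV] at hX
  have hY : ∀ u ∈ insert w (nbr F w), ∀ v ∈ insert w (nbr F w), sqd q u v = sqd p u v := by
    rintro u (rfl | hu) v (rfl | hv)
    · simp only [sqd_self]
    · exact hq _ _ hv
    · rw [sqd_comm q, sqd_comm p]
      exact hq _ _ hu
    · exact hX u (hm u hu) v (hm v hv)
  have := sqd_eq_of_union hX hY ⟨hm x hx, .inr hx⟩ ⟨hm y hy, .inr hy⟩ ⟨hm z hz, .inr hz⟩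
    (hg.2 x y z hxy hyz hxz)
  have hsub : ∀ u ∈ vertexSpan F, u ∈ (vertexSpan F \ {w}) ∪ insert w (nbr F w) := by
    intro u hu
    by_cases h : u = w
    · exact .inr (.inl h)
    · exact .inl ⟨hu, h⟩
  exact fun u hu v hv => this u (hsub u hu) v (hsub v hv)

/-- If `F` is 3-connected and `F \ {ab}` is separated by `{s, t}`, then the side of `b`,
augmented with the triangle on `s`, `t`, `a` and the edge `ab`, is 3-connected. -/
theorem ThreeConn.triangle_side {F : Set (Sym2 V)} (hF : ThreeConn F) {s t a b : V} {U W : Set V}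
    (hab : s(a, b) ∈ F) (h : Sep (F \ {s(a, b)}) s t U W) (ha : a ∈ U) (hb : b ∈ W) (hst : s ≠ t)
    (hB : vertexSpan ({s(a, s), s(a, t), s(a, b)} ∪
      insert s(s, t) (touch (F \ {s(a, b)}) W)) = insert a (insert s (insert t W)))
    (hs : s ∈ vertexSpan F) (ht : t ∈ vertexSpan F) :
    ThreeConn ({s(a, s), s(a, t), s(a, b)} ∪ insert s(s, t) (touch (F \ {s(a, b)}) W)) := by
  set B := ({s(a, s), s(a, t), s(a, b)} ∪ insert s(s, t) (touch (F \ {s(a, b)}) W) :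
    Set (Sym2 V)) with hBdef
  have haW : a ∉ W := h.disj a ha
  have has : a ≠ s := fun e => h.x_left (e ▸ ha)
  have hat : a ≠ t := fun e => h.y_left (e ▸ ha)
  have m1 : s(a, s) ∈ B := by simp [hBdef]
  have m2 : s(a, t) ∈ B := by simp [hBdef]
  have m3 : s(s, t) ∈ B := by simp [hBdef]
  have m4 : s(a, b) ∈ B := by simp [hBdef]
  refine ⟨?_, ?_⟩
  · rw [hB, Set.ncard_insert_of_notMem (by simp [has, hat, haW]),
      Set.ncard_insert_of_notMem (by simp [hst, h.x_right]),
      Set.ncard_insert_of_notMem h.y_right]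
    have : 0 < W.ncard := (Set.ncard_pos).mpr ⟨b, hb⟩
    lia
  have hWF : W ⊆ vertexSpan F := h.sub_right.trans (vertexSpan_mono Set.sdiff_subset)
  have hBF : ∀ u ∈ vertexSpan B, u ∈ vertexSpan F := by
    rw [hB]
    rintro u (rfl | rfl | rfl | hu)
    exacts [left_mem_vertexSpan hab, hs, ht, hWF hu]
  have main : ∀ x y U₁ W₁, Sep B x y U₁ W₁ → s ∉ U₁ → t ∉ U₁ → a ∉ U₁ → False := by
    intro x y U₁ W₁ hS hsU htU haU
    have hUW : U₁ ⊆ W := fun u hu => by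
      have := hS.sub_left hu
      rw [hB] at this
      rcases this with rfl | rfl | rfl | h
      exacts [(haU hu).elim, (hsU hu).elim, (htU hu).elim, h]
    refine hF.2 x y U₁ _ (Sep.of_no_edge hS.left (hUW.trans hWF) hS.x_left hS.y_left ?_ ?_)
    · intro u hu w huw
      have huB : s(u, w) ∈ B := by
        by_cases he : s(u, w) = s(a, b)
        · rw [he]
          exact m4
        · exact .inr (.inr (mem_touch.mpr ⟨⟨huw, he⟩, .inl (hUW hu)⟩))
      have hn : w ∉ W₁ := fun hw => hS.no_edge u hu w hw huB
      have := hS.cover w (right_mem_vertexSpan huB)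
      tauto
    · obtain ⟨w, hw⟩ := hS.right
      exact ⟨w, hBF w (hS.sub_right hw), fun h => hS.disj w h hw, fun h => hS.x_right (h ▸ hw),
        fun h => hS.y_right (h ▸ hw)⟩
  intro x y U₁ W₁ hS
  have m1' : s(s, a) ∈ B := Sym2.eq_swap (a := a) ▸ m1
  have m2' : s(t, a) ∈ B := Sym2.eq_swap (a := a) ▸ m2
  have m3' : s(t, s) ∈ B := Sym2.eq_swap (a := s) ▸ m3
  have hno := hS.no_edge
  have hd := hS.disj
  by_cases hU : s ∉ U₁ ∧ t ∉ U₁ ∧ a ∉ U₁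
  · exact main x y U₁ W₁ hS hU.1 hU.2.1 hU.2.2
  · refine main x y W₁ U₁ hS.symm ?_ ?_ ?_ <;> intro hm <;> apply hU <;> refine ⟨?_, ?_, ?_⟩ <;>
      intro hm' <;>
      first
      | exact hd _ hm' hm
      | exact hno _ hm' _ hm (by assumption)

theorem RCon.sqd_eq_of_sep_sdiff {p q : Pl V} (hp : Generic p) {F : Set (Sym2 V)}
    (hl : Loopless F) (h3 : ThreeConn F) (hq : LenEq F p q) {e : Sym2 V} (he : e ∈ F)
    (hF : RCon p (F \ {e})) (hV : vertexSpan (F \ {e}) = vertexSpan F)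
    (hns : ¬ ThreeConn (F \ {e}))
    (ih : ∀ F' : Set (Sym2 V), (vertexSpan F').ncard < (vertexSpan F).ncard → RCon p F' →
      Loopless F' → ThreeConn F' → LenEq F' p q →
      ∀ u ∈ vertexSpan F', ∀ v ∈ vertexSpan F', sqd q u v = sqd p u v) :
    ∀ u ∈ vertexSpan F, ∀ v ∈ vertexSpan F, sqd q u v = sqd p u v := by
  have hg := hp.genPos
  have hl' : Loopless (F \ {e}) := fun f hf => hl f hf.1
  have hex : ∃ n, ∃ s t U W, Sep (F \ {e}) s t U W ∧ U.ncard = n := by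
    by_contra hcon
    push Not at hcon
    exact hns ⟨hV ▸ h3.1, fun s t U W h => hcon _ s t U W h rfl⟩
  classical
  obtain ⟨s, t, U, W, hS, hUn⟩ := Nat.find_spec hex
  have hmin : ∀ s' t' U' W', Sep (F \ {e}) s' t' U' W' → U.ncard ≤ U'.ncard := fun s' t' U' W' h => by
    rw [hUn]
    exact Nat.find_min' hex ⟨s', t', U', W', h, rfl⟩
  have hst := hF.sep_ne hg hS
  obtain ⟨a, ha, b, hb, rfl⟩ : ∃ a ∈ U, ∃ b ∈ W, e = s(a, b) := by
    by_contra hcon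
    push Not at hcon
    refine h3.2 s t U W ⟨hS.left, hS.right, hS.disj, hS.x_left, hS.y_left, hS.x_right, hS.y_right,
      hV ▸ hS.cover, hV ▸ hS.sub_left, hV ▸ hS.sub_right, fun u hu w hw h => ?_⟩
    exact hS.no_edge u hu w hw ⟨h, fun h' => hcon u hu w hw h'.symm⟩
  set F' := F \ {s(a, b)} with hF'
  have h2 : 2 ≤ U.ncard := by
    have hd := hF.three_le hg hl' (nontrivial_of_vertexSpan (hV ▸ h3.1)) (hS.sub_left ha)
    have hsub : nbr F' a ⊆ insert s (insert t (U \ {a})) := by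
      intro u hu
      have h1 : u ∉ W := fun hw => hS.no_edge a ha u hw hu
      have h2 := hS.cover u (nbr_subset_vertexSpan a hu)
      have h3 := nbr_ne hl' hu
      simp only [Set.mem_insert_iff, Set.mem_sdiff, Set.mem_singleton_iff]
      tauto
    have h1 := Set.ncard_le_ncard hsub
    have h2 := Set.ncard_insert_le s (insert t (U \ {a}))
    have h3 := Set.ncard_insert_le t (U \ {a})
    have h4 := Set.ncard_sdiff_singleton_add_one ha
    lia
  have hq' : LenEq F' p q := hq.mono Set.sdiff_subset
  have hsq := hF.sqd_eq_of_sep hp hS hq'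
  have hlt : ∀ W', LenEq (insert s(s, t) (touch F' W')) p q := by
    rintro W' u v (h | h)
    · rcases Sym2.eq_iff.mp h with ⟨rfl, rfl⟩ | ⟨rfl, rfl⟩
      · exact hsq
      · rw [sqd_comm q, sqd_comm p]
        exact hsq
    · exact hq' u v (touch_subset _ _ h)
  have hll : ∀ W', Loopless (insert s(s, t) (touch F' W')) := by
    rintro W' f (rfl | hf)
    · simpa using hst
    · exact hl' f (touch_subset _ _ hf)
  have hspan : ∀ U' W', Sep F' s t U' W' →
      vertexSpan (insert s(s, t) (touch F' U')) = insert s (insert t U') := by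
    intro U' W' h
    rw [Set.insert_eq, vertexSpan_union, vertexSpan_singleton, hF.vertexSpan_touch hg h]
    ext u
    simp only [Set.mem_union, Set.mem_insert_iff, Set.mem_singleton_iff]
    tauto
  have hsF : s ∈ vertexSpan F := hV ▸ vertexSpan_mono (touch_subset F' U) (hF.sep_mem hg hS).1
  have htF : t ∈ vertexSpan F := hV ▸ vertexSpan_mono (touch_subset F' U) (hF.sep_mem hg hS).2
  have hcard : ∀ F₂ : Set (Sym2 V), vertexSpan F₂ ⊆ vertexSpan F → (∃ u ∈ vertexSpan F, u ∉ vertexSpan F₂) →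
      (vertexSpan F₂).ncard < (vertexSpan F).ncard := fun F₂ h1 ⟨u, hu, hu'⟩ =>
    Set.ncard_lt_ncard ⟨h1, fun h => hu' (h hu)⟩
  have hX := ih _ (hcard _ (by
      rw [hspan U W hS]
      rintro u (rfl | rfl | hu)
      exacts [hsF, htF, hV ▸ hS.sub_left hu])
    ⟨b, right_mem_vertexSpan he, by
      rw [hspan U W hS]
      rintro (rfl | rfl | hu)
      exacts [hS.x_right hb, hS.y_right hb, hS.disj b hu hb]⟩)
    (hF.sep_rCon hg hS) (hll U) (ThreeConn.of_minimal_sep hg hF hS h2 hmin) (hlt U)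
  rw [hspan U W hS] at hX
  have hWspan := hspan W U hS.symm
  have hB : vertexSpan ({s(a, s), s(a, t), s(a, b)} ∪ insert s(s, t) (touch F' W)) =
      insert a (insert s (insert t W)) := by
    rw [vertexSpan_union, hWspan, Set.insert_eq s(a, s), Set.insert_eq s(a, t), vertexSpan_union,
      vertexSpan_union, vertexSpan_singleton, vertexSpan_singleton, vertexSpan_singleton]
    ext u
    simp only [Set.mem_union, Set.mem_insert_iff, Set.mem_singleton_iff]
    have hb' : u = b → u ∈ W := fun h => h ▸ hb
    tauto
  have hC := h3.triangle_side he hS ha hb hst hB hsF htF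
  have hbs : b ≠ s := fun e => hS.x_right (e ▸ hb)
  have hbt : b ≠ t := fun e => hS.y_right (e ▸ hb)
  have has : a ≠ s := fun e => hS.x_left (e ▸ ha)
  have hat : a ≠ t := fun e => hS.y_left (e ▸ ha)
  have haV : a ∉ insert s (insert t W) := by
    simp [has, hat, hS.disj a ha]
  have hWr : RigidOn p (insert s(s, t) (touch F' W)) (vertexSpan (insert s(s, t) (touch F' W))) := by
    rw [hWspan]
    exact (hF.sep_rigidOn hp hl' hS.symm).mono (Set.subset_insert _ _) subset_rfl
  have hBR : RCon p ({s(a, s), s(a, t), s(a, b)} ∪ insert s(s, t) (touch F' W)) :=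
    RCon.add_star hg (hF.sep_rCon hg hS.symm) hWr (by rw [hWspan]; exact haV)
      (by simp [hWspan]) (by simp [hWspan]) (by simp [hWspan, hb]) hst hbs.symm hbt.symm
  obtain ⟨c, hc, hca⟩ : ∃ c ∈ U, c ≠ a := Set.exists_ne_of_one_lt_ncard (by lia) a
  have hY := ih _ (hcard _ (by
      rw [hB]
      rintro u (rfl | rfl | rfl | hu)
      exacts [left_mem_vertexSpan he, hsF, htF, hV ▸ hS.sub_right hu])
    ⟨c, hV ▸ hS.sub_left hc, by
      rw [hB]
      rintro (rfl | rfl | rfl | hu)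
      exacts [hca rfl, hS.x_left hc, hS.y_left hc, hS.disj c hc hu]⟩) hBR (by
      rintro f ((rfl | rfl | rfl) | hf)
      · simpa using has
      · simpa using hat
      · exact hl _ he
      · exact hll W f hf) hC (by
      rintro u v ((h | h | h) | h)
      · rcases Sym2.eq_iff.mp h with ⟨rfl, rfl⟩ | ⟨rfl, rfl⟩
        · exact hX _ (by simp [ha]) _ (by simp)
        · exact hX _ (by simp) _ (by simp [ha])
      · rcases Sym2.eq_iff.mp h with ⟨rfl, rfl⟩ | ⟨rfl, rfl⟩
        · exact hX _ (by simp [ha]) _ (by simp)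
        · exact hX _ (by simp) _ (by simp [ha])
      · exact hq u v (h ▸ he)
      · exact hlt W u v h)
  rw [hB] at hY
  have := sqd_eq_of_union hX hY (x := s) (y := t) (z := a) (by simp) (by simp) (by simp [ha])
    (hg.2 s t a hst hat.symm has.symm)
  have hsub : ∀ u ∈ vertexSpan F, u ∈ insert s (insert t U) ∪ insert a (insert s (insert t W)) := by
    intro u hu
    have := hS.cover u (hV ▸ hu)
    simp only [Set.mem_union, Set.mem_insert_iff]
    tauto
  exact fun u hu v hv => this u (hsub u hu) v (hsub v hv)

/-- A 3-connected and redundantly rigid generic framework in the plane is globally rigid. -/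
theorem RCon.sqd_eq {p q : Pl V} (hp : Generic p) {F : Set (Sym2 V)} (hF : RCon p F)
    (hl : Loopless F) (h3 : ThreeConn F) (hq : LenEq F p q) :
    ∀ u ∈ vertexSpan F, ∀ v ∈ vertexSpan F, sqd q u v = sqd p u v := by
  have hg := hp.genPos
  obtain ⟨n, hn⟩ : ∃ n, (vertexSpan F).ncard = n := ⟨_, rfl⟩
  induction n using Nat.strong_induction_on generalizing F with
  | _ n ihn =>
  obtain ⟨m, hm⟩ : ∃ m, F.ncard = m := ⟨_, rfl⟩
  induction m using Nat.strong_induction_on generalizing F with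
  | _ m ihm =>
  have ih : ∀ F' : Set (Sym2 V), (vertexSpan F').ncard < (vertexSpan F).ncard → RCon p F' →
      Loopless F' → ThreeConn F' → LenEq F' p q →
      ∀ u ∈ vertexSpan F', ∀ v ∈ vertexSpan F', sqd q u v = sqd p u v :=
    fun F' h1 h2 h3 h4 h5 => ihn _ (hn ▸ h1) h2 h3 h4 h5 rfl
  have hnt := nontrivial_of_vertexSpan h3.1
  by_cases h4 : (vertexSpan F).ncard = 4
  · intro u hu v hv
    by_cases huv : u = v
    · subst huv
      simp only [sqd_self]
    · exact hq u v (mem_of_ncard_eq_four hg hF hl h4 hu hv huv)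
  have h5 : 5 ≤ (vertexSpan F).ncard := by
    have := h3.1
    lia
  by_cases hw : ∃ w ∈ vertexSpan F, (nbr F w).ncard = 3
  · obtain ⟨w, hwF, hw⟩ := hw
    exact hF.sqd_eq_of_ncard_nbr_eq_three hp hl h3 h5 hq hwF hw ih
  · push Not at hw
    obtain ⟨e, he, hFe⟩ := hF.exists_removable hp hl h3 fun w hwF => by
      have := hF.three_le hg hl hnt hwF
      have := hw w hwF
      lia
    have hV : vertexSpan (F \ {e}) = vertexSpan F := by
      refine (vertexSpan_mono Set.sdiff_subset).antisymm fun u hu => ?_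
      have h3 := hF.three_le hg hl hnt hu
      by_contra hcon
      have hsub : ∀ x ∈ nbr F u, s(u, x) = e := fun x hx => by
        by_contra hne
        exact hcon (left_mem_vertexSpan (v := x) ⟨hx, hne⟩)
      have : (nbr F u).ncard ≤ 1 := (Set.ncard_le_one (Set.toFinite _)).mpr fun x hx y hy => by
        have := (hsub x hx).trans (hsub y hy).symm
        exact Sym2.congr_right.mp this
      lia
    by_cases h : ThreeConn (F \ {e})
    · have := ihm (F \ {e}).ncard (by
        rw [← hm, ← Set.ncard_sdiff_singleton_add_one he]
        lia) hFe (fun f hf => hl f hf.1) h (hq.mono Set.sdiff_subset) (hV ▸ hn) rfl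
      rwa [hV] at this
    · exact RCon.sqd_eq_of_sep_sdiff hp hl h3 hq he hFe hV h ih

end GlobalRigidityOfThreeConn

section Sufficiency

variable [Fintype V] [DecidableEq V]

/-- No two vertices of `F` separate `v` from a vertex of `P`. -/
def UnSep (F : Set (Sym2 V)) (P : Set V) (v : V) : Prop :=
  ∀ x y U W, Sep F x y U W → v ∈ U → ∀ b ∈ P, b ∉ W

theorem UnSep.side {F : Set (Sym2 V)} {P : Set V} {v : V} (h : UnSep F P v) {s t : V}
    {U W : Set V} (hS : Sep F s t U W)
    (hV : vertexSpan (insert s(s, t) (touch F U)) = insert s (insert t U))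
    (hs : s ∈ vertexSpan F) (ht : t ∈ vertexSpan F) :
    UnSep (insert s(s, t) (touch F U)) P v := by
  intro x y A B hAB hvA b hb hbB
  have hsub : ∀ u ∈ insert s (insert t U), u ∈ vertexSpan F := by
    rintro u (rfl | rfl | hu)
    exacts [hs, ht, hS.sub_left hu]
  have key : ∀ A B, Sep (insert s(s, t) (touch F U)) x y A B → s ∉ A → t ∉ A →
      ∀ w ∈ B, ∃ W', Sep F x y A W' ∧ w ∈ W' := by
    intro A B hAB hsA htA w hw
    have hAU : A ⊆ U := fun u hu => by
      have := hAB.sub_left hu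
      rw [hV] at this
      rcases this with rfl | rfl | h
      exacts [(hsA hu).elim, (htA hu).elim, h]
    have hwF : w ∈ vertexSpan F := hsub w (hV ▸ hAB.sub_right hw)
    have hwA : w ∉ A := fun h => hAB.disj w h hw
    have hwx : w ≠ x := fun h => hAB.x_right (h ▸ hw)
    have hwy : w ≠ y := fun h => hAB.y_right (h ▸ hw)
    refine ⟨_, Sep.of_no_edge hAB.left (hAU.trans hS.sub_left) hAB.x_left hAB.y_left ?_
      ⟨w, hwF, hwA, hwx, hwy⟩, hwF, hwA, hwx, hwy⟩
    intro u hu z huz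
    have huz' : s(u, z) ∈ insert s(s, t) (touch F U) := .inr (mem_touch.mpr ⟨huz, .inl (hAU hu)⟩)
    have hn : z ∉ B := fun hz => hAB.no_edge u hu z hz huz'
    have := hAB.cover z (right_mem_vertexSpan huz')
    tauto
  have hno := hAB.no_edge
  have hd := hAB.disj
  have hst : s(s, t) ∈ insert s(s, t) (touch F U) := .inl rfl
  have hts : s(t, s) ∈ insert s(s, t) (touch F U) := .inl Sym2.eq_swap
  by_cases hA : s ∉ A ∧ t ∉ A
  · obtain ⟨W', h1, h2⟩ := key A B hAB hA.1 hA.2 b hbB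
    exact h x y A W' h1 hvA b hb h2
  · obtain ⟨W', h1, h2⟩ := key B A hAB.symm (fun hm => hA ⟨fun h => hd _ h hm, fun h => hno _ h _ hm hts⟩)
      (fun hm => hA ⟨fun h => hno _ h _ hm hst, fun h => hd _ h hm⟩) v hvA
    exact h x y W' B h1.symm h2 b hb hbB

theorem RCon.sqd_eq_of_unSep {p q : Pl V} (hp : Generic p) {F : Set (Sym2 V)} (hF : RCon p F)
    (hl : Loopless F) (hq : LenEq F p q) {P : Set V} {v : V} (h3 : 3 ≤ P.ncard) (hvP : v ∉ P)
    (hP : P ⊆ vertexSpan F) (hv : v ∈ vertexSpan F) (hK : KK P ⊆ F) (hU : UnSep F P v) :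
    ∀ b ∈ P, sqd q v b = sqd p v b := by
  have hg := hp.genPos
  obtain ⟨n, hn⟩ : ∃ n, (vertexSpan F).ncard = n := ⟨_, rfl⟩
  induction n using Nat.strong_induction_on generalizing F with
  | _ n ih =>
  by_cases hT : ThreeConn F
  · exact fun b hb => hF.sqd_eq hp hl hT hq v hv b (hP hb)
  have h4 : 4 ≤ (vertexSpan F).ncard := by
    have := Set.ncard_le_ncard (Set.insert_subset hv hP)
    rw [Set.ncard_insert_of_notMem hvP] at this
    lia
  have main : ∀ s t U W, Sep F s t U W → v ∉ W → (∀ b ∈ P, b ∉ W) →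
      ∀ b ∈ P, sqd q v b = sqd p v b := by
    intro s t U W hS hvW hPW
    have hst := hF.sep_ne hg hS
    have hV : vertexSpan (insert s(s, t) (touch F U)) = insert s (insert t U) := by
      rw [Set.insert_eq, vertexSpan_union, vertexSpan_singleton, hF.vertexSpan_touch hg hS]
      ext u
      simp only [Set.mem_union, Set.mem_insert_iff, Set.mem_singleton_iff]
      tauto
    have hs : s ∈ vertexSpan F := vertexSpan_mono (touch_subset F U) (hF.sep_mem hg hS).1
    have ht : t ∈ vertexSpan F := vertexSpan_mono (touch_subset F U) (hF.sep_mem hg hS).2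
    have hmem : ∀ u ∈ vertexSpan F, u ∉ W → u = s ∨ u = t ∨ u ∈ U := by
      intro u hu huW
      have := hS.cover u hu
      tauto
    refine ih _ ?_ (hF.sep_rCon hg hS) ?_ ?_ ?_ ?_ ?_ (hU.side hS hV hs ht) rfl
    · rw [← hn, hV]
      obtain ⟨w, hw⟩ := hS.right
      refine Set.ncard_lt_ncard ⟨?_, fun h => ?_⟩
      · rintro u (rfl | rfl | hu)
        exacts [hs, ht, hS.sub_left hu]
      · rcases h (hS.sub_right hw) with rfl | rfl | h
        exacts [hS.x_right hw, hS.y_right hw, hS.disj _ h hw]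
    · rintro f (rfl | hf)
      · simpa using hst
      · exact hl f (touch_subset _ _ hf)
    · rintro a b (h | h)
      · have := hF.sqd_eq_of_sep hp hS hq
        rcases Sym2.eq_iff.mp h with ⟨rfl, rfl⟩ | ⟨rfl, rfl⟩
        · exact this
        · rwa [sqd_comm q, sqd_comm p]
      · exact hq a b (touch_subset _ _ h)
    · intro b hb
      rw [hV]
      exact hmem b (hP hb) (hPW b hb)
    · rw [hV]
      exact hmem v hv hvW
    · intro e he
      induction e using Sym2.ind with
      | _ a b =>
        obtain ⟨hab, ha, hb⟩ := mem_KK.mp he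
        have h1 := hmem a (hP ha) (hPW a ha)
        have h2 := hmem b (hP hb) (hPW b hb)
        by_cases haU : a ∈ U
        · exact .inr (mem_touch.mpr ⟨hK he, .inl haU⟩)
        by_cases hbU : b ∈ U
        · exact .inr (mem_touch.mpr ⟨hK he, .inr hbU⟩)
        left
        rcases h1 with rfl | rfl | h1 <;> rcases h2 with rfl | rfl | h2 <;>
          first
          | rfl
          | exact Sym2.eq_swap
          | tauto
  obtain ⟨s, t, U, W, hS⟩ : ∃ s t U W, Sep F s t U W := by
    by_contra hcon
    push Not at hcon
    exact hT ⟨h4, hcon⟩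
  by_cases hvU : v ∈ U
  · exact main s t U W hS (hS.disj v hvU) (hU s t U W hS hvU)
  by_cases hvW : v ∈ W
  · exact main s t W U hS.symm hvU (hU s t W U hS.symm hvW)
  by_cases hPW : ∀ b ∈ P, b ∉ W
  · exact main s t U W hS hvW hPW
  · push Not at hPW
    obtain ⟨b, hb, hbW⟩ := hPW
    refine main s t W U hS.symm hvU fun c hc hcU => ?_
    exact hS.no_edge c hcU b hbW (hK (mem_KK.mpr ⟨fun h => hS.disj c hcU (h ▸ hbW), hc, hb⟩))

theorem eq_of_sqd_eq_of_three {p q : Pl V} {a b c v : V} (hA : area p a b c ≠ 0) (ha : q a = p a)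
    (hb : q b = p b) (hc : q c = p c) (h1 : sqd q v a = sqd p v a) (h2 : sqd q v b = sqd p v b)
    (h3 : sqd q v c = sqd p v c) : q v = p v := by
  simp only [sqd, ha, hb, hc] at h1 h2 h3
  have e1 : (q v 0 - p v 0) * (p b 0 - p a 0) + (q v 1 - p v 1) * (p b 1 - p a 1) = 0 := by
    linarith
  have e2 : (q v 0 - p v 0) * (p c 0 - p a 0) + (q v 1 - p v 1) * (p c 1 - p a 1) = 0 := by
    linarith
  have d0 : (q v 0 - p v 0) * area p a b c = 0 := by
    simp only [area]
    linear_combination (p c 1 - p a 1) * e1 - (p b 1 - p a 1) * e2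
  have d1 : (q v 1 - p v 1) * area p a b c = 0 := by
    simp only [area]
    linear_combination (p b 0 - p a 0) * e2 - (p c 0 - p a 0) * e1
  funext i
  fin_cases i
  · exact sub_eq_zero.mp ((mul_eq_zero.mp d0).resolve_right hA)
  · exact sub_eq_zero.mp ((mul_eq_zero.mp d1).resolve_right hA)

theorem Sep.mem_support {F : Set (Sym2 V)} {x y : V} {U W : Set V} (h : Sep F x y U W) {u b : V}
    (w : (SimpleGraph.fromEdgeSet F).Walk u b) (hu : u ∈ U) (hb : b ∈ W) :
    x ∈ w.support ∨ y ∈ w.support := by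
  induction w with
  | nil => exact (h.disj _ hu hb).elim
  | @cons u z b huz w ih =>
    rw [SimpleGraph.fromEdgeSet_adj] at huz
    rcases h.cover z (right_mem_vertexSpan huz.1) with rfl | rfl | hz | hz
    · left
      simp
    · right
      simp
    · rcases ih hz hb with h | h
      · exact .inl (List.mem_cons_of_mem _ h)
      · exact .inr (List.mem_cons_of_mem _ h)
    · exact (h.no_edge u hu z hz huz.1).elim

theorem unSep_of_internallyDisjointPaths {F : Set (Sym2 V)} {P : Set V} {v : V}
    (h : ∀ b ∈ P, InternallyDisjointPaths (SimpleGraph.fromEdgeSet F) v b 3) : UnSep F P v := by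
  intro x y U W hS hv b hb hbW
  obtain ⟨Q, -, hQ⟩ := h b hb
  have hx : x ≠ v ∧ x ≠ b := ⟨fun e => hS.x_left (e ▸ hv), fun e => hS.x_right (e ▸ hbW)⟩
  have hy : y ≠ v ∧ y ≠ b := ⟨fun e => hS.y_left (e ▸ hv), fun e => hS.y_right (e ▸ hbW)⟩
  have hmem : ∀ i, x ∈ (Q i).support ∨ y ∈ (Q i).support := fun i => hS.mem_support (Q i) hv hbW
  have hno : ∀ i j, i ≠ j → ∀ z, z ≠ v ∧ z ≠ b → z ∈ (Q i).support → z ∉ (Q j).support :=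
    fun i j hij z hz hi hj => (hQ i j hij z hi hj).elim hz.1 hz.2
  have hxs : ∀ i, x ∈ (Q i).support → False := fun i hi => by
    obtain ⟨j, k, hij, hik, hjk⟩ : ∃ j k : Fin 3, i ≠ j ∧ i ≠ k ∧ j ≠ k := by
      fin_cases i
      exacts [⟨1, 2, by decide⟩, ⟨0, 2, by decide⟩, ⟨0, 1, by decide⟩]
    exact hno j k hjk y hy ((hmem j).resolve_left (hno i j hij x hx hi))
      ((hmem k).resolve_left (hno i k hik x hx hi))
  exact hno 0 1 (by decide) y hy ((hmem 0).resolve_left (hxs 0)) ((hmem 1).resolve_left (hxs 1))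

theorem loopless_edgeSet (G : SimpleGraph V) : Loopless G.edgeSet :=
  fun _ he => G.not_isDiag_of_mem_edgeSet he

theorem mem_addClique {G : SimpleGraph V} {P : Set V} {e : Sym2 V} :
    e ∈ (addClique G P).edgeSet ↔ e ∈ G.edgeSet ∨ e ∈ KK P := by
  induction e using Sym2.ind with
  | _ a b =>
    simp only [addClique, SimpleGraph.mem_edgeSet, SimpleGraph.sup_adj,
      SimpleGraph.fromEdgeSet_adj, Set.mem_ofPred_eq, mem_KK]
    refine or_congr_right ⟨?_, ?_⟩
    · rintro ⟨⟨c, hc, d, hd, h⟩, hab⟩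
      rcases Sym2.eq_iff.mp h with ⟨rfl, rfl⟩ | ⟨rfl, rfl⟩
      exacts [⟨hab, hc, hd⟩, ⟨hab, hd, hc⟩]
    · rintro ⟨hab, ha, hb⟩
      exact ⟨⟨a, ha, b, hb, rfl⟩, hab⟩

theorem KK_subset_elemClass {p : Pl V} (hp : Generic p) {E : Set (Sym2 V)} (hl : Loopless E)
    {e : Sym2 V} (he : e ∈ E) {P : Set V} (hK : KK P ⊆ E)
    (hP : P ⊆ vertexSpan (elemClass (stressOn p E) e)) :
    KK P ⊆ elemClass (stressOn p E) e := by
  intro f hf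
  induction f using Sym2.ind with
  | _ a b =>
    obtain ⟨hab, ha, hb⟩ := mem_KK.mp hf
    have hm : s(a, b) ∈ elemClass (stressOn p E) s(a, b) := .inl rfl
    rwa [elemClass_eq_of_lk hp.genPos he (hK hf) hab
      ((rigidOn_elemClass hp hl he).lk (hP ha) (hP hb)) (Lk.of_mem hm)]

theorem uniquelyLocalizable_of_component {G : SimpleGraph V} {P : Set V} {v : V} (hv : v ∉ P)
    (h3 : 3 ≤ P.ncard) {F : Set (Sym2 V)} (hF : IsRdComponent 2 (addClique G P) F)
    (hPF : P ∪ {v} ⊆ vertexSpan F)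
    (hpath : ∀ b ∈ P, InternallyDisjointPaths (SimpleGraph.fromEdgeSet F) v b 3) :
    UniquelyLocalizable G P v := by
  intro p hp q hq hqP
  obtain ⟨e, he, rfl⟩ := (isRdComponent_iff hp _ _).mp hF
  have hl := loopless_edgeSet (addClique G P)
  have hsub := elemClass_stressOn_subset (p := p) he
  have hP : P ⊆ vertexSpan (elemClass (stressOn p (addClique G P).edgeSet) e) :=
    fun b hb => hPF (.inl hb)
  have hlen : LenEq (elemClass (stressOn p (addClique G P).edgeSet) e) p q := by
    intro a b hab
    rcases mem_addClique.mp (hsub hab) with h | h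
    · exact ((eDist_eq_iff p q a b).mp (hq a b h)).symm
    · obtain ⟨-, ha, hb⟩ := mem_KK.mp h
      simp only [sqd, hqP a ha, hqP b hb]
  have hsq := (rCon_elemClass he).sqd_eq_of_unSep hp (fun f hf => hl f (hsub hf)) hlen h3 hv hP
    (hPF (.inr rfl)) (KK_subset_elemClass hp hl he (fun f hf => mem_addClique.mpr (.inr hf)) hP)
    (unSep_of_internallyDisjointPaths hpath)
  obtain ⟨a, b, c, ha, hb, hc, hab, hac, hbc⟩ := (Set.two_lt_ncard_iff).mp h3
  exact eq_of_sqd_eq_of_three (hp.genPos.2 a b c hab hbc hac) (hqP a ha) (hqP b hb) (hqP c hc)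
    (hsq a ha) (hsq b hb) (hsq c hc)

end Sufficiency

section PathLifting

open Topology

/-- Near a point where the derivative of `f` has a right inverse, straight segments in the target
lift to differentiable paths. -/
theorem exists_path_lift {E F : Type*} [NormedAddCommGroup E] [NormedSpace ℝ E] [CompleteSpace E]
    [NormedAddCommGroup F] [NormedSpace ℝ F] [CompleteSpace F] {f : E → F} {f' : E →L[ℝ] F} {a : E}
    (hf : ContDiffAt ℝ 1 f a) (hf' : HasFDerivAt f f' a) {g : F →L[ℝ] E} (hg : ∀ y, f' (g y) = y)
    {N : Set E} (hN : N ∈ 𝓝 a) :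
    ∃ δ > 0, ∀ p, ‖p - a‖ < δ → ∀ y, ‖y - f a‖ < δ → ∃ γ : ℝ → E, γ 0 = p ∧
      ∀ t ∈ Set.Icc (0 : ℝ) 1, γ t ∈ N ∧ DifferentiableAt ℝ γ t ∧ f (γ t) = f p + t • (y - f p) := by
  set s : E × F → E := fun x => x.1 + g x.2 with hs
  have hsa : s (a, 0) = a := by simp [hs]
  set Ξ : E × F → E × F := fun x => (x.1, f (s x)) with hΞ
  have hsd : ContDiff ℝ 1 s := contDiff_fst.add (g.contDiff.comp contDiff_snd)
  have hc : ContDiffAt ℝ 1 Ξ (a, 0) :=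
    contDiffAt_fst.prodMk (ContDiffAt.comp (a, (0 : F)) (hsa.symm ▸ hf) hsd.contDiffAt)
  set L : (E × F) ≃L[ℝ] E × F :=
    (ContinuousLinearEquiv.refl ℝ E).skewProd (ContinuousLinearEquiv.refl ℝ F) f' with hL
  have hd : HasFDerivAt Ξ (L : E × F →L[ℝ] E × F) (a, 0) := by
    have h1 : HasFDerivAt s (ContinuousLinearMap.fst ℝ E F +
        g.comp (ContinuousLinearMap.snd ℝ E F)) (a, 0) :=
      hasFDerivAt_fst.add (g.hasFDerivAt.comp (a, (0 : F)) hasFDerivAt_snd)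
    have h2 := hasFDerivAt_fst.prodMk (HasFDerivAt.comp (a, (0 : F)) (hsa.symm ▸ hf') h1)
    have hLe : (L : E × F →L[ℝ] E × F) = (ContinuousLinearMap.fst ℝ E F).prod
        (f'.comp (ContinuousLinearMap.fst ℝ E F + g.comp (ContinuousLinearMap.snd ℝ E F))) := by
      apply ContinuousLinearMap.ext
      rintro ⟨x, y⟩
      simp [hL, hg, add_comm]
    rw [hLe]
    exact h2
  have hst := hc.hasStrictFDerivAt' hd one_ne_zero
  set Ψ := hc.localInverse hd one_ne_zero with hΨ
  have hΞa : Ξ (a, 0) = (a, f a) := by simp [hΞ, hsa]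
  have hA : ∀ᶠ x in 𝓝 (a, (0 : F)), Ψ (Ξ x) = x := hst.eventually_left_inverse
  have hB : ∀ᶠ z in 𝓝 (a, f a), Ξ (Ψ z) = z := hΞa ▸ hst.eventually_right_inverse
  have hΨc : ContDiffAt ℝ 1 Ψ (a, f a) := hΞa ▸ hc.to_localInverse hd one_ne_zero
  have hC : ∀ᶠ z in 𝓝 (a, f a), ContDiffAt ℝ 1 Ψ z := hΨc.eventually (by simp)
  have hΨa : Ψ (a, f a) = (a, 0) := hΞa ▸ hA.self_of_nhds
  have hD : ∀ᶠ z in 𝓝 (a, f a), s (Ψ z) ∈ N := by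
    have : ContinuousAt (fun z => s (Ψ z)) (a, f a) :=
      hsd.continuous.continuousAt.comp hΨc.continuousAt
    refine this.eventually_mem ?_
    rw [hΨa, hsa]
    exact hN
  have hA' : ∀ᶠ p in 𝓝 a, Ψ (p, f p) = (p, 0) := by
    have : ContinuousAt (fun p : E => (p, (0 : F))) a := by fun_prop
    filter_upwards [this.eventually hA] with p hp
    simpa [hΞ, hs] using hp
  obtain ⟨ε, hε, hball⟩ := Metric.eventually_nhds_iff_ball.mp (hB.and (hC.and hD))
  have hcont : ∀ᶠ p in 𝓝 a, f p ∈ Metric.ball (f a) ε :=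
    hf.continuousAt.eventually_mem (Metric.ball_mem_nhds _ hε)
  obtain ⟨δ, hδ, hball'⟩ := Metric.eventually_nhds_iff_ball.mp (hA'.and hcont)
  refine ⟨min δ ε, lt_min hδ hε, fun p hp y hy => ?_⟩
  obtain ⟨h1, h2⟩ := hball' p (by
    rw [mem_ball_iff_norm]
    exact hp.trans_le (min_le_left _ _))
  have hy' : y ∈ Metric.ball (f a) ε := by
    rw [mem_ball_iff_norm]
    exact hy.trans_le (min_le_right _ _)
  have hp' : p ∈ Metric.ball a ε := by
    rw [mem_ball_iff_norm]
    exact hp.trans_le (min_le_right _ _)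
  refine ⟨fun t => s (Ψ (p, f p + t • (y - f p))), ?_, fun t ht => ?_⟩
  · simp [h1, hs]
  · obtain ⟨k1, k2, k3⟩ := hball (p, f p + t • (y - f p)) (by
      rw [← ball_prod_same]
      exact ⟨hp', (convex_ball (f a) ε).add_smul_sub_mem h2 hy' ht⟩)
    refine ⟨k3, ?_, congrArg Prod.snd k1⟩
    have e1 : DifferentiableAt ℝ s (Ψ (p, f p + t • (y - f p))) :=
      (hsd.differentiable one_ne_zero).differentiableAt
    have e2 : DifferentiableAt ℝ Ψ (p, f p + t • (y - f p)) := k2.differentiableAt one_ne_zero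
    have e3 : DifferentiableAt ℝ (fun t : ℝ => (p, f p + t • (y - f p))) t := by fun_prop
    exact e1.comp t (e2.comp t e3)

end PathLifting

section Flex

open Topology

variable [Fintype V]

/-- The squared length of an edge. -/
def lens (p : Pl V) (e : Sym2 V) : ℝ := Sym2.lift ⟨sqd p, sqd_comm p⟩ e

theorem hasFDerivAt_sqd (p : Pl V) (u v : V) :
    HasFDerivAt (fun q : Pl V => sqd q u v)
      ((2 : ℝ) • LinearMap.toContinuousLinearMap (rowF p s(u, v))) p := by
  have h : ∀ (w : V) (i : Fin 2), HasFDerivAt (fun q : Pl V => q w i)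
      ((ContinuousLinearMap.proj (R := ℝ) (φ := fun _ : Fin 2 => ℝ) i).comp
        (ContinuousLinearMap.proj (R := ℝ) (φ := fun _ : V => Fin 2 → ℝ) w)) p := fun w i =>
    ((ContinuousLinearMap.proj (R := ℝ) (φ := fun _ : Fin 2 => ℝ) i).comp
        (ContinuousLinearMap.proj (R := ℝ) (φ := fun _ : V => Fin 2 → ℝ) w)).hasFDerivAt
  have h2 := (((h u 0).sub (h v 0)).pow 2).add (((h u 1).sub (h v 1)).pow 2)
  refine h2.congr_fderiv ?_
  apply ContinuousLinearMap.ext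
  intro m
  simp [rowF, bil]
  ring

theorem hasFDerivAt_lens (p : Pl V) (e : Sym2 V) :
    HasFDerivAt (fun q : Pl V => lens q e)
      ((2 : ℝ) • LinearMap.toContinuousLinearMap (rowF p e)) p := by
  induction e with
  | _ u v => exact hasFDerivAt_sqd p u v

theorem contDiff_lens (e : Sym2 V) : ContDiff ℝ 1 (fun q : Pl V => lens q e) := by
  induction e with
  | _ u v =>
    change ContDiff ℝ 1 fun q : Pl V => (q u 0 - q v 0) ^ 2 + (q u 1 - q v 1) ^ 2
    have h : ∀ (w : V) (i : Fin 2), ContDiff ℝ 1 (fun q : Pl V => q w i) :=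
      fun w i => contDiff_apply_apply ℝ ℝ w i
    exact (((h u 0).sub (h v 0)).pow 2).add (((h u 1).sub (h v 1)).pow 2)

/-- The derivative of the map recording the positions on `X` and the lengths of `B`. -/
def pinDeriv (p : Pl V) (X : Set V) (B : Set (Sym2 V)) :
    Pl V →ₗ[ℝ] (X → Fin 2 → ℝ) × (B → ℝ) :=
  LinearMap.prod (LinearMap.pi fun u => LinearMap.proj u.1)
    (LinearMap.pi fun e => (2 : ℝ) • rowF p e.1)

theorem PinIndep.surjective_pinDeriv {p : Pl V} {X : Set V} {B : Set (Sym2 V)}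
    (h : PinIndep p X B) : Function.Surjective (pinDeriv p X B) := by
  classical
  rw [← LinearMap.dualMap_injective_iff, ← LinearMap.ker_eq_bot, LinearMap.ker_eq_bot']
  intro φ hφ
  have hφ' : ∀ m, φ (pinDeriv p X B m) = 0 := fun m => LinearMap.congr_fun hφ m
  set ω : Sym2 V → ℝ := fun e => if he : e ∈ B then φ (0, Pi.single ⟨e, he⟩ 1) else 0 with hω
  have hsnd : ∀ y : B → ℝ, φ (0, y) = ∑ e, ω e * (if he : e ∈ B then y ⟨e, he⟩ else 0) := by
    intro y
    have h1 : ∑ e, ω e * (if he : e ∈ B then y ⟨e, he⟩ else 0) = ∑ e : B, ω e.1 * y e := by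
      rw [← Finset.sum_subset (Finset.subset_univ (Finset.univ.filter (· ∈ B))), ←
        Finset.sum_subtype_eq_sum_filter]
      · refine Finset.sum_nbij' (fun e => ⟨e.1, e.2⟩) (fun e => ⟨e.1, e.2⟩) ?_ ?_ ?_ ?_ ?_ <;> simp
      · intro e _ he
        simp only [Finset.mem_filter, Finset.mem_univ, true_and] at he
        simp [he]
    have h2 : ((0 : X → Fin 2 → ℝ), y) =
        ∑ e : B, y e • ((0 : X → Fin 2 → ℝ), (Pi.single e 1 : B → ℝ)) := by
      refine Prod.ext ?_ ?_
      · simp [Prod.fst_sum]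
      · rw [Prod.snd_sum]
        funext e
        simp [Finset.sum_apply, Pi.single_apply]
    rw [h1, h2, map_sum]
    refine Finset.sum_congr rfl fun e _ => ?_
    rw [map_smul, smul_eq_mul, mul_comm]
    simp [hω, e.2]
  have hω0 : ω = 0 := by
    refine h ω (fun u hu i => ?_) (fun e he => by simp [hω, he])
    have h1 := hφ' (Pi.single u (Pi.single i 1))
    have h2 : pinDeriv p X B (Pi.single u (Pi.single i 1)) =
        (0, fun e : B => 2 * rowF p e.1 (Pi.single u (Pi.single i 1))) := by
      refine Prod.ext ?_ rfl
      funext w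
      have : w.1 ≠ u := fun hw => hu (hw ▸ w.2)
      simp [pinDeriv, this]
    rw [h2, hsnd] at h1
    have h3 : ∑ e, ω e * (if he : e ∈ B then 2 * rowF p e (Pi.single u (Pi.single i 1)) else 0) =
        2 * ∑ e, ω e * rowF p e (Pi.single u (Pi.single i 1)) := by
      rw [Finset.mul_sum]
      refine Finset.sum_congr rfl fun e _ => ?_
      by_cases he : e ∈ B
      · simp [he]; ring
      · simp [hω, he]
    rw [h3, sum_rowF_eq] at h1
    have h4 : ∑ w, ∑ j, force p ω w j * (Pi.single u (Pi.single i 1) : Pl V) w j =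
        force p ω u i := by
      rw [Finset.sum_eq_single u, Finset.sum_eq_single i]
      · simp
      · intro j _ hj; simp [hj]
      · simp
      · intro w _ hw; simp [hw]
      · simp
    rw [h4] at h1
    linarith
  apply LinearMap.ext
  rintro ⟨x, y⟩
  have hy : ∀ y, φ (0, y) = 0 := fun y => by rw [hsnd, hω0]; simp
  let m : Pl V := fun u => if hu : u ∈ X then x ⟨u, hu⟩ else 0
  have h1 := hφ' m
  have h2 : pinDeriv p X B m = (x, 0) + (0, (pinDeriv p X B m).2) := by
    refine Prod.ext ?_ (by simp)
    funext w
    simp [pinDeriv, m]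
  have h3 : (x, y) = (x, (0 : B → ℝ)) + (0, y) := by simp
  rw [h2, map_add, hy, add_zero] at h1
  rw [h3, map_add, hy, h1]
  simp

theorem hasDerivAt_sqd {γ : ℝ → Pl V} {t : ℝ} (h : DifferentiableAt ℝ γ t) (u v : V) :
    HasDerivAt (fun s => sqd (γ s) u v) (2 * bil (γ t) (deriv γ t) u v) t := by
  have := (hasFDerivAt_sqd (γ t) u v).comp_hasDerivAt t h.hasDerivAt
  have h2 : ((2 : ℝ) • LinearMap.toContinuousLinearMap (rowF (γ t) s(u, v))) (deriv γ t) =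
      2 * bil (γ t) (deriv γ t) u v := by simp [rowF]
  rw [h2] at this
  exact this

/-- Pinning the vertices of `X` at nearby positions, an edge set whose rows stay spanned by `B`
can be realised with the prescribed lengths. -/
theorem exists_flex {p₀ : Pl V} {X : Set V} {B E₀ : Set (Sym2 V)} (hB : PinIndep p₀ X B)
    (hBE : ∀ u v, s(u, v) ∈ E₀ → ∀ᶠ p in 𝓝 p₀, Lk p B u v) {ε : ℝ} (hε : 0 < ε) :
    ∃ δ > 0, ∀ p r : Pl V, (∀ u i, |p u i - p₀ u i| < δ) → (∀ u ∈ X, ∀ i, |r u i - p₀ u i| < δ) →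
      ∃ q : Pl V, (∀ u ∈ X, q u = r u) ∧ (∀ u i, |q u i - p₀ u i| < ε) ∧ LenEq E₀ p q := by
  classical
  let f : Pl V → (X → Fin 2 → ℝ) × (B → ℝ) := fun p => (fun u => p u.1, fun e => lens p e.1)
  have hf : ContDiff ℝ 1 f := by
    refine ContDiff.prodMk (contDiff_pi.mpr fun u => contDiff_apply ℝ (Fin 2 → ℝ) u.1)
      (contDiff_pi.mpr fun e => contDiff_lens e.1)
  have hf' : HasFDerivAt f (LinearMap.toContinuousLinearMap (pinDeriv p₀ X B)) p₀ := by
    have h1 : HasFDerivAt (fun p : Pl V => fun u : X => p u.1)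
        (ContinuousLinearMap.pi fun u : X =>
          ContinuousLinearMap.proj (R := ℝ) (φ := fun _ : V => Fin 2 → ℝ) u.1) p₀ :=
      hasFDerivAt_pi.mpr fun u =>
        (ContinuousLinearMap.proj (R := ℝ) (φ := fun _ : V => Fin 2 → ℝ) u.1).hasFDerivAt
    have h2 : HasFDerivAt (fun p : Pl V => fun e : B => lens p e.1)
        (ContinuousLinearMap.pi fun e : B =>
          (2 : ℝ) • LinearMap.toContinuousLinearMap (rowF p₀ e.1)) p₀ :=
      hasFDerivAt_pi.mpr fun e => hasFDerivAt_lens p₀ e.1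
    refine (h1.prodMk h2).congr_fderiv ?_
    apply ContinuousLinearMap.ext
    intro m
    rfl
  obtain ⟨g, hg⟩ := LinearMap.exists_rightInverse_of_surjective _
    (LinearMap.range_eq_top.mpr hB.surjective_pinDeriv)
  have hN : {p : Pl V | (∀ e : Sym2 V, e ∈ E₀ → ∀ u v, e = s(u, v) → Lk p B u v) ∧
      p ∈ Metric.ball p₀ ε} ∈ 𝓝 p₀ := by
    refine Filter.Eventually.and ?_ (Metric.ball_mem_nhds _ hε)
    rw [Filter.eventually_all]
    intro e
    by_cases he : e ∈ E₀
    · induction e with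
      | _ u v =>
        filter_upwards [hBE u v he] with p hp _ a b hab
        rcases Sym2.eq_iff.mp hab with ⟨rfl, rfl⟩ | ⟨rfl, rfl⟩
        · exact hp
        · exact hp.symm
    · exact Filter.Eventually.of_forall fun p h => absurd h he
  obtain ⟨δ, hδ, H⟩ := exists_path_lift hf.contDiffAt hf'
    (g := LinearMap.toContinuousLinearMap g) (fun y => LinearMap.congr_fun hg y) hN
  have hcont : ∀ᶠ p in 𝓝 p₀, ‖(fun e : B => lens p e.1) - (fun e : B => lens p₀ e.1)‖ < δ := by
    have h1 : Continuous fun p : Pl V => (fun e : B => lens p e.1) := hf.continuous.snd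
    have h2 : ContinuousAt (fun p : Pl V =>
        ‖(fun e : B => lens p e.1) - (fun e : B => lens p₀ e.1)‖) p₀ :=
      (h1.sub continuous_const).norm.continuousAt
    exact h2.eventually_lt_const (by simpa using hδ)
  obtain ⟨δ', hδ', hball⟩ := Metric.eventually_nhds_iff_ball.mp hcont
  refine ⟨min δ δ', lt_min hδ hδ', fun p r hp hr => ?_⟩
  have hnorm : ‖p - p₀‖ < min δ δ' :=
    (pi_norm_lt_iff (lt_min hδ hδ')).mpr fun u =>
      (pi_norm_lt_iff (lt_min hδ hδ')).mpr fun i => hp u i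
  obtain ⟨γ, h0, hγ⟩ := H p (hnorm.trans_le (min_le_left _ _))
    ((fun u => r u.1), fun e => lens p e.1) (by
      rw [Prod.norm_def, max_lt_iff]
      refine ⟨?_, ?_⟩
      · refine (pi_norm_lt_iff hδ).mpr fun u => (pi_norm_lt_iff hδ).mpr fun i => ?_
        exact (hr u.1 u.2 i).trans_le (min_le_left _ _)
      · refine hball p ?_
        rw [mem_ball_iff_norm]
        exact hnorm.trans_le (min_le_right _ _))
  have hlen : ∀ t ∈ Set.Icc (0 : ℝ) 1, ∀ e ∈ B, lens (γ t) e = lens p e := by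
    intro t ht e he
    have := congrFun (congrArg Prod.snd (hγ t ht).2.2) ⟨e, he⟩
    simpa [f] using this
  have hlen' : ∀ t ∈ Set.Icc (0 : ℝ) 1, ∀ u v, s(u, v) ∈ B → sqd (γ t) u v = sqd p u v :=
    fun t ht u v h => hlen t ht s(u, v) h
  have hcons : ∀ u v, s(u, v) ∈ E₀ → ∀ t ∈ Set.Icc (0 : ℝ) 1, sqd (γ t) u v = sqd (γ 0) u v := by
    intro u v huv
    have hd : ∀ t ∈ Set.Icc (0 : ℝ) 1, ∀ a b, 
        HasDerivAt (fun s => sqd (γ s) a b) (2 * bil (γ t) (deriv γ t) a b) t :=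
      fun t ht a b => hasDerivAt_sqd (hγ t ht).2.1 a b
    refine constant_of_derivWithin_zero
      (fun t ht => (hd t ht u v).differentiableAt.differentiableWithinAt) fun t ht => ?_
    have ht' := Set.Ico_subset_Icc_self ht
    have hud : UniqueDiffWithinAt ℝ (Set.Icc (0 : ℝ) 1) t :=
      uniqueDiffOn_Icc zero_lt_one t ht'
    rw [(hd t ht' u v).hasDerivWithinAt.derivWithin hud]
    have hm : deriv γ t ∈ Mot (γ t) B := by
      intro a b hab
      have e1 := (hd t ht' a b).hasDerivWithinAt.derivWithin hud
      have e2 : derivWithin (fun s => sqd (γ s) a b) (Set.Icc (0 : ℝ) 1) t = 0 := by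
        rw [derivWithin_congr (f := fun _ => sqd p a b) (fun s hs => hlen' s hs a b hab)
          (hlen' t ht' a b hab)]
        simp
      linarith
    rw [(hγ t ht').1.1 s(u, v) huv u v rfl _ hm, mul_zero]
  have h1 : (1 : ℝ) ∈ Set.Icc (0 : ℝ) 1 := ⟨zero_le_one, le_rfl⟩
  refine ⟨γ 1, fun u hu => ?_, fun u i => ?_, fun u v huv => ?_⟩
  · have := congrFun (congrArg Prod.fst (hγ 1 h1).2.2) ⟨u, hu⟩
    simpa [f] using this
  · have := (hγ 1 h1).1.2
    rw [mem_ball_iff_norm, pi_norm_lt_iff hε] at this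
    exact (pi_norm_lt_iff hε).mp (this u) i
  · rw [hcons u v huv 1 h1, h0]

/-- Linkedness in an independent set spreads from a generic placement to a neighbourhood of any
placement where the set is independent. -/
theorem eventually_lk {p p₀ : Pl V} (hp : Generic p) {B : Set (Sym2 V)} (hB : Indep p₀ B)
    {u v : V} (h : Lk p B u v) : ∀ᶠ q in 𝓝 p₀, Lk q B u v := by
  classical
  have hdet : Continuous fun q : Pl V => (gram q ∅ B).det := by
    refine Continuous.matrix_det ?_
    refine continuous_matrix fun e f => ?_
    have hc : ∀ (e : Sym2 V) (u : V) (i : Fin 2), Continuous fun q : Pl V => coefE q e u i := by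
      intro e u i
      induction e with
      | _ a b =>
        have ha : ∀ (w : V) (j : Fin 2), Continuous fun q : Pl V => q w j :=
          fun w j => continuous_apply_apply w j
        refine Continuous.add ?_ ?_ <;> split_ifs
        · exact (ha a i).sub (ha b i)
        · exact continuous_const
        · exact (ha b i).sub (ha a i)
        · exact continuous_const
    have hc' : ∀ (e : Sym2 V) (u : V) (i : Fin 2), Continuous fun q : Pl V =>
        if e ∈ B ∧ u ∉ (∅ : Set V) then coefE q e u i else 0 := by
      intro e u i
      split_ifs
      · exact hc e u i
      · exact continuous_const
    unfold gram
    refine Continuous.add (continuous_finsetSum _ fun u _ => continuous_finsetSum _ fun i _ =>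
      ?_) continuous_const
    refine ((hc' e u i).mul (hc' f u i)).congr fun q => ?_
    simp only [Pi.mul_apply]
    congr
  filter_upwards [hdet.continuousAt.eventually_ne ((pinIndep_iff_det p₀ ∅ B).mp hB)] with q hq
  by_contra hl
  have hq' : PinIndep q ∅ B := (pinIndep_iff_det q ∅ B).mpr hq
  have hn : ¬ PLk q ∅ B u v := fun h => hl (lk_of_PLk h)
  by_cases huv : s(u, v) ∈ B
  · exact hl (Lk.of_mem huv)
  · exact Indep.not_lk (PinIndep.generic hp (hq'.insert_of_not_PLk hn)) huv h

end Flex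

section Menger

/-- The orbit of `a` under a map `σ : A ⊕ V → V ⊕ B`, halted on reaching `B`. -/
def orbitSeq {A B : Type*} (σ : A ⊕ V → V ⊕ B) (a : A) : ℕ → V ⊕ B
  | 0 => σ (Sum.inl a)
  | n + 1 => match orbitSeq σ a n with
    | Sum.inl w => σ (Sum.inr w)
    | Sum.inr b => Sum.inr b

theorem orbitSeq_succ_eq_inl {A B : Type*} {σ : A ⊕ V → V ⊕ B} {a : A} {n : ℕ} {w : V}
    (h : orbitSeq σ a (n + 1) = Sum.inl w) :
    ∃ u, orbitSeq σ a n = Sum.inl u ∧ σ (Sum.inr u) = Sum.inl w := by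
  rw [orbitSeq] at h
  cases hu : orbitSeq σ a n with
  | inl u => exact ⟨u, rfl, by simpa [hu] using h⟩
  | inr b => simp [hu] at h

theorem orbitSeq_injective {A B : Type*} {σ : A ⊕ V → V ⊕ B} (hσ : Function.Injective σ) {w : V} :
    ∀ {m n : ℕ} {a a' : A}, orbitSeq σ a m = Sum.inl w → orbitSeq σ a' n = Sum.inl w →
      a = a' ∧ m = n := by
  intro m
  induction m generalizing w with
  | zero =>
    intro n a a' h h'
    cases n with
    | zero => exact ⟨Sum.inl_injective (hσ (h.trans h'.symm)), rfl⟩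
    | succ n =>
      obtain ⟨u, -, hu⟩ := orbitSeq_succ_eq_inl h'
      exact absurd (hσ (h.trans hu.symm)) (by simp)
  | succ m ih =>
    intro n a a' h h'
    obtain ⟨u, hu1, hu⟩ := orbitSeq_succ_eq_inl h
    cases n with
    | zero => exact absurd (hσ (hu.trans h'.symm)) (by simp)
    | succ n =>
      obtain ⟨u', hu1', hu'⟩ := orbitSeq_succ_eq_inl h'
      have := Sum.inr_injective (hσ (hu.trans hu'.symm))
      subst this
      obtain ⟨h1, h2⟩ := ih hu1 hu1'
      exact ⟨h1, by rw [h2]⟩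

theorem exists_orbitSeq_eq_inr [Finite V] {A B : Type*} {σ : A ⊕ V → V ⊕ B}
    (hσ : Function.Injective σ) (a : A) : ∃ n b, orbitSeq σ a n = Sum.inr b := by
  by_contra! h
  have h' : ∀ n, ∃ w, orbitSeq σ a n = Sum.inl w := by
    intro n
    cases hn : orbitSeq σ a n with
    | inl w => exact ⟨w, rfl⟩
    | inr b => exact absurd hn (h n b)
  choose f hf using h'
  exact not_injective_infinite_finite f fun m n hmn =>
    (orbitSeq_injective hσ (hf m) (hmn ▸ hf n)).2

variable {H : SimpleGraph V} {v b : V}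

/-- The admissible successors used to derive the Menger theorem from the Hall marriage theorem. -/
def LinkRel (H : SimpleGraph V) (v b : V) (k : ℕ) : Fin k ⊕ V → V ⊕ Fin k → Prop
  | Sum.inl _, Sum.inl w => w ≠ v ∧ w ≠ b ∧ H.Adj v w
  | Sum.inl _, Sum.inr _ => False
  | Sum.inr u, Sum.inl w => u = w ∨ (w ≠ v ∧ w ≠ b ∧ H.Adj u w)
  | Sum.inr u, Sum.inr _ => H.Adj u b

theorem exists_injective_linkRel [Fintype V] (hvb' : v ≠ b) (hvb : ¬ H.Adj v b) {k : ℕ}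
    (hcut : ∀ U : Set V, v ∈ U → b ∉ U → (∀ u ∈ U, ¬ H.Adj u b) →
      k ≤ {w | w ∉ U ∧ ∃ u ∈ U, H.Adj u w}.ncard) :
    ∃ σ : Fin k ⊕ V → V ⊕ Fin k, Function.Injective σ ∧ ∀ x, LinkRel H v b k x (σ x) := by
  classical
  rw [← Fintype.all_card_le_filter_rel_iff_exists_injective]
  intro S
  by_cases hS : ∃ i, Sum.inl i ∈ S
  swap
  · push Not at hS
    refine Finset.card_le_card_of_injOn (Sum.elim Sum.inr Sum.inl) ?_ ?_
    · rintro (i | u) hu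
      · exact absurd hu (hS i)
      · simp only [Finset.coe_filter, Finset.mem_univ, true_and]
        exact ⟨Sum.inr u, hu, Or.inl rfl⟩
    · rintro (i | u) hu (j | w) hw h
      · exact absurd hu (hS i)
      · exact absurd hu (hS i)
      · exact absurd hw (hS j)
      · simpa using h
  obtain ⟨i, hi⟩ := hS
  set S₂ : Finset V := Finset.univ.filter fun u => Sum.inr u ∈ S with hS₂
  have hcard : S.card ≤ k + S₂.card := by
    have h : S ⊆ (Finset.univ : Finset (Fin k)).disjSum S₂ := by
      rintro (j | u) hu
      · simp
      · simpa [hS₂] using hu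
    have := Finset.card_le_card h
    rwa [Finset.card_disjSum, Finset.card_univ, Fintype.card_fin] at this
  refine hcard.trans ?_
  by_cases hb : ∃ u ∈ S₂, H.Adj u b
  · obtain ⟨u, hu, hub⟩ := hb
    have h : S₂.disjSum (Finset.univ : Finset (Fin k)) ⊆
        Finset.univ.filter fun y => ∃ x ∈ S, LinkRel H v b k x y := by
      rintro (w | j) hw
      · simp only [Finset.mem_filter, Finset.mem_univ, true_and]
        exact ⟨Sum.inr w, by simpa [hS₂] using hw, Or.inl rfl⟩
      · simp only [Finset.mem_filter, Finset.mem_univ, true_and]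
        exact ⟨Sum.inr u, by simpa [hS₂] using hu, hub⟩
    have := Finset.card_le_card h
    rw [Finset.card_disjSum, Finset.card_univ, Fintype.card_fin] at this
    omega
  · push Not at hb
    set U : Set V := {u | u = v ∨ (u ∈ S₂ ∧ u ≠ b)} with hU
    have hUb : ∀ u ∈ U, ¬ H.Adj u b := by
      rintro u (rfl | ⟨hu, -⟩)
      · exact hvb
      · exact hb u hu
    have hT := hcut U (Or.inl rfl) (by rintro (h | h); exacts [hvb' h.symm, h.2 rfl]) hUb
    set T : Finset V := Finset.univ.filter fun w => w ∉ U ∧ ∃ u ∈ U, H.Adj u w with hTdef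
    have hT' : {w | w ∉ U ∧ ∃ u ∈ U, H.Adj u w} = (T : Set V) := by ext; simp [hTdef]
    rw [hT', Set.ncard_coe_finset] at hT
    have hTb : ∀ w ∈ T, w ≠ b := by
      rintro w hw rfl
      obtain ⟨-, u, hu, huw⟩ := (Finset.mem_filter.mp hw).2
      exact hUb u hu huw
    have hdisj : Disjoint T S₂ := by
      rw [Finset.disjoint_left]
      intro w hw hw2
      exact (Finset.mem_filter.mp hw).2.1 (Or.inr ⟨hw2, hTb w hw⟩)
    have h : (T ∪ S₂).map Function.Embedding.inl ⊆
        Finset.univ.filter fun y => ∃ x ∈ S, LinkRel H v b k x y := by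
      intro y hy
      obtain ⟨w, hw, rfl⟩ := Finset.mem_map.mp hy
      simp only [Finset.mem_filter, Finset.mem_univ, true_and]
      rcases Finset.mem_union.mp hw with hw | hw
      · obtain ⟨hwU, u, hu, huw⟩ := (Finset.mem_filter.mp hw).2
        have hwv : w ≠ v := fun h => hwU (Or.inl h)
        rcases hu with rfl | ⟨hu, -⟩
        · exact ⟨Sum.inl i, hi, hwv, hTb w hw, huw⟩
        · exact ⟨Sum.inr u, by simpa [hS₂] using hu, Or.inr ⟨hwv, hTb w hw, huw⟩⟩
      · exact ⟨Sum.inr w, by simpa [hS₂] using hw, Or.inl rfl⟩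
    have := Finset.card_le_card h
    rw [Finset.card_map, Finset.card_union_of_disjoint hdisj] at this
    omega

theorem exists_walk_of_orbitSeq {k : ℕ} {σ : Fin k ⊕ V → V ⊕ Fin k} (hσ : Function.Injective σ)
    (hr : ∀ x, LinkRel H v b k x (σ x)) (a : Fin k) :
    ∀ n w, orbitSeq σ a n = Sum.inl w → w ≠ v ∧ w ≠ b ∧ ∃ p : H.Walk v w, p.IsPath ∧
      ∀ x ∈ p.support, x = v ∨ ∃ m ≤ n, orbitSeq σ a m = Sum.inl x := by
  intro n
  induction n with
  | zero =>
    intro w hw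
    have h := hr (Sum.inl a)
    rw [show σ (Sum.inl a) = Sum.inl w from hw] at h
    obtain ⟨h1, h2, h3⟩ := h
    refine ⟨h1, h2, h3.toWalk, ?_, ?_⟩
    · simp [SimpleGraph.Adj.toWalk, SimpleGraph.Walk.cons_isPath_iff, h1.symm]
    · intro x hx
      simp [SimpleGraph.Adj.toWalk] at hx
      rcases hx with rfl | rfl
      · exact Or.inl rfl
      · exact Or.inr ⟨0, le_rfl, hw⟩
  | succ n ih =>
    intro w hw
    obtain ⟨u, hu, huw⟩ := orbitSeq_succ_eq_inl hw
    obtain ⟨hu1, hu2, p, hp, hps⟩ := ih u hu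
    have h := hr (Sum.inr u)
    rw [huw] at h
    obtain h | ⟨h1, h2, h3⟩ := h
    · subst h
      exact absurd (orbitSeq_injective hσ hu hw).2 (by omega)
    · refine ⟨h1, h2, p.concat h3, hp.concat ?_ h3, ?_⟩
      · intro hx
        rcases hps w hx with hx | ⟨m, hm, hx⟩
        · exact h1 hx
        · exact absurd (orbitSeq_injective hσ hx hw).2 (by omega)
      · intro x hx
        rw [SimpleGraph.Walk.support_concat, List.mem_append] at hx
        rcases hx with hx | hx
        · rcases hps x hx with hx | ⟨m, hm, hx⟩
          · exact Or.inl hx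
          · exact Or.inr ⟨m, by omega, hx⟩
        · rw [List.mem_singleton] at hx
          exact Or.inr ⟨n + 1, le_rfl, hx ▸ hw⟩

/-- The Menger theorem for a pair of non-adjacent vertices. -/
theorem internallyDisjointPaths_of_cut [Fintype V] (hvb' : v ≠ b) (hvb : ¬ H.Adj v b) {k : ℕ}
    (hcut : ∀ U : Set V, v ∈ U → b ∉ U → (∀ u ∈ U, ¬ H.Adj u b) →
      k ≤ {w | w ∉ U ∧ ∃ u ∈ U, H.Adj u w}.ncard) : InternallyDisjointPaths H v b k := by
  obtain ⟨σ, hσ, hr⟩ := exists_injective_linkRel hvb' hvb hcut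
  have key : ∀ a : Fin k, ∃ p : H.Walk v b, p.IsPath ∧
      ∀ x ∈ p.support, x = v ∨ x = b ∨ ∃ m, orbitSeq σ a m = Sum.inl x := by
    intro a
    classical
    have hex := exists_orbitSeq_eq_inr hσ a
    obtain ⟨j, hj⟩ := Nat.find_spec hex
    have hmin := fun m => Nat.find_min (H := hex) (m := m)
    generalize Nat.find hex = N at hj hmin
    cases N with
    | zero =>
      have h := hr (Sum.inl a)
      rw [show σ (Sum.inl a) = Sum.inr j from hj] at h
      exact h.elim
    | succ n =>
      cases hw : orbitSeq σ a n with
      | inr j' => exact absurd ⟨j', hw⟩ (hmin n (Nat.lt_succ_self n))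
      | inl w =>
        obtain ⟨h1, h2, p, hp, hps⟩ := exists_walk_of_orbitSeq hσ hr a n w hw
        have h := hr (Sum.inr w)
        rw [show σ (Sum.inr w) = Sum.inr j by simpa [orbitSeq, hw] using hj] at h
        replace h : H.Adj w b := h
        refine ⟨p.concat h, hp.concat ?_ h, ?_⟩
        · intro hx
          rcases hps b hx with hx | ⟨m, -, hx⟩
          · exact hvb' hx.symm
          · exact (exists_walk_of_orbitSeq hσ hr a m b hx).2.1 rfl
        · intro x hx
          rw [SimpleGraph.Walk.support_concat, List.mem_append] at hx
          rcases hx with hx | hx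
          · rcases hps x hx with hx | ⟨m, -, hx⟩
            · exact Or.inl hx
            · exact Or.inr (Or.inr ⟨m, hx⟩)
          · exact Or.inr (Or.inl (List.mem_singleton.mp hx))
  choose p hp hps using key
  refine ⟨p, hp, fun i j hij w hi hj => ?_⟩
  rcases hps i w hi with h | h | ⟨m, h⟩
  · exact Or.inl h
  · exact Or.inr h
  rcases hps j w hj with h' | h' | ⟨m', h'⟩
  · exact Or.inl h'
  · exact Or.inr h'
  · exact absurd (orbitSeq_injective hσ h h').1 hij

end Menger

section Pinning

open Topology

variable [Fintype V] [DecidableEq V]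

theorem PinIndep.of_separator {p : Pl V} {E H B : Set (Sym2 V)} {X : Set V} (hHE : H ⊆ E)
    (hs : IsSeparator p E H) (hr : RigidOn p H X) (hBE : B ⊆ E \ H) (hB : Indep p B) :
    PinIndep p X B := by
  intro ω hω hωB
  obtain ⟨τ, hτ, hτω⟩ := exists_stress_of_pinned hr hω hωB
  have hτE : τ ∈ stressOn p E :=
    stressOn_mono (Set.union_subset (fun e he => (hBE he).1) hHE) hτ
  have h1 : (E \ H).indicator τ = ω := by
    funext e
    by_cases he : e ∈ E \ H
    · rw [Set.indicator_of_mem he, hτω e he.2]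
    · rw [Set.indicator_of_notMem he, hωB e fun h => he (hBE h)]
  have h2 := hs.compl τ hτE
  rw [h1] at h2
  exact indep_iff.mp hB ω ⟨h2.1, hωB⟩

/-- A generic placement near a flattened one, and an equivalent realisation of the edges outside
the pinned part whose pinned vertices are moved by a prescribed continuous map. -/
theorem exists_generic_flex {p : Pl V} (hp : Generic p) {E H : Set (Sym2 V)} {X : Set V}
    (hHE : H ⊆ E) (hs : IsSeparator p E H) (hr : RigidOn p H X) {r : Pl V → Pl V}
    (hc : ∀ u ∈ X, ∀ i, ContinuousAt (fun p' => r p' u i) (flat X p))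
    (h0 : ∀ u ∈ X, r (flat X p) u = flat X p u) {ε : ℝ} (hε : 0 < ε) :
    ∃ p' q : Pl V, Generic p' ∧ (∀ u i, |p' u i - flat X p u i| < ε) ∧
      (∀ u i, |q u i - flat X p u i| < ε) ∧ (∀ u ∈ X, q u = r p' u) ∧ LenEq (E \ H) p' q := by
  obtain ⟨B, hBE, hB, hBs⟩ := exists_pinIndep_basis p ∅ (E \ H)
  have hB0 : PinIndep (flat X p) X B := (PinIndep.of_separator hHE hs hr hBE hB).flat hp
  have hB0' : Indep (flat X p) B := fun ω hω hωB => hB0 ω (fun u _ i => hω u (by simp) i) hωB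
  obtain ⟨δ, hδ, hflex⟩ := exists_flex (E₀ := E \ H) hB0
    (fun u v huv => eventually_lk hp hB0' (lk_of_PLk (hBs u v huv))) hε
  have hev : ∀ᶠ p' in 𝓝 (flat X p), ∀ u, ∀ i, u ∈ X → |r p' u i - flat X p u i| < δ := by
    rw [Filter.eventually_all]
    intro u
    rw [Filter.eventually_all]
    intro i
    by_cases hu : u ∈ X
    · have h1 : ContinuousAt (fun p' => |r p' u i - flat X p u i|) (flat X p) :=
        ((hc u hu i).sub continuousAt_const).abs
      refine (h1.eventually_lt_const ?_).mono fun p' h _ => h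
      simpa [h0 u hu] using hδ
    · exact Filter.Eventually.of_forall fun _ h => absurd h hu
  obtain ⟨η, hη, hball⟩ := Metric.eventually_nhds_iff_ball.mp hev
  have hm : 0 < min ε (min δ η) := lt_min hε (lt_min hδ hη)
  obtain ⟨p', hp', hnear⟩ := exists_generic_near (flat X p) hm
  have hb : p' ∈ Metric.ball (flat X p) η := by
    rw [mem_ball_iff_norm, pi_norm_lt_iff hη]
    refine fun u => (pi_norm_lt_iff hη).mpr fun i => ?_
    exact (hnear u i).trans_le ((min_le_right _ _).trans (min_le_right _ _))
  obtain ⟨q, hqX, hqε, hq⟩ := hflex p' (r p')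
    (fun u i => (hnear u i).trans_le ((min_le_right _ _).trans (min_le_left _ _)))
    (fun u hu i => hball p' hb u i hu)
  exact ⟨p', q, hp', fun u i => (hnear u i).trans_le (min_le_left _ _), hqε, hqX, hq⟩

/-- Reflection in the first axis. -/
def axisRefl (p : Pl V) : Pl V := fun u i => if i = 1 then -p u i else p u i

theorem sqd_axisRefl (p : Pl V) (u v : V) : sqd (axisRefl p) u v = sqd p u v := by
  simp [sqd, axisRefl]
  ring

theorem UniquelyLocalizable.eq_of_lenEq {G : SimpleGraph V} {P : Set V} {v : V}
    (h : UniquelyLocalizable G P v) {p q : Pl V} (hp : Generic p)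
    (hq : LenEq G.edgeSet p q) (hqP : ∀ b ∈ P, q b = p b) : q v = p v :=
  h p hp q (fun a b hab => (eDist_eq_iff p q a b).mpr (hq a b hab).symm) hqP

/-- A vertex outside the rigid part containing `P` is not uniquely localizable. -/
theorem UniquelyLocalizable.mem_vertexSpan {G : SimpleGraph V} {P : Set V} {v : V}
    (h : UniquelyLocalizable G P v) {p : Pl V} (hp : Generic p) {E H : Set (Sym2 V)}
    (hHE : H ⊆ E) (hGE : G.edgeSet ⊆ E) (hs : IsSeparator p E H)
    (hr : RigidOn p H (vertexSpan H)) (hP : P ⊆ vertexSpan H) : v ∈ vertexSpan H := by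
  by_contra hv
  have hv0 : p v 1 ≠ 0 := hp.ne_zero (v, 1)
  have hfv : flat (vertexSpan H) p v 1 = p v 1 := by simp [flat, hv]
  obtain ⟨p', q, hp', hn, hqn, hqX, hq⟩ := exists_generic_flex hp hHE hs hr (r := axisRefl)
    (fun u _ i => by
      have h1 : Continuous fun p' : Pl V => p' u i := continuous_apply_apply u i
      unfold axisRefl
      split_ifs
      · exact h1.neg.continuousAt
      · exact h1.continuousAt)
    (fun u hu => by
      funext i
      fin_cases i <;> simp [axisRefl, flat, hu]) (half_pos (abs_pos.mpr hv0))
  have hX : ∀ u ∈ vertexSpan H, axisRefl q u = p' u := by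
    intro u hu
    funext i
    fin_cases i <;> simp [axisRefl, hqX u hu]
  have hlen : LenEq G.edgeSet p' (axisRefl q) := by
    intro a b hab
    by_cases hH : s(a, b) ∈ H
    · simp only [sqd, hX a (left_mem_vertexSpan hH), hX b (right_mem_vertexSpan hH)]
    · rw [sqd_axisRefl]
      exact hq a b ⟨hGE hab, hH⟩
  have h1 := congrFun (h.eq_of_lenEq hp' hlen fun b hb => hX b (hP hb)) 1
  have h2 := hn v 1
  have h3 := hqn v 1
  rw [hfv] at h2 h3
  simp only [axisRefl, if_true] at h1
  rw [← h1] at h2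
  rw [abs_lt] at h2 h3
  rcases abs_cases (p v 1) with ⟨h4, -⟩ | ⟨h4, -⟩ <;> rw [h4] at h2 h3 <;> linarith [h2.1, h2.2, h3.1, h3.2]

/-- Reflection of the point `z` in the line through `a` and `b`. -/
def lineRefl (a b z : Fin 2 → ℝ) : Fin 2 → ℝ :=
  let c := 2 * ((b 0 - a 0) * (z 1 - a 1) - (b 1 - a 1) * (z 0 - a 0)) /
    ((b 0 - a 0) ^ 2 + (b 1 - a 1) ^ 2)
  ![z 0 + c * (b 1 - a 1), z 1 - c * (b 0 - a 0)]

theorem sqd_lineRefl {a b : Fin 2 → ℝ} (h : (b 0 - a 0) ^ 2 + (b 1 - a 1) ^ 2 ≠ 0)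
    (z w : Fin 2 → ℝ) :
    (lineRefl a b z 0 - lineRefl a b w 0) ^ 2 + (lineRefl a b z 1 - lineRefl a b w 1) ^ 2 =
      (z 0 - w 0) ^ 2 + (z 1 - w 1) ^ 2 := by
  simp only [lineRefl, Matrix.cons_val_zero, Matrix.cons_val_one]
  field_simp
  ring

theorem lineRefl_left (a b : Fin 2 → ℝ) : lineRefl a b a = a := by
  funext i
  fin_cases i <;> simp [lineRefl]

theorem lineRefl_right (a b : Fin 2 → ℝ) : lineRefl a b b = b := by
  funext i
  fin_cases i <;> simp [lineRefl] <;> ring_nf <;> simp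

theorem lineRefl_ne {a b z : Fin 2 → ℝ} (h : (b 0 - a 0) ^ 2 + (b 1 - a 1) ^ 2 ≠ 0)
    (hz : (b 0 - a 0) * (z 1 - a 1) - (b 1 - a 1) * (z 0 - a 0) ≠ 0) : lineRefl a b z ≠ z := by
  intro h1
  have e0 := congrFun h1 0
  have e1 := congrFun h1 1
  simp only [lineRefl, Matrix.cons_val_zero, Matrix.cons_val_one] at e0 e1
  have hc := div_ne_zero (mul_ne_zero two_ne_zero hz) h
  have d1 := (mul_eq_zero.mp (add_eq_left.mp e0)).resolve_left hc
  have d0 := (mul_eq_zero.mp (sub_eq_self.mp e1)).resolve_left hc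
  exact h (by rw [d0, d1]; norm_num)

theorem UniquelyLocalizable.three_le_ncard {G : SimpleGraph V} {P : Set V} {v : V}
    (h : UniquelyLocalizable G P v) (hv : v ∉ P) : 3 ≤ P.ncard := by
  obtain ⟨p, hp, -⟩ := exists_generic_near (0 : Pl V) one_pos
  have key : ∀ a b : Fin 2 → ℝ, (b 0 - a 0) * (p v 1 - a 1) - (b 1 - a 1) * (p v 0 - a 0) ≠ 0 →
      (∀ c ∈ P, lineRefl a b (p c) = p c) → False := by
    intro a b hA hP
    have hden : (b 0 - a 0) ^ 2 + (b 1 - a 1) ^ 2 ≠ 0 := by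
      intro h0
      have h1 : b 0 - a 0 = 0 := by nlinarith [sq_nonneg (b 0 - a 0), sq_nonneg (b 1 - a 1)]
      have h2 : b 1 - a 1 = 0 := by nlinarith [sq_nonneg (b 0 - a 0), sq_nonneg (b 1 - a 1)]
      exact hA (by rw [h1, h2]; ring)
    exact lineRefl_ne hden hA (h.eq_of_lenEq hp (q := fun u => lineRefl a b (p u))
      (fun u w _ => sqd_lineRefl hden _ _) hP)
  by_contra hlt
  have h3 : P.ncard = 0 ∨ P.ncard = 1 ∨ P.ncard = 2 := by omega
  rcases h3 with h0 | h1 | h2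
  · rw [Set.ncard_eq_zero] at h0
    subst h0
    exact key ![p v 0 + 1, p v 1] ![p v 0 + 1, p v 1 + 1] (by simp) (by simp)
  · obtain ⟨a, rfl⟩ := Set.ncard_eq_one.mp h1
    have hav : v ≠ a := hv
    refine key (p a) ![p a 0 - (p v 1 - p a 1), p a 1 + (p v 0 - p a 0)] ?_ ?_
    · have := sq_pos_of_ne_zero (sub_ne_zero.mpr (hp.genPos.1 v a hav))
      simp only [Matrix.cons_val_zero, Matrix.cons_val_one]
      nlinarith [sq_nonneg (p v 1 - p a 1)]
    · rintro c rfl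
      exact lineRefl_left _ _
  · obtain ⟨a, b, hab, rfl⟩ := Set.ncard_eq_two.mp h2
    have hav : a ≠ v := fun e => hv (Or.inl e.symm)
    have hbv : b ≠ v := fun e => hv (Or.inr e.symm)
    refine key (p a) (p b) (hp.genPos.2 a b v hab hbv hav) ?_
    rintro c (rfl | rfl)
    · exact lineRefl_left _ _
    · exact lineRefl_right _ _

/-- A vertex separated from some anchor by a pair is not uniquely localizable. -/
theorem UniquelyLocalizable.unSep {G : SimpleGraph V} {P : Set V} {v : V}
    (h : UniquelyLocalizable G P v) {p : Pl V} (hp : Generic p) {E H : Set (Sym2 V)}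
    (hHE : H ⊆ E) (hGE : G.edgeSet ⊆ E) (hs : IsSeparator p E H)
    (hr : RigidOn p H (vertexSpan H)) (hP : P ⊆ vertexSpan H) (hK : KK P ⊆ H) {x y : V}
    (hxy : x ≠ y) (hx : x ∈ vertexSpan H) (hy : y ∈ vertexSpan H) {U W : Set V}
    (hS : Sep H x y U W) (hv : v ∈ U) : ∀ b ∈ P, b ∉ W := by
  intro b hb hbW
  classical
  have hPU : ∀ a ∈ P, a ∉ U := fun a ha haU =>
    hS.no_edge a haU b hbW (hK (mem_KK.mpr ⟨fun e => hS.disj a haU (e ▸ hbW), ha, hb⟩))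
  let r : Pl V → Pl V := fun p' u => if u ∈ U then lineRefl (p' x) (p' y) (p' u) else p' u
  have hne : flat (vertexSpan H) p y 0 - flat (vertexSpan H) p x 0 ≠ 0 := by
    simpa [flat, sub_eq_zero] using hp.genPos.1 y x hxy.symm
  obtain ⟨p', q, hp', -, -, hqX, hq⟩ := exists_generic_flex hp hHE hs hr (r := r)
    (fun u _ i => by
      have h1 : ∀ (w : V) (j : Fin 2), ContinuousAt (fun p' : Pl V => p' w j)
          (flat (vertexSpan H) p) := fun w j => (continuous_apply_apply w j).continuousAt
      by_cases hu : u ∈ U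
      · simp only [r, if_pos hu, lineRefl]
        have hden : (flat (vertexSpan H) p y 0 - flat (vertexSpan H) p x 0) ^ 2 +
            (flat (vertexSpan H) p y 1 - flat (vertexSpan H) p x 1) ^ 2 ≠ 0 := by
          have := sq_pos_of_ne_zero hne
          positivity
        have hcc := ((continuousAt_const (y := (2 : ℝ))).mul ((((h1 y 0).sub (h1 x 0)).mul
          ((h1 u 1).sub (h1 x 1))).sub (((h1 y 1).sub (h1 x 1)).mul
          ((h1 u 0).sub (h1 x 0))))).div
          ((((h1 y 0).sub (h1 x 0)).pow 2).add (((h1 y 1).sub (h1 x 1)).pow 2)) hden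
        fin_cases i
        · exact (h1 u 0).add (hcc.mul ((h1 y 1).sub (h1 x 1)))
        · exact (h1 u 1).sub (hcc.mul ((h1 y 0).sub (h1 x 0)))
      · simp only [r, if_neg hu]
        exact h1 u i)
    (fun u hu => by
      by_cases huU : u ∈ U
      · simp only [r, if_pos huU, lineRefl]
        funext i
        fin_cases i <;> simp [flat, hu, hx, hy]
      · simp only [r, if_neg huU]) one_pos
  have hden' : (p' y 0 - p' x 0) ^ 2 + (p' y 1 - p' x 1) ^ 2 ≠ 0 := by
    have := sq_pos_of_ne_zero (sub_ne_zero.mpr (hp'.genPos.1 y x hxy.symm))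
    positivity
  have hUX : ∀ u ∈ U, q u = lineRefl (p' x) (p' y) (p' u) := by
    intro u hu
    rw [hqX u (hS.sub_left hu)]
    simp [r, hu]
  have hfix : ∀ u ∈ vertexSpan H, u ∉ U → q u = p' u := by
    intro u hu huU
    rw [hqX u hu]
    simp [r, huU]
  have hmir : ∀ u, u = x ∨ u = y ∨ u ∈ U → q u = lineRefl (p' x) (p' y) (p' u) := by
    rintro u (rfl | rfl | hu)
    · rw [hfix _ hx hS.x_left, lineRefl_left]
    · rw [hfix _ hy hS.y_left, lineRefl_right]
    · exact hUX u hu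
  have hside : ∀ u w, s(u, w) ∈ H → u ∈ U → sqd q u w = sqd p' u w := by
    intro u w huw hu
    have hw : w = x ∨ w = y ∨ w ∈ U := by
      rcases hS.cover w (right_mem_vertexSpan huw) with hw | hw | hw | hw
      · exact Or.inl hw
      · exact Or.inr (Or.inl hw)
      · exact Or.inr (Or.inr hw)
      · exact absurd huw (hS.no_edge u hu w hw)
    simp only [sqd, hmir u (Or.inr (Or.inr hu)), hmir w hw]
    exact sqd_lineRefl hden' _ _
  have hlen : LenEq G.edgeSet p' q := by
    intro u w huw
    by_cases hH : s(u, w) ∈ H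
    · by_cases hu : u ∈ U
      · exact hside u w hH hu
      by_cases hw : w ∈ U
      · rw [sqd_comm q, sqd_comm p']
        exact hside w u (Sym2.eq_swap ▸ hH) hw
      · simp only [sqd, hfix u (left_mem_vertexSpan hH) hu, hfix w (right_mem_vertexSpan hH) hw]
    · exact hq u w ⟨hGE huw, hH⟩
  have h1 := h.eq_of_lenEq hp' hlen fun a ha => hfix a (hP ha) (hPU a ha)
  rw [hUX v hv] at h1
  have hA := hp'.genPos.2 x y v hxy (fun e => hS.y_left (e ▸ hv)) (fun e => hS.x_left (e ▸ hv))
  exact lineRefl_ne hden' hA h1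

end Pinning

section Necessity

variable [Fintype V] [DecidableEq V]

theorem IsSeparator.union {p : Pl V} {E A B : Set (Sym2 V)} (hA : IsSeparator p E A)
    (hB : IsSeparator p E B) : IsSeparator p E (A ∪ B) := by
  intro ω hω
  have h1 := hA ω hω
  have h2 : (A ∪ B).indicator ω = A.indicator ω + B.indicator (ω - A.indicator ω) := by
    funext e
    by_cases hA' : e ∈ A <;> by_cases hB' : e ∈ B <;> simp [hA', hB']
  rw [h2]
  exact Submodule.add_mem _ h1 (hB _ (Submodule.sub_mem _ hω h1))

/-- The union of the classes of the edges in `D`. -/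
def classUnion (p : Pl V) (E D : Set (Sym2 V)) : Set (Sym2 V) :=
  {f | ∃ g ∈ D, f ∈ elemClass (stressOn p E) g}

theorem isSeparator_classUnion (p : Pl V) (E D : Set (Sym2 V)) :
    IsSeparator p E (classUnion p E D) := by
  induction D, Set.toFinite D using Set.Finite.induction_on with
  | empty =>
    intro ω _
    have : (classUnion p E ∅).indicator ω = 0 := by
      funext e
      simp [classUnion]
    rw [this]
    exact Submodule.zero_mem _
  | @insert g D _ _ ih =>
    have : classUnion p E (insert g D) = elemClass (stressOn p E) g ∪ classUnion p E D := by
      ext f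
      simp [classUnion]
    rw [this]
    exact (isSeparator_elemClass p E g).union ih

theorem classUnion_subset {p : Pl V} {E D : Set (Sym2 V)} (hD : D ⊆ E) : classUnion p E D ⊆ E := by
  rintro f ⟨g, hg, hf⟩
  exact elemClass_stressOn_subset (hD hg) hf

theorem subset_classUnion (p : Pl V) (E D : Set (Sym2 V)) : D ⊆ classUnion p E D :=
  fun g hg => ⟨g, hg, Or.inl rfl⟩

theorem mem_vertexSpan_classUnion {p : Pl V} {E D : Set (Sym2 V)} {u : V} :
    u ∈ vertexSpan (classUnion p E D) ↔
      ∃ g ∈ D, u ∈ vertexSpan (elemClass (stressOn p E) g) :=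
  ⟨fun ⟨f, ⟨g, hg, hf⟩, hu⟩ => ⟨g, hg, f, hf, hu⟩, fun ⟨g, hg, f, hf, hu⟩ => ⟨f, ⟨g, hg, hf⟩, hu⟩⟩

theorem rigidOn_classUnion {p : Pl V} (hp : Generic p) {E : Set (Sym2 V)} (hl : Loopless E)
    {P : Set V} (hK : KK P ⊆ E) :
    RigidOn p (classUnion p E (KK P)) (vertexSpan (classUnion p E (KK P))) := by
  have hP : RigidOn p (classUnion p E (KK P)) P :=
    (rigidOn_KK hp.genPos P).mono (subset_classUnion p E _) subset_rfl
  have hg : ∀ g ∈ KK P, RigidOn p (classUnion p E (KK P))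
      (P ∪ vertexSpan (elemClass (stressOn p E) g)) := by
    intro g hg
    have h1 := (rigidOn_elemClass hp hl (hK hg)).mono (F' := classUnion p E (KK P))
      (fun f hf => ⟨g, hg, hf⟩) subset_rfl
    have hm : g ∈ elemClass (stressOn p E) g := Or.inl rfl
    induction g with
    | _ a b =>
      obtain ⟨hab, ha, hb⟩ := mem_KK.mp hg
      exact hP.union hp.genPos h1 hab ha (left_mem_vertexSpan hm) hb (right_mem_vertexSpan hm)
  refine rigidOn_of_lk hp.genPos fun x hx y hy => ?_
  obtain ⟨g, hgK, hxg⟩ := mem_vertexSpan_classUnion.mp hx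
  obtain ⟨g', hgK', hyg⟩ := mem_vertexSpan_classUnion.mp hy
  have hgK₂ := hgK
  induction g with
  | _ a b =>
    obtain ⟨hab, ha, hb⟩ := mem_KK.mp hgK₂
    exact ((hg _ hgK).union hp.genPos (hg _ hgK') hab (Or.inl ha) (Or.inl ha) (Or.inl hb)
      (Or.inl hb)).lk (Or.inl (Or.inr hxg)) (Or.inr (Or.inr hyg))

theorem elemClass_eq_of_two {p : Pl V} (hp : Generic p) {E : Set (Sym2 V)} (hl : Loopless E)
    {e f : Sym2 V} (he : e ∈ E) (hf : f ∈ E) {x y : V} (hxy : x ≠ y)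
    (hx : x ∈ vertexSpan (elemClass (stressOn p E) e))
    (hx' : x ∈ vertexSpan (elemClass (stressOn p E) f))
    (hy : y ∈ vertexSpan (elemClass (stressOn p E) e))
    (hy' : y ∈ vertexSpan (elemClass (stressOn p E) f)) :
    elemClass (stressOn p E) e = elemClass (stressOn p E) f :=
  elemClass_eq_of_lk hp.genPos he hf hxy ((rigidOn_elemClass hp hl he).lk hx hy)
    ((rigidOn_elemClass hp hl hf).lk hx' hy')

/-- In a complete graph on four vertices, an edge is in the same class as some edge at any given
vertex or at a fourth one. -/
theorem mem_vertexSpan_elemClass_of_K4 {p : Pl V} (hp : Generic p) {E : Set (Sym2 V)} {P : Set V}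
    (hK : KK P ⊆ E) {x y z d : V} (hx : x ∈ P) (hy : y ∈ P) (hz : z ∈ P) (hd : d ∈ P) (hxy : x ≠ y)
    (hxz : x ≠ z) (hyz : y ≠ z) (hdx : d ≠ x) (hdy : d ≠ y) (hdz : d ≠ z)
    (hzn : z ∉ vertexSpan (elemClass (stressOn p E) s(x, y))) :
    d ∈ vertexSpan (elemClass (stressOn p E) s(x, y)) := by
  set D : Set (Sym2 V) := KK {x, y, z, d} \ {s(x, y)} with hD
  have hsub : ({x, y, z, d} : Set V) ⊆ P := by
    rintro u (rfl | rfl | rfl | rfl) <;> assumption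
  have hDE : D ⊆ E := Set.sdiff_subset.trans ((KK_mono hsub).trans hK)
  have h1 : KK {z, d, x} ⊆ D := by
    intro f hf
    refine ⟨KK_mono ?_ hf, ?_⟩
    · rintro u (rfl | rfl | rfl) <;> simp
    · rintro rfl
      have := (mem_KK.mp hf).2.2
      simp [hyz, hdy.symm, hxy.symm] at this
  have h2 : KK {z, d, y} ⊆ D := by
    intro f hf
    refine ⟨KK_mono ?_ hf, ?_⟩
    · rintro u (rfl | rfl | rfl) <;> simp
    · rintro rfl
      have := (mem_KK.mp hf).2.1
      simp [hxz, hdx.symm, hxy] at this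
  have hr := ((rigidOn_KK hp.genPos _).mono h1 subset_rfl).union hp.genPos
    ((rigidOn_KK hp.genPos _).mono h2 subset_rfl) hdz.symm (by simp) (by simp) (by simp) (by simp)
  obtain ⟨f, hf, hff⟩ := exists_mem_elemClass_of_lk hp.genPos hDE hxy
    (hr.lk (x := x) (y := y) (by simp) (by simp)) (hK (mem_KK.mpr ⟨hxy, hx, hy⟩))
  rw [elemClass_eq_of_mem hff] at hzn ⊢
  have hm : f ∈ elemClass (stressOn p E) f := Or.inl rfl
  by_contra hdn
  refine hf.2 ?_
  have hfK := hf.1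
  induction f with
  | _ u w =>
    obtain ⟨huw, hu, hw⟩ := mem_KK.mp hfK
    have hu' := left_mem_vertexSpan hm
    have hw' := right_mem_vertexSpan hm
    rcases hu with rfl | rfl | rfl | rfl <;> rcases hw with rfl | rfl | rfl | rfl <;>
      first
        | exact absurd rfl huw
        | exact absurd hu' hzn
        | exact absurd hw' hzn
        | exact absurd hu' hdn
        | exact absurd hw' hdn
        | rfl
        | exact Sym2.eq_swap

theorem not_mem_vertexSpan_elemClass_of_corner {p : Pl V} (hp : Generic p) {E : Set (Sym2 V)}
    (hl : Loopless E) {P : Set V} (hK : KK P ⊆ E) {v : V} (hv : v ∉ P)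
    (hsep : ∀ x y U W, x ≠ y → x ∈ P → y ∈ P → Sep (classUnion p E (KK P)) x y U W → v ∈ U →
      ∀ b ∈ P, b ∉ W) {x y z : V} (hx : x ∈ P) (hy : y ∈ P) (hz : z ∈ P) (hxy : x ≠ y) (hxz : x ≠ z)
    (hyz : y ≠ z) (hP : P ⊆ {x, y, z}) (hzn : z ∉ vertexSpan (elemClass (stressOn p E) s(x, y))) :
    v ∉ vertexSpan (elemClass (stressOn p E) s(x, y)) := by
  intro hvC
  have hxyK : s(x, y) ∈ KK P := mem_KK.mpr ⟨hxy, hx, hy⟩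
  have hm : s(x, y) ∈ elemClass (stressOn p E) s(x, y) := Or.inl rfl
  have hvU : v ∈ vertexSpan (elemClass (stressOn p E) s(x, y)) \ {x, y} := by
    refine ⟨hvC, ?_⟩
    rintro (rfl | rfl)
    exacts [hv hx, hv hy]
  have hzH : z ∈ vertexSpan (classUnion p E (KK P)) :=
    left_mem_vertexSpan (subset_classUnion p E _ (mem_KK.mpr ⟨hxz.symm, hz, hx⟩))
  refine hsep x y _ _ hxy hx hy (Sep.of_no_edge (U := vertexSpan (elemClass (stressOn p E) s(x, y)) \ {x, y})
    ⟨v, hvU⟩ ?_ (by simp) (by simp) ?_ ?_) hvU z hz ⟨hzH, fun h => hzn h.1, hxz.symm, hyz.symm⟩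
  · exact fun u hu => mem_vertexSpan_classUnion.mpr ⟨_, hxyK, hu.1⟩
  · rintro u hu w ⟨f, hf, huw⟩
    have heq : elemClass (stressOn p E) f = elemClass (stressOn p E) s(x, y) := by
      have hmf : f ∈ elemClass (stressOn p E) f := Or.inl rfl
      have key : ∀ t, (t = x ∨ t = y) → t ∈ vertexSpan (elemClass (stressOn p E) f) →
          elemClass (stressOn p E) f = elemClass (stressOn p E) s(x, y) := by
        intro t ht htf
        refine elemClass_eq_of_two hp hl (hK hf) (hK hxyK) (x := u) (y := t) ?_
          (left_mem_vertexSpan huw) hu.1 htf ?_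
        · rintro rfl
          exact hu.2 ht
        · rcases ht with rfl | rfl
          exacts [left_mem_vertexSpan hm, right_mem_vertexSpan hm]
      induction f with
      | _ c d =>
        obtain ⟨hcd, hc, hd⟩ := mem_KK.mp hf
        rcases hP hc with h | h | h
        · exact key c (Or.inl h) (left_mem_vertexSpan hmf)
        · exact key c (Or.inr h) (left_mem_vertexSpan hmf)
        · rcases hP hd with h' | h' | h'
          · exact key d (Or.inl h') (right_mem_vertexSpan hmf)
          · exact key d (Or.inr h') (right_mem_vertexSpan hmf)
          · exact absurd (h.trans h'.symm) hcd
    rw [heq] at huw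
    by_cases h1 : w = x
    · exact Or.inl h1
    by_cases h2 : w = y
    · exact Or.inr (Or.inl h2)
    · exact Or.inr (Or.inr ⟨right_mem_vertexSpan huw, by simp [h1, h2]⟩)
  · exact ⟨z, hzH, fun h => hzn h.1, hxz.symm, hyz.symm⟩

theorem exists_classUnion_eq {p : Pl V} (hp : Generic p) {E : Set (Sym2 V)}
    (hl : Loopless E) {P : Set V} (hK : KK P ⊆ E) (h3 : 3 ≤ P.ncard) {v : V} (hv : v ∉ P)
    (hvH : v ∈ vertexSpan (classUnion p E (KK P)))
    (hsep : ∀ x y U W, x ≠ y → x ∈ P → y ∈ P → Sep (classUnion p E (KK P)) x y U W → v ∈ U →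
      ∀ b ∈ P, b ∉ W) :
    ∃ e ∈ KK P, classUnion p E (KK P) = elemClass (stressOn p E) e := by
  by_cases hadj : ∀ a ∈ P, ∀ b ∈ P, ∀ c ∈ P, a ≠ b → b ≠ c →
      elemClass (stressOn p E) s(a, b) = elemClass (stressOn p E) s(b, c)
  · obtain ⟨a, b, -, ha, hb, -, hab, -, -⟩ := (Set.two_lt_ncard_iff).mp h3
    refine ⟨s(a, b), mem_KK.mpr ⟨hab, ha, hb⟩, Set.Subset.antisymm ?_ fun f hf =>
      ⟨s(a, b), mem_KK.mpr ⟨hab, ha, hb⟩, hf⟩⟩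
    rintro f ⟨g, hg, hf⟩
    induction g with
    | _ c d =>
      obtain ⟨hcd, hc, hd⟩ := mem_KK.mp hg
      by_cases hbc : b = c
      · subst hbc
        rwa [hadj a ha b hb d hd hab hcd]
      · rwa [hadj a ha b hb c hc hab hbc, hadj b hb c hc d hd hbc hcd]
  · push Not at hadj
    obtain ⟨a, ha, b, hb, c, hc, hab, hbc, hne⟩ := hadj
    have hac : a ≠ c := by
      rintro rfl
      exact hne (by rw [Sym2.eq_swap])
    have hKE : ∀ {x y}, x ≠ y → x ∈ P → y ∈ P → s(x, y) ∈ E :=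
      fun h hx hy => hK (mem_KK.mpr ⟨h, hx, hy⟩)
    have hl' : ∀ x y, x ∈ vertexSpan (elemClass (stressOn p E) s(x, y)) :=
      fun x y => left_mem_vertexSpan (B := elemClass (stressOn p E) s(x, y)) (Or.inl rfl)
    have hr' : ∀ x y, y ∈ vertexSpan (elemClass (stressOn p E) s(x, y)) :=
      fun x y => right_mem_vertexSpan (B := elemClass (stressOn p E) s(x, y)) (Or.inl rfl)
    have hcn : c ∉ vertexSpan (elemClass (stressOn p E) s(a, b)) := fun h =>
      hne (elemClass_eq_of_two hp hl (hKE hab ha hb) (hKE hbc hb hc) hbc (hr' a b) (hl' b c) h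
        (hr' b c))
    have han : a ∉ vertexSpan (elemClass (stressOn p E) s(b, c)) := fun h =>
      hne (elemClass_eq_of_two hp hl (hKE hab ha hb) (hKE hbc hb hc) hab (hl' a b) h (hr' a b)
        (hl' b c))
    have hbn : b ∉ vertexSpan (elemClass (stressOn p E) s(a, c)) := fun h => by
      have h1 := elemClass_eq_of_two hp hl (hKE hac ha hc) (hKE hbc hb hc) hbc h (hl' b c)
        (hr' a c) (hr' b c)
      exact han (h1 ▸ hl' a c)
    have hP : P ⊆ {a, b, c} := by
      intro d hd
      by_contra hdn
      simp only [Set.mem_insert_iff, Set.mem_singleton_iff, not_or] at hdn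
      have h1 := mem_vertexSpan_elemClass_of_K4 hp hK ha hb hc hd hab hac hbc hdn.1 hdn.2.1 hdn.2.2
        hcn
      have h2 := mem_vertexSpan_elemClass_of_K4 hp hK hb hc ha hd hbc hab.symm hac.symm hdn.2.1
        hdn.2.2 hdn.1 han
      exact hne (elemClass_eq_of_two hp hl (hKE hab ha hb) (hKE hbc hb hc) hdn.2.1 h1 h2 (hr' a b)
        (hl' b c))
    obtain ⟨f, hf, hvf⟩ := mem_vertexSpan_classUnion.mp hvH
    have n1 := not_mem_vertexSpan_elemClass_of_corner hp hl hK hv hsep ha hb hc hab hac hbc hP hcn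
    have n2 := not_mem_vertexSpan_elemClass_of_corner hp hl hK hv hsep hb hc ha hbc hab.symm
      hac.symm
      (fun d hd => by
        have h := hP hd
        simp only [Set.mem_insert_iff, Set.mem_singleton_iff] at h ⊢
        tauto) han
    have n3 := not_mem_vertexSpan_elemClass_of_corner hp hl hK hv hsep ha hc hb hac hab
      hbc.symm
      (fun d hd => by
        have h := hP hd
        simp only [Set.mem_insert_iff, Set.mem_singleton_iff] at h ⊢
        tauto) hbn
    induction f with
    | _ x y =>
      obtain ⟨hxy, hx, hy⟩ := mem_KK.mp hf
      have hvf' : v ∈ vertexSpan (elemClass (stressOn p E) s(y, x)) := by rwa [Sym2.eq_swap]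
      rcases hP hx with rfl | rfl | rfl <;> rcases hP hy with rfl | rfl | rfl <;>
        first
          | exact absurd rfl hxy
          | exact absurd hvf n1
          | exact absurd hvf n2
          | exact absurd hvf n3
          | exact absurd hvf' n1
          | exact absurd hvf' n2
          | exact absurd hvf' n3

theorem RCon.internallyDisjointPaths {p : Pl V} (hp : GenPos p) {F : Set (Sym2 V)} (hF : RCon p F)
    {v a b : V} (hvb : v ≠ b) (hab : a ≠ b) (hab' : s(a, b) ∈ F) (hv : v ∈ vertexSpan F)
    (hsep : ∀ x y U W, x ≠ y → x ∈ vertexSpan F → y ∈ vertexSpan F → Sep F x y U W → v ∈ U →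
      b ∉ W) :
    InternallyDisjointPaths (SimpleGraph.fromEdgeSet F) v b 3 := by
  by_cases hadj : (SimpleGraph.fromEdgeSet F).Adj v b
  · refine ⟨fun _ => hadj.toWalk, fun _ => ?_, fun i j _ w hi _ => ?_⟩
    · simp [SimpleGraph.Adj.toWalk, SimpleGraph.Walk.cons_isPath_iff, hvb]
    · simpa [SimpleGraph.Adj.toWalk] using hi
  refine internallyDisjointPaths_of_cut hvb hadj fun U hvU hbU hUb => ?_
  by_contra hlt
  have haU : a ∉ U := fun h => hUb a h ((SimpleGraph.fromEdgeSet_adj F).mpr ⟨hab', hab⟩)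
  set T := {w | w ∉ U ∧ ∃ u ∈ U, (SimpleGraph.fromEdgeSet F).Adj u w} with hT
  have hbT : b ∉ T := fun ⟨_, u, hu, h⟩ => hUb u hu h
  obtain ⟨x, y, hxU, hyU, hxb, hyb, hTxy⟩ : ∃ x y, x ∉ U ∧ y ∉ U ∧ x ≠ b ∧ y ≠ b ∧ T ⊆ {x, y} := by
    have h3 : T.ncard = 0 ∨ T.ncard = 1 ∨ T.ncard = 2 := by omega
    rcases h3 with h0 | h1 | h2
    · rw [Set.ncard_eq_zero] at h0
      exact ⟨a, a, haU, haU, hab, hab, by rw [h0]; exact Set.empty_subset _⟩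
    · obtain ⟨t, ht⟩ := Set.ncard_eq_one.mp h1
      have h : t ∈ T := by rw [ht]; rfl
      have htb : t ≠ b := fun e => hbT (e ▸ h)
      exact ⟨t, t, h.1, h.1, htb, htb, by rw [ht]; simp⟩
    · obtain ⟨s, t, -, ht⟩ := Set.ncard_eq_two.mp h2
      have hs' : s ∈ T := by rw [ht]; simp
      have ht' : t ∈ T := by rw [ht]; simp
      exact ⟨s, t, hs'.1, ht'.1, fun e => hbT (e ▸ hs'), fun e => hbT (e ▸ ht'), ht.subset⟩
  have hbW : b ∈ vertexSpan F ∧ b ∉ U ∩ vertexSpan F ∧ b ≠ x ∧ b ≠ y :=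
    ⟨right_mem_vertexSpan hab', fun h => hbU h.1, hxb.symm, hyb.symm⟩
  have hS := Sep.of_no_edge (F := F) (x := x) (y := y) (U := U ∩ vertexSpan F) ⟨v, hvU, hv⟩
    Set.inter_subset_right (fun h => hxU h.1) (fun h => hyU h.1) (fun u hu w huw => by
      by_cases hw : w ∈ U
      · exact Or.inr (Or.inr ⟨hw, right_mem_vertexSpan huw⟩)
      · have hwT : w ∈ T := ⟨hw, u, hu.1, (SimpleGraph.fromEdgeSet_adj F).mpr
          ⟨huw, fun e => hw (e ▸ hu.1)⟩⟩
        rcases hTxy hwT with h | h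
        · exact Or.inl h
        · exact Or.inr (Or.inl h)) ⟨b, hbW⟩
  have hm := hF.sep_mem hp hS
  have hsub : vertexSpan (touch F (U ∩ vertexSpan F)) ⊆ vertexSpan F :=
    vertexSpan_mono fun f hf => hf.1
  exact hsep x y _ _ (hF.sep_ne hp hS) (hsub hm.1) (hsub hm.2) hS ⟨hvU, hv⟩ hbW

theorem UniquelyLocalizable.exists_component {G : SimpleGraph V} {P : Set V} {v : V} (hv : v ∉ P)
    (h : UniquelyLocalizable G P v) :
    3 ≤ P.ncard ∧ ∃ F : Set (Sym2 V), IsRdComponent 2 (addClique G P) F ∧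
      P ∪ {v} ⊆ vertexSpan F ∧
      ∀ b ∈ P, InternallyDisjointPaths (SimpleGraph.fromEdgeSet F) v b 3 := by
  have h3 := h.three_le_ncard hv
  refine ⟨h3, ?_⟩
  obtain ⟨p, hp, -⟩ := exists_generic_near (0 : Pl V) one_pos
  set E := (addClique G P).edgeSet with hE
  have hl : Loopless E := loopless_edgeSet _
  have hGE : G.edgeSet ⊆ E := fun f hf => mem_addClique.mpr (Or.inl hf)
  have hK : KK P ⊆ E := fun f hf => mem_addClique.mpr (Or.inr hf)
  have hHE := classUnion_subset (p := p) hK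
  have hKH := subset_classUnion p E (KK P)
  have hs := isSeparator_classUnion p E (KK P)
  have hr := rigidOn_classUnion hp hl hK
  have hex : ∀ b ∈ P, ∃ a ∈ P, a ≠ b := fun b _ =>
    Set.exists_ne_of_one_lt_ncard (by omega) b
  have hP : P ⊆ vertexSpan (classUnion p E (KK P)) := by
    intro b hb
    obtain ⟨a, ha, hab⟩ := hex b hb
    exact right_mem_vertexSpan (hKH (mem_KK.mpr ⟨hab, ha, hb⟩))
  have hvH := h.mem_vertexSpan hp hHE hGE hs hr hP
  have hsep := fun (x y : V) (U W : Set V) (hxy : x ≠ y) hx hy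
    (hS : Sep (classUnion p E (KK P)) x y U W) (hvU : v ∈ U) =>
    h.unSep hp hHE hGE hs hr hP hKH hxy hx hy hS hvU
  obtain ⟨e, he, heq⟩ := exists_classUnion_eq hp hl hK h3 hv hvH fun x y U W hxy hx hy =>
    hsep x y U W hxy (hP hx) (hP hy)
  rw [heq] at hP hvH hsep hKH
  refine ⟨elemClass (stressOn p E) e, (isRdComponent_iff hp _ _).mpr ⟨e, hK he, rfl⟩,
    Set.union_subset hP (Set.singleton_subset_iff.mpr hvH), fun b hb => ?_⟩
  obtain ⟨a, ha, hab⟩ := hex b hb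
  exact (rCon_elemClass (hK he)).internallyDisjointPaths hp.genPos (fun e => hv (e ▸ hb)) hab
    (hKH (mem_KK.mpr ⟨hab, ha, hb⟩)) hvH fun x y U W hxy hx hy hS hvU =>
    hsep x y U W hxy hx hy hS hvU b hb

end Necessity

/-- `v ∈ V ∖ P` is uniquely localizable in `G` with respect to `P` in `ℝ²` iff
`|P| ≥ 3` and some `ℛ₂`-component `H` of `G+K(P)` satisfies `P ∪ {v} ⊆ V(H)` and
`κ_H(v,b) ≥ 3` for all `b ∈ P`. -/
theorem uniquely_localizable_iff {V : Type*} [Fintype V] [DecidableEq V]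
    (G : SimpleGraph V) (P : Set V) (v : V) (hv : v ∉ P) :
    UniquelyLocalizable G P v ↔
      (3 ≤ P.ncard ∧ ∃ F : Set (Sym2 V), IsRdComponent 2 (addClique G P) F ∧
        P ∪ {v} ⊆ vertexSpan F ∧
        ∀ b ∈ P, InternallyDisjointPaths (SimpleGraph.fromEdgeSet F) v b 3) := by
  exact ⟨fun h => h.exists_component hv, fun ⟨h3, F, hF, hPF, hpath⟩ =>
    uniquelyLocalizable_of_component hv h3 hF hPF hpath⟩

end Rigidity
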